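/- arXiv:1708.04932 — 14 statements merged into one kernel-verified Lean document; each statement's English description precedes it below -/
import Mathlib

section
/- For c ∈ ℚ, the polynomial x⁶ + c⁶ − 1 ∈ ℚ[x] is reducible over ℚ if and only if c ∈ {0, 1, −1}. -/
open Polynomial

theorem Int.exists_eq_pow_of_isCoprime_of_mul_eq_pow {a b c : ℤ} {k : ℕ} (hk : Even k)
    (ha : 0 ≤ a) (hab : IsCoprime a b) (h : a * b = c ^ k) : ∃ d, a = d ^ k := by
  obtain ⟨d, hd⟩ := exists_associated_pow_of_mul_eq_pow
    ((gcd_isUnit_iff a b).mpr hab) h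
  rcases Int.associated_iff.mp hd with hd | hd
  · exact ⟨d, hd.symm⟩
  · have := hk.pow_nonneg d
    exact ⟨d, by omega⟩

theorem Int.exists_fourth_powers_of_mul_eq_three_mul_fourth_pow_of_dvd {a b f : ℤ}
    (ha : 0 ≤ a) (hb : 0 ≤ b) (hab : IsCoprime a b) (h : a * b = 3 * f ^ 4) (h3 : 3 ∣ b) :
    ∃ m n, a = m ^ 4 ∧ b = 3 * n ^ 4 ∧ f = m * n := by
  obtain ⟨b, rfl⟩ := h3
  have h' : a * b = f ^ 4 := by linarith
  have hab' : IsCoprime a b := hab.of_mul_right_right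
  have four : Even 4 := by decide
  obtain ⟨m, rfl⟩ := Int.exists_eq_pow_of_isCoprime_of_mul_eq_pow four ha hab' h'
  obtain ⟨n, rfl⟩ := Int.exists_eq_pow_of_isCoprime_of_mul_eq_pow four (by omega) hab'.symm
    (by rw [mul_comm]; exact h')
  rw [← mul_pow] at h'
  rcases (pow_eq_pow_iff_of_ne_zero four_ne_zero).mp h' with h' | ⟨h', -⟩
  · exact ⟨m, n, rfl, rfl, h'.symm⟩
  · exact ⟨m, -n, rfl, by ring, by linarith⟩

theorem Int.exists_fourth_powers_of_mul_eq_three_mul_fourth_pow {a b f : ℤ}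
    (ha : 0 ≤ a) (hb : 0 ≤ b) (hab : IsCoprime a b) (h : a * b = 3 * f ^ 4) :
    (∃ m n, a = m ^ 4 ∧ b = 3 * n ^ 4 ∧ f = m * n) ∨
      ∃ m n, b = m ^ 4 ∧ a = 3 * n ^ 4 ∧ f = m * n := by
  rcases Int.prime_three.dvd_or_dvd (Dvd.intro _ h.symm) with h3 | h3
  · exact .inr (exists_fourth_powers_of_mul_eq_three_mul_fourth_pow_of_dvd hb ha hab.symm
      (by rw [mul_comm]; exact h) h3)
  · exact .inl (exists_fourth_powers_of_mul_eq_three_mul_fourth_pow_of_dvd ha hb hab h h3)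

theorem Int.isCoprime_of_mul_eq_three_mul_fourth_pow {a b f x y : ℤ} (hf : f ≠ 0)
    (h : a * b = 3 * f ^ 4) (hc : IsCoprime (x * a + y * b) f) : IsCoprime a b := by
  refine isCoprime_of_prime_dvd (fun h0 => ?_) fun p hp hpa hpb => ?_
  · have : f ^ 4 = 0 := by rw [h0.1] at h; linarith
    exact hf (by simpa using this)
  · have hpf : p ∣ f := by
      by_contra hpf
      have hcop : IsCoprime (p * p) (f ^ 4) :=
        (((Prime.coprime_iff_not_dvd hp).mpr hpf).mul_left
          ((Prime.coprime_iff_not_dvd hp).mpr hpf)).pow_right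
      have : p * p ∣ 3 := hcop.dvd_of_dvd_mul_right (h ▸ mul_dvd_mul hpa hpb)
      exact hp.not_isUnit (Int.prime_three.irreducible.squarefree p this)
    exact hp.not_isUnit (hc.isUnit_of_dvd'
      (dvd_add (hpa.mul_left x) (hpb.mul_left y)) hpf)

theorem Int.two_dvd_of_sq_eq_quartic {s e t : ℤ}
    (h : t ^ 2 = s ^ 4 + 3 * s ^ 2 * e ^ 2 + 3 * e ^ 4) : 2 ∣ e := by
  have key : ∀ s e t : ZMod 4, t ^ 2 = s ^ 4 + 3 * s ^ 2 * e ^ 2 + 3 * e ^ 4 → 2 * e = 0 := by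
    decide
  have := key s e t (by exact_mod_cast congrArg (Int.cast : ℤ → ZMod 4) h)
  have : ((2 * e : ℤ) : ZMod 4) = 0 := by exact_mod_cast this
  have := (ZMod.intCast_zmod_eq_zero_iff_dvd _ 4).mp this
  omega

theorem Int.two_dvd_of_odd_sq_eq_quartic {s g h : ℤ} (hs : Odd s)
    (H : s ^ 2 = g ^ 4 - 6 * g ^ 2 * h ^ 2 - 3 * h ^ 4) : 2 ∣ h := by
  have key : ∀ s g h : ZMod 8, s ^ 2 = g ^ 4 - 6 * g ^ 2 * h ^ 2 - 3 * h ^ 4 →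
      4 * s = 0 ∨ 4 * h = 0 := by
    decide
  obtain ⟨k, hk⟩ := hs
  rcases key s g h (by exact_mod_cast congrArg (Int.cast : ℤ → ZMod 8) H) with h0 | h0
  · have : ((4 * s : ℤ) : ZMod 8) = 0 := by exact_mod_cast h0
    have := (ZMod.intCast_zmod_eq_zero_iff_dvd _ 8).mp this
    omega
  · have : ((4 * h : ℤ) : ZMod 8) = 0 := by exact_mod_cast h0
    have := (ZMod.intCast_zmod_eq_zero_iff_dvd _ 8).mp this
    omega

/-- First half of the descent, corresponding to a 2-isogeny. -/
theorem Int.exists_of_sq_eq_quartic {s e t : ℤ} (he : e ≠ 0) (hc : IsCoprime s e)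
    (h : t ^ 2 = s ^ 4 + 3 * s ^ 2 * e ^ 2 + 3 * e ^ 4) :
    Odd s ∧ ∃ g h, e = 2 * (g * h) ∧ IsCoprime g h ∧
      s ^ 2 = g ^ 4 - 6 * g ^ 2 * h ^ 2 - 3 * h ^ 4 := by
  wlog ht : 0 ≤ t generalizing t
  · exact this (t := -t) (by rw [neg_sq]; exact h) (by omega)
  obtain ⟨f, rfl⟩ := two_dvd_of_sq_eq_quartic h
  have hs : Odd s := by
    rw [← Int.not_even_iff_odd, even_iff_two_dvd]
    intro hs
    exact Int.prime_two.not_isUnit (hc.isUnit_of_dvd' hs (dvd_mul_right _ _))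
  refine ⟨hs, ?_⟩
  have hf : f ≠ 0 := by rintro rfl; simp at he
  have hsf : IsCoprime s f := hc.of_mul_right_right
  have htodd : Odd t := by
    have : Odd (t ^ 2) := by
      rw [h]
      obtain ⟨k, hk⟩ := hs.pow (n := 4)
      exact ⟨k + 6 * s ^ 2 * f ^ 2 + 24 * f ^ 4, by rw [hk]; ring⟩
    exact (Int.odd_pow' two_ne_zero).mp this
  obtain ⟨k, hk⟩ := hs
  obtain ⟨l, hl⟩ := htodd
  obtain ⟨a, ha⟩ : ∃ a, 2 * a = t - s ^ 2 - 6 * f ^ 2 :=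
    ⟨l - 2 * k ^ 2 - 2 * k - 3 * f ^ 2, by rw [hk, hl]; ring⟩
  obtain ⟨b, hb⟩ : ∃ b, b = a + s ^ 2 + 6 * f ^ 2 := ⟨_, rfl⟩
  have hab : a * b = 3 * f ^ 4 := by
    have ht' : t = 2 * a + s ^ 2 + 6 * f ^ 2 := by linarith
    rw [ht'] at h
    rw [hb]
    linarith
  have hf4 : 0 < f ^ 4 := by positivity
  have hsum : 0 ≤ a + b := by linarith
  have hpos : 0 ≤ a ∧ 0 ≤ b := by
    constructor <;> nlinarith
  have hcop : IsCoprime a b := by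
    refine isCoprime_of_mul_eq_three_mul_fourth_pow (x := -1) (y := 1) hf hab ?_
    have : -1 * a + 1 * b = s ^ 2 + f * (6 * f) := by rw [hb]; ring
    rw [this]
    exact hsf.pow_left.add_mul_left_left _
  rcases exists_fourth_powers_of_mul_eq_three_mul_fourth_pow hpos.1 hpos.2 hcop hab with
    ⟨m, n, rfl, rfl, rfl⟩ | ⟨m, n, rfl, rfl, rfl⟩
  · exfalso
    have hs2 : s ^ 2 + m ^ 4 = 3 * (n ^ 4 - 2 * m ^ 2 * n ^ 2) := by linarith
    have key : ∀ s m : ZMod 3, s ^ 2 + m ^ 4 = 0 → m = 0 := by decide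
    have h0 := congrArg (Int.cast : ℤ → ZMod 3) hs2
    push_cast at h0
    rw [show (3 : ZMod 3) = 0 from rfl, zero_mul] at h0
    have h3 := (ZMod.intCast_zmod_eq_zero_iff_dvd m 3).mp (key _ _ h0)
    exact Int.prime_three.not_isUnit
      (hcop.isUnit_of_dvd' (dvd_pow h3 four_ne_zero) (dvd_mul_right _ _))
  · refine ⟨m, n, rfl, ?_, by linarith⟩
    exact (IsCoprime.pow_iff (by norm_num) (by norm_num)).mp hcop.of_mul_left_right.symm

/-- Second half of the descent, corresponding to the dual 2-isogeny. -/
theorem Int.exists_of_odd_sq_eq_quartic {s g h : ℤ} (hs : Odd s) (hh : h ≠ 0)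
    (hc : IsCoprime g h) (H : s ^ 2 = g ^ 4 - 6 * g ^ 2 * h ^ 2 - 3 * h ^ 4) :
    ∃ m n, h = m * n ∧ IsCoprime m n ∧ g ^ 2 = m ^ 4 + 3 * m ^ 2 * n ^ 2 + 3 * n ^ 4 := by
  obtain ⟨i, rfl⟩ := two_dvd_of_odd_sq_eq_quartic hs H
  have hg : Odd g := by
    rw [← Int.not_even_iff_odd, even_iff_two_dvd]
    intro hg
    exact Int.prime_two.not_isUnit (hc.isUnit_of_dvd' hg (dvd_mul_right _ _))
  obtain ⟨k, hk⟩ := hs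
  obtain ⟨j, hj⟩ := hg
  obtain ⟨a, ha⟩ : ∃ a, 2 * a = g ^ 2 - 3 * (2 * i) ^ 2 - s :=
    ⟨2 * j ^ 2 + 2 * j - 6 * i ^ 2 - k, by rw [hk, hj]; ring⟩
  generalize 2 * i = h at *
  obtain ⟨b, hb⟩ : ∃ b, b = a + s := ⟨_, rfl⟩
  have hsum : a + b = g ^ 2 - 3 * h ^ 2 := by linarith
  have hab : a * b = 3 * h ^ 4 := by
    have hs' : s = b - a := by linarith
    have hg' : g ^ 2 = a + b + 3 * h ^ 2 := by linarith
    have : s ^ 2 = (g ^ 2) ^ 2 - 6 * g ^ 2 * h ^ 2 - 3 * h ^ 4 := by rw [H]; ring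
    rw [hs', hg'] at this
    linarith
  have hh4 : 0 < h ^ 4 := by positivity
  have hsum0 : 0 ≤ a + b := by
    by_contra! hneg
    have h1 : 0 ≤ a + b + 3 * h ^ 2 := by rw [hsum]; nlinarith [sq_nonneg g]
    nlinarith [sq_nonneg (a - b), mul_nonneg h1 (sq_nonneg h)]
  have hpos : 0 ≤ a ∧ 0 ≤ b := by
    constructor <;> nlinarith
  have hcop : IsCoprime a b := by
    refine isCoprime_of_mul_eq_three_mul_fourth_pow (x := 1) (y := 1) hh hab ?_
    have : 1 * a + 1 * b = g ^ 2 + h * (-3 * h) := by linarith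
    rw [this]
    exact hc.pow_left.add_mul_left_left _
  rcases exists_fourth_powers_of_mul_eq_three_mul_fourth_pow hpos.1 hpos.2 hcop hab with
    ⟨m, n, rfl, rfl, rfl⟩ | ⟨m, n, rfl, rfl, rfl⟩
  · exact ⟨m, n, rfl, (IsCoprime.pow_iff (by norm_num) (by norm_num)).mp
      hcop.of_mul_right_right, by linarith⟩
  · exact ⟨m, n, rfl, (IsCoprime.pow_iff (by norm_num) (by norm_num)).mp
      hcop.of_mul_left_right.symm, by linarith⟩

theorem Int.eq_zero_of_sq_eq_quartic {s e t : ℤ} (hc : IsCoprime s e)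
    (h : t ^ 2 = s ^ 4 + 3 * s ^ 2 * e ^ 2 + 3 * e ^ 4) : e = 0 := by
  induction hN : e.natAbs using Nat.strong_induction_on generalizing s e t with
  | _ N ih =>
  by_contra he
  obtain ⟨hs, g, k, rfl, hgk, H⟩ := exists_of_sq_eq_quartic he hc h
  have hgk0 : g ≠ 0 ∧ k ≠ 0 := by simpa using he
  obtain ⟨m, n, rfl, hmn, H'⟩ := exists_of_odd_sq_eq_quartic hs hgk0.2 hgk H
  have hmn0 : m ≠ 0 ∧ n ≠ 0 := by simpa using hgk0.2
  refine hmn0.2 (ih n.natAbs ?_ hmn H' rfl)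
  rw [← hN]
  simp only [Int.natAbs_mul, Int.reduceAbs]
  have h1 := Int.natAbs_pos.mpr hgk0.1
  have h2 := Int.natAbs_pos.mpr hmn0.1
  have h3 := Int.natAbs_pos.mpr hmn0.2
  have h4 := Nat.mul_pos h1 h2
  show _ < 2 * (_ * _)
  nlinarith [Nat.mul_le_mul_right n.natAbs h4]

theorem Int.eq_zero_or_sq_eq_sq_of_sixth_pow_add_sq {p q r : ℤ} (hq : q ≠ 0)
    (hc : IsCoprime p q) (h : p ^ 6 + r ^ 2 = q ^ 6) : p = 0 ∨ p ^ 2 = q ^ 2 := by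
  obtain ⟨a, ha⟩ : ∃ a, a = q ^ 2 - p ^ 2 := ⟨_, rfl⟩
  have hprod : a * (a ^ 2 + 3 * p ^ 2 * q ^ 2) = r ^ 2 := by
    rw [ha]; linarith
  have hap : IsCoprime a p := by
    have := (hc.symm.pow_left (m := 2)).add_mul_left_left (-p)
    rwa [show q ^ 2 + p * -p = a by rw [ha]; ring] at this
  have haq : IsCoprime a q := by
    have := (hc.pow_left (m := 2)).neg_left.add_mul_left_left q
    rwa [show -p ^ 2 + q * q = a by rw [ha]; ring] at this
  have hapq : IsCoprime a (p ^ 2 * q ^ 2) := hap.pow_right.mul_right haq.pow_right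
  have hpq : 0 ≤ p ^ 2 * q ^ 2 := by positivity
  have ha0 : 0 ≤ a := by
    by_contra! hneg
    have : 0 < a ^ 2 + 3 * p ^ 2 * q ^ 2 := by nlinarith
    nlinarith [sq_nonneg r]
  by_cases h3 : 3 ∣ a
  · right
    obtain ⟨a, rfl⟩ := h3
    have hr : (3 : ℤ) ∣ r := Int.prime_three.dvd_of_dvd_pow
      (n := 2) ⟨a * (9 * a ^ 2 + 3 * p ^ 2 * q ^ 2), by rw [← hprod]; ring⟩
    obtain ⟨r, rfl⟩ := hr
    have hprod' : a * (p ^ 2 * q ^ 2 + a * (3 * a)) = r ^ 2 := by linarith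
    have hcop : IsCoprime a (p ^ 2 * q ^ 2 + a * (3 * a)) :=
      hapq.of_mul_left_right.add_mul_left_right _
    obtain ⟨u, rfl⟩ := exists_eq_pow_of_isCoprime_of_mul_eq_pow even_two (by omega) hcop hprod'
    obtain ⟨v, hv⟩ := exists_eq_pow_of_isCoprime_of_mul_eq_pow even_two
      (by positivity) hcop.symm (by rw [mul_comm]; exact hprod')
    have hq2 : q ^ 2 = p ^ 2 + 3 * u ^ 2 := by linarith
    rw [hq2] at hv
    have hu := eq_zero_of_sq_eq_quartic (s := p) (e := u) (t := v)
      ((IsCoprime.pow_left_iff two_pos).mp hap.of_mul_left_right).symm (by rw [← hv]; ring)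
    rw [hq2, hu]; ring
  · left
    have ha3 : IsCoprime a 3 := ((Prime.coprime_iff_not_dvd Int.prime_three).mpr h3).symm
    have hcop : IsCoprime a (a ^ 2 + 3 * p ^ 2 * q ^ 2) := by
      have := (ha3.mul_right hapq).add_mul_left_right a
      rwa [show 3 * (p ^ 2 * q ^ 2) + a * a = a ^ 2 + 3 * p ^ 2 * q ^ 2 by ring] at this
    obtain ⟨u, rfl⟩ := exists_eq_pow_of_isCoprime_of_mul_eq_pow even_two ha0 hcop hprod
    obtain ⟨v, hv⟩ := exists_eq_pow_of_isCoprime_of_mul_eq_pow even_two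
      (by positivity) hcop.symm (by rw [mul_comm]; exact hprod)
    have hq2 : q ^ 2 = p ^ 2 + u ^ 2 := by linarith
    rw [mul_assoc, hq2] at hv
    exact eq_zero_of_sq_eq_quartic (s := u) (e := p) (t := v)
      ((IsCoprime.pow_left_iff two_pos).mp hap) (by rw [← hv]; ring)

theorem Rat.eq_zero_or_one_or_neg_one_of_sixth_pow_add_sq {b c : ℚ} (h : c ^ 6 + b ^ 2 = 1) :
    c = 0 ∨ c = 1 ∨ c = -1 := by
  have hq : (c.den : ℚ) ≠ 0 := by exact_mod_cast c.den_ne_zero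
  have hcd : c * c.den = c.num := Rat.mul_den_eq_num c
  have hsq : IsSquare (((c.den : ℤ) ^ 6 - c.num ^ 6 : ℤ) : ℚ) := by
    refine ⟨b * c.den ^ 3, ?_⟩
    push_cast
    rw [← hcd]
    linear_combination -(c.den : ℚ) ^ 6 * h
  obtain ⟨r, hr⟩ := Rat.isSquare_intCast_iff.mp hsq
  have hcop : IsCoprime c.num (c.den : ℤ) := Rat.isCoprime_num_den c
  rcases Int.eq_zero_or_sq_eq_sq_of_sixth_pow_add_sq (r := r)
    (by exact_mod_cast c.den_ne_zero) hcop (by linarith) with h0 | h0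
  · exact .inl (Rat.num_eq_zero.mp h0)
  · right
    have : (c.num : ℚ) ^ 2 = (c.den : ℚ) ^ 2 := by exact_mod_cast h0
    rw [← hcd, mul_pow] at this
    exact sq_eq_one_iff.mp (mul_right_cancel₀ (pow_ne_zero 2 hq) (by rw [this, one_mul]))

theorem Polynomial.X_pow_six_sub_C_irreducible {K : Type*} [Field K] {a : K}
    (h2 : ∀ b : K, b ^ 2 ≠ a) (h3 : ∀ b : K, b ^ 3 ≠ a) : Irreducible (X ^ 6 - C a) := by
  have hsq := X_pow_sub_C_irreducible_of_prime Nat.prime_two h2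
  refine X_pow_mul_sub_C_irreducible (n := 3) (m := 2) hsq fun E _ _ x hx => ?_
  have hint : IsIntegral K x := not_not.mp fun h => by
    simpa only [degree_zero, degree_X_pow_sub_C Nat.prime_two.pos,
      WithBot.natCast_ne_bot] using congr_arg degree (hx.symm.trans (dif_neg h))
  refine X_pow_sub_C_irreducible_of_prime Nat.prime_three fun b hb => ?_
  have hnorm : Algebra.norm K (IntermediateField.AdjoinSimple.gen K x) = -a := by
    rw [← IntermediateField.adjoin.powerBasis_gen hint,
      Algebra.PowerBasis.norm_gen_eq_coeff_zero_minpoly]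
    simp [IntermediateField.minpoly_gen, hx]
  refine h3 (-Algebra.norm K b) ?_
  rw [Odd.neg_pow (by decide), ← map_pow, hb, hnorm, neg_neg]

/-- For `c ∈ ℚ`, the polynomial `x⁶ + c⁶ − 1 ∈ ℚ[x]` is reducible over `ℚ`
if and only if `c ∈ {0, 1, −1}`. -/
theorem stmt_5 (c : ℚ) :
    ¬ Irreducible (X ^ 6 + C (c ^ 6 - 1) : ℚ[X]) ↔ c = 0 ∨ c = 1 ∨ c = -1 := by
  have hpoly : (X ^ 6 + C (c ^ 6 - 1) : ℚ[X]) = X ^ 6 - C (1 - c ^ 6) := by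
    simp only [map_sub]; ring
  rw [hpoly]
  constructor
  · contrapose!
    intro hc
    refine X_pow_six_sub_C_irreducible (fun b hb => ?_) fun b hb => ?_
    · have := Rat.eq_zero_or_one_or_neg_one_of_sixth_pow_add_sq (b := b) (c := c) (by linarith)
      tauto
    · have hb0 : b ≠ 0 := by
        rintro rfl
        have := Rat.eq_zero_or_one_or_neg_one_of_sixth_pow_add_sq (b := 0) (c := c) (by linarith)
        tauto
      exact fermatLastTheoremFor_iff_rat.mp fermatLastTheoremThree (c ^ 2) b 1
        (pow_ne_zero 2 hc.1) hb0 one_ne_zero (by rw [hb]; ring)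
  · intro hc h
    obtain ⟨b, hb⟩ : ∃ b : ℚ, b ^ 2 = 1 - c ^ 6 := by
      rcases hc with rfl | rfl | rfl
      · exact ⟨1, by norm_num⟩
      · exact ⟨0, by norm_num⟩
      · exact ⟨0, by norm_num⟩
    exact pow_ne_of_irreducible_X_pow_sub_C h (m := 2) (by norm_num) (by norm_num) b hb
end

section
/- The only rational solution (u,v) ∈ ℚ × ℚ of the equation v² = 3(u³ − 1) is (u,v) = (1, 0). -/
theorem Int.exists_eq_sq_of_isCoprime {x y z : ℤ} (hx : 0 < x) (hxy : IsCoprime x y)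
    (h : x * y = z ^ 2) : ∃ a, x = a ^ 2 := by
  obtain ⟨a, ha | ha⟩ := Int.sq_of_isCoprime hxy h
  · exact ⟨a, ha⟩
  · nlinarith [sq_nonneg a]

theorem Int.exists_eq_pow_four_of_isCoprime {x y z : ℤ} (hx : 0 < x) (hy : 0 < y)
    (hxy : IsCoprime x y) (h : x * y = z ^ 4) :
    ∃ d e, x = d ^ 4 ∧ y = e ^ 4 ∧ z ^ 2 = d ^ 2 * e ^ 2 := by
  have key : ∀ {x y : ℤ}, 0 < x → 0 < y → IsCoprime x y → x * y = z ^ 4 → ∃ d, x = d ^ 4 := by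
    intro x y hx hy hxy h
    obtain ⟨a, rfl⟩ := exists_eq_sq_of_isCoprime hx hxy (z := z ^ 2) (by rw [h]; ring)
    obtain ⟨b, rfl⟩ := exists_eq_sq_of_isCoprime hy hxy.symm (z := z ^ 2) (by linear_combination h)
    have ha : a ≠ 0 := by rintro rfl; simp at hx
    have hb : b ≠ 0 := by rintro rfl; simp at hy
    have hab : |a| * |b| = z ^ 2 := by
      rw [← abs_mul, ← abs_of_nonneg (sq_nonneg z), ← sq_eq_sq_iff_abs_eq_abs]
      linear_combination h
    have hco : IsCoprime |a| |b| := by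
      rw [IsCoprime.abs_abs_iff]
      exact (IsCoprime.pow_iff two_pos two_pos).1 hxy
    obtain ⟨d, hd⟩ := exists_eq_sq_of_isCoprime (abs_pos.2 ha) hco hab
    exact ⟨d, by rw [← sq_abs, hd]; ring⟩
  obtain ⟨d, rfl⟩ := key hx hy hxy h
  obtain ⟨e, rfl⟩ := key hy hx hxy.symm (by linear_combination h)
  refine ⟨d, e, rfl, rfl, ?_⟩
  rw [← abs_of_nonneg (sq_nonneg z), ← abs_of_nonneg (by positivity : 0 ≤ d ^ 2 * e ^ 2),
    ← sq_eq_sq_iff_abs_eq_abs]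
  linear_combination -h

theorem Int.exists_pow_four_of_mul_eq {P Q B a α β γ : ℤ} (hP : 0 < P) (hQ : 0 < Q)
    (h : P * Q = 27 * B ^ 4) (hco : IsCoprime a B) (ha : ¬ 3 ∣ a)
    (hlin : a ^ 2 = α * P + β * Q + 9 * γ * B ^ 2) :
    ∃ d e, B ^ 2 = d ^ 2 * e ^ 2 ∧
      (P = 27 * d ^ 4 ∧ Q = e ^ 4 ∨ P = e ^ 4 ∧ Q = 27 * d ^ 4) := by
  have hPQ : IsCoprime P Q := by
    refine isCoprime_of_prime_dvd (fun h => hP.ne' h.1) fun p hp hpP hpQ => ?_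
    have h3B : p ∣ 3 ∨ p ∣ B := by
      have : p ∣ 3 ^ 3 * B ^ 4 := by
        have := hpP.mul_right Q
        rwa [h] at this
      exact (hp.dvd_or_dvd this).imp hp.dvd_of_dvd_pow hp.dvd_of_dvd_pow
    have hpa : p ∣ a := by
      refine hp.dvd_of_dvd_pow (n := 2) ?_
      rw [hlin]
      refine dvd_add (dvd_add (hpP.mul_left _) (hpQ.mul_left _)) ?_
      rcases h3B with h | h
      · exact (h.mul_right (3 * γ * B ^ 2)).trans (dvd_of_eq (by ring))
      · exact (h.mul_right (9 * γ * B)).trans (dvd_of_eq (by ring))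
    rcases h3B with h | h
    · exact ha (((hp.associated_of_dvd Int.prime_three h).symm.dvd).trans hpa)
    · exact hp.not_isUnit (hco.isUnit_of_dvd' hpa h)
  have key : ∀ {P Q : ℤ}, 0 < P → 0 < Q → IsCoprime P Q → P * Q = 27 * B ^ 4 → 3 ∣ P →
      ∃ d e, B ^ 2 = d ^ 2 * e ^ 2 ∧ P = 27 * d ^ 4 ∧ Q = e ^ 4 := by
    intro P Q hP hQ hPQ h h3
    have h27 : (27 : ℤ) ∣ P := by
      have : IsCoprime ((3 : ℤ) ^ 3) Q := (hPQ.of_isCoprime_of_dvd_left h3).pow_left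
      norm_num at this
      exact this.dvd_of_dvd_mul_right ⟨_, h⟩
    obtain ⟨R, rfl⟩ := h27
    obtain ⟨d, e, rfl, rfl, hB⟩ := exists_eq_pow_four_of_isCoprime (z := B)
      (by lia : 0 < R) hQ hPQ.of_mul_left_right (by linarith)
    exact ⟨d, e, hB, rfl, rfl⟩
  have h3 : 3 ∣ P * Q := ⟨9 * B ^ 4, by rw [h]; ring⟩
  rcases Int.prime_three.dvd_or_dvd h3 with h3 | h3
  · obtain ⟨d, e, hB, h1, h2⟩ := key hP hQ hPQ h h3
    exact ⟨d, e, hB, Or.inl ⟨h1, h2⟩⟩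
  · obtain ⟨d, e, hB, h1, h2⟩ := key hQ hP hPQ.symm (by linarith) h3
    exact ⟨d, e, hB, Or.inr ⟨h2, h1⟩⟩

theorem Int.sq_emod_three_of_not_dvd {a : ℤ} (ha : ¬ 3 ∣ a) : a ^ 2 % 3 = 1 := by
  have : a % 3 = 1 ∨ a % 3 = 2 := by lia
  rcases this with h | h <;> simp [pow_two, Int.mul_emod, h]

theorem ZMod.four_mul_intCast_eq_zero_iff {a : ℤ} : 4 * (a : ZMod 8) = 0 ↔ Even a := by
  have := ZMod.intCast_zmod_eq_zero_iff_dvd (4 * a) 8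
  push_cast at this
  rw [this, Int.even_iff]
  lia

theorem ZMod.four_mul_intCast_eq_four_iff {a : ℤ} : 4 * (a : ZMod 8) = 4 ↔ Odd a := by
  have := ZMod.intCast_zmod_eq_zero_iff_dvd (4 * a - 4) 8
  push_cast at this
  rw [← sub_eq_zero, this, Int.odd_iff]
  lia

theorem Int.exists_quartic_covering {a b c : ℤ} (hco : IsCoprime a b) (ha : ¬ 3 ∣ a)
    (hb : b ≠ 0) (h : a ^ 4 + 9 * a ^ 2 * b ^ 2 + 27 * b ^ 4 = c ^ 2) :
    ∃ d e, Odd a ∧ b ^ 2 = 4 * (d ^ 2 * e ^ 2) ∧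
      a ^ 2 = e ^ 4 - 18 * d ^ 2 * e ^ 2 - 27 * d ^ 4 := by
  wlog hc : 0 ≤ c generalizing c
  · exact this (c := -c) (by linarith [neg_sq c]) (by lia)
  obtain ⟨haodd, ⟨B, hbB⟩, hcodd⟩ : Odd a ∧ Even b ∧ Odd c := by
    have h8 := congrArg (Int.cast : ℤ → ZMod 8) h
    push_cast at h8
    have key : ∀ a b c : ZMod 8, a ^ 4 + 9 * a ^ 2 * b ^ 2 + 27 * b ^ 4 = c ^ 2 →
        4 * a = 0 ∧ 4 * b = 0 ∨ 4 * a = 4 ∧ 4 * b = 0 ∧ 4 * c = 4 := by decide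
    rcases key _ _ _ h8 with ⟨ha', hb'⟩ | ⟨ha', hb', hc'⟩
    · rw [ZMod.four_mul_intCast_eq_zero_iff] at ha' hb'
      exact absurd (hco.isUnit_of_dvd' ha'.two_dvd hb'.two_dvd) Int.prime_two.not_isUnit
    · rw [ZMod.four_mul_intCast_eq_four_iff] at ha' hc'
      rw [ZMod.four_mul_intCast_eq_zero_iff] at hb'
      exact ⟨ha', hb', hc'⟩
  obtain rfl : b = 2 * B := by lia
  have hB : B ≠ 0 := by rintro rfl; simp at hb
  obtain ⟨P, hP⟩ : ∃ P, c = a ^ 2 + 18 * B ^ 2 + 2 * P := by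
    obtain ⟨k, hk⟩ := haodd.pow (n := 2)
    obtain ⟨l, hl⟩ := hcodd
    exact ⟨l - k - 9 * B ^ 2, by rw [hk, hl]; ring⟩
  obtain ⟨Q, hQ⟩ : ∃ Q, Q = P + a ^ 2 + 18 * B ^ 2 := ⟨_, rfl⟩
  have hPQ : P * Q = 27 * B ^ 4 := by
    subst hP hQ
    linarith
  have hB4 : 0 < B ^ 4 := by positivity
  have hP0 : 0 < P := by
    by_contra hP0
    have : Q < 0 := by nlinarith
    lia
  have hQ0 : 0 < Q := pos_of_mul_pos_right (by lia : 0 < P * Q) hP0.le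
  obtain ⟨d, e, hde, ⟨rfl, rfl⟩ | ⟨rfl, rfl⟩⟩ :=
    exists_pow_four_of_mul_eq (α := -1) (β := 1) (γ := -2) hP0 hQ0 hPQ hco.of_mul_right_right ha
      (by lia)
  · exact ⟨d, e, haodd, by linarith, by linarith⟩
  · have h1 := sq_emod_three_of_not_dvd ha
    have h2 : e ^ 4 % 3 = 0 ∨ e ^ 4 % 3 = 1 := by
      by_cases h3 : 3 ∣ e
      · exact Or.inl (Int.emod_eq_zero_of_dvd (dvd_pow h3 (by simp)))
      · have h4 := sq_emod_three_of_not_dvd h3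
        exact Or.inr (by rw [show e ^ 4 = e ^ 2 * e ^ 2 by ring, Int.mul_emod, h4]; rfl)
    lia

theorem Int.exists_quartic_of_covering {a d e : ℤ} (haodd : Odd a) (hco : IsCoprime e d)
    (he : ¬ 3 ∣ e) (hd : d ≠ 0)
    (h : a ^ 2 = e ^ 4 - 18 * d ^ 2 * e ^ 2 - 27 * d ^ 4) :
    ∃ f g, d ^ 2 = f ^ 2 * g ^ 2 ∧ g ^ 4 + 9 * g ^ 2 * f ^ 2 + 27 * f ^ 4 = e ^ 2 := by
  obtain ⟨heodd, hdeven⟩ : Odd e ∧ Even d := by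
    have h8 := congrArg (Int.cast : ℤ → ZMod 8) h
    push_cast at h8
    have key : ∀ a d e : ZMod 8, 4 * a = 4 →
        a ^ 2 = e ^ 4 - 18 * d ^ 2 * e ^ 2 - 27 * d ^ 4 → 4 * e = 4 ∧ 4 * d = 0 := by decide
    have := key _ _ _ (ZMod.four_mul_intCast_eq_four_iff.2 haodd) h8
    rwa [ZMod.four_mul_intCast_eq_four_iff, ZMod.four_mul_intCast_eq_zero_iff] at this
  obtain ⟨P, hP⟩ : ∃ P, e ^ 2 - 9 * d ^ 2 = a + 2 * P := by
    obtain ⟨k, hk⟩ := haodd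
    obtain ⟨l, hl⟩ := heodd.pow (n := 2)
    obtain ⟨m, rfl⟩ := hdeven
    exact ⟨l - k - 18 * m ^ 2, by rw [hk, hl]; ring⟩
  obtain ⟨Q, hQ⟩ : ∃ Q, Q = P + a := ⟨_, rfl⟩
  have hPQ : P * Q = 27 * d ^ 4 := by
    obtain rfl : a = e ^ 2 - 9 * d ^ 2 - 2 * P := by lia
    subst hQ
    linarith
  have hd4 : 0 < d ^ 4 := by positivity
  have hpos : 0 < P + Q := by
    have : P + Q = e ^ 2 - 9 * d ^ 2 := by lia
    rw [this]
    by_contra hle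
    nlinarith [sq_nonneg a, sq_nonneg e, sq_nonneg d, mul_nonneg (sq_nonneg e) (sq_nonneg d)]
  have hP0 : 0 < P := by
    by_contra hP0
    have : Q < 0 := by nlinarith
    lia
  have hQ0 : 0 < Q := pos_of_mul_pos_right (by lia : 0 < P * Q) hP0.le
  obtain ⟨f, g, hfg, ⟨rfl, rfl⟩ | ⟨rfl, rfl⟩⟩ :=
    exists_pow_four_of_mul_eq (α := 1) (β := 1) (γ := 1) hP0 hQ0 hPQ hco he (by lia)
  all_goals exact ⟨f, g, hfg, by linarith⟩

theorem Int.quartic_ne_sq {a b c : ℤ} (hco : IsCoprime a b) (ha : ¬ 3 ∣ a) (hb : b ≠ 0) :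
    a ^ 4 + 9 * a ^ 2 * b ^ 2 + 27 * b ^ 4 ≠ c ^ 2 := by
  induction hn : b.natAbs using Nat.strong_induction_on generalizing a b c with
  | _ n ih =>
  subst hn
  intro h
  obtain ⟨d, e, haodd, hde, h1⟩ := exists_quartic_covering hco ha hb h
  have hd : d ≠ 0 := by rintro rfl; simp [hb] at hde
  have he : ¬ 3 ∣ e := fun ⟨k, hk⟩ => ha <| Int.prime_three.dvd_of_dvd_pow (n := 2)
    ⟨27 * k ^ 4 - 54 * d ^ 2 * k ^ 2 - 9 * d ^ 4, by rw [h1, hk]; ring⟩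
  have hed : IsCoprime e d := by
    have : IsCoprime (a ^ 2) (d ^ 2) :=
      (hco.pow (m := 2) (n := 2)).of_isCoprime_of_dvd_right ⟨4 * e ^ 2, by rw [hde]; ring⟩
    rw [h1, show e ^ 4 - 18 * d ^ 2 * e ^ 2 - 27 * d ^ 4 =
      e ^ 4 + d ^ 2 * (-18 * e ^ 2 - 27 * d ^ 2) by ring] at this
    exact (IsCoprime.pow_iff four_pos two_pos).1 this.of_add_mul_left_left
  obtain ⟨f, g, hfg, h2⟩ := exists_quartic_of_covering haodd hed he hd h1
  have hf : f ≠ 0 := by rintro rfl; simp [hd] at hfg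
  have hg : ¬ 3 ∣ g := fun ⟨k, hk⟩ => he <| Int.prime_three.dvd_of_dvd_pow (n := 2)
    ⟨27 * k ^ 4 + 27 * k ^ 2 * f ^ 2 + 9 * f ^ 4, by rw [← h2, hk]; ring⟩
  have hgf : IsCoprime g f := by
    have : IsCoprime (e ^ 2) (f ^ 2) :=
      (hed.pow (m := 2) (n := 2)).of_isCoprime_of_dvd_right ⟨g ^ 2, hfg⟩
    rw [← h2, show g ^ 4 + 9 * g ^ 2 * f ^ 2 + 27 * f ^ 4 =
      g ^ 4 + f ^ 2 * (9 * g ^ 2 + 27 * f ^ 2) by ring] at this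
    exact (IsCoprime.pow_iff four_pos two_pos).1 this.of_add_mul_left_left
  refine ih f.natAbs ?_ hgf hg hf rfl h2
  rw [Int.natAbs_lt_iff_sq_lt, hde, hfg]
  have hf2 : 0 < f ^ 2 := by positivity
  have hge : 0 < g ^ 2 * e ^ 2 := by
    have : g ≠ 0 := by rintro rfl; simp at hg
    have : e ≠ 0 := by rintro rfl; simp at he
    positivity
  nlinarith

theorem Int.three_mul_mul_ne_sq_of_not_dvd {n k w : ℤ} (hn : 0 < n) (hk : 0 < k)
    (hco : IsCoprime k n) (h3 : ¬ 3 ∣ k) :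
    3 * n * k * (k ^ 2 + 3 * k * n + 3 * n ^ 2) ≠ w ^ 2 := by
  intro h
  have hk3 : IsCoprime k 3 := ((Int.prime_three.coprime_iff_not_dvd).2 h3).symm
  have hk3n : IsCoprime k (3 * n) := hk3.mul_right hco
  have h1 : IsCoprime (3 * n) (k ^ 2 + 3 * k * n + 3 * n ^ 2) := by
    rw [show k ^ 2 + 3 * k * n + 3 * n ^ 2 = k ^ 2 + 3 * n * (k + n) by ring]
    exact (hk3n.symm.pow_right (n := 2)).add_mul_left_right _
  have h2 : IsCoprime k (k ^ 2 + 3 * k * n + 3 * n ^ 2) := by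
    rw [show k ^ 2 + 3 * k * n + 3 * n ^ 2 = 3 * n * n + k * (k + 3 * n) by ring]
    exact (hk3n.mul_right hco).add_mul_left_right _
  obtain ⟨c, hc⟩ := exists_eq_sq_of_isCoprime (by positivity) (h1.mul_left h2).symm
    (by rw [mul_comm]; exact h)
  obtain ⟨t, ht⟩ := exists_eq_sq_of_isCoprime (z := w) (by positivity)
    (hk3n.symm.mul_right h1) (by rw [← h]; ring)
  obtain ⟨a, rfl⟩ := exists_eq_sq_of_isCoprime (z := w) hk
    (hk3n.mul_right h2) (by rw [← h]; ring)
  obtain ⟨b, rfl⟩ : 3 ∣ t := Int.prime_three.dvd_of_dvd_pow (n := 2) ⟨n, ht.symm⟩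
  obtain rfl : n = 3 * b ^ 2 := by linarith
  refine quartic_ne_sq (a := a) (b := b) (c := c) ?_ ?_ ?_ ?_
  · exact (IsCoprime.pow_iff two_pos two_pos).1 hco.of_mul_right_right
  · exact fun h => h3 (dvd_pow h two_ne_zero)
  · rintro rfl
    simp at hn
  · rw [← hc]
    ring

theorem Int.eq_zero_of_three_mul_mul_eq_sq {n k w : ℤ} (hn : 0 < n) (hco : IsCoprime k n)
    (h : 3 * n * k * (k ^ 2 + 3 * k * n + 3 * n ^ 2) = w ^ 2) : k = 0 := by
  by_contra hk0
  have hk : 0 < k := by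
    have hQ : 0 < k ^ 2 + 3 * k * n + 3 * n ^ 2 := by nlinarith [sq_nonneg (2 * k + 3 * n)]
    have : 0 ≤ (3 * n) * (k * (k ^ 2 + 3 * k * n + 3 * n ^ 2)) := by
      rw [← mul_assoc, h]
      exact sq_nonneg w
    have := nonneg_of_mul_nonneg_right this (by positivity)
    have := nonneg_of_mul_nonneg_left this hQ
    lia
  by_cases h3 : 3 ∣ k
  · have hn3 : ¬ 3 ∣ n := fun hn3 => Int.prime_three.not_isUnit (hco.isUnit_of_dvd' h3 hn3)
    obtain ⟨l, rfl⟩ := h3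
    obtain ⟨t, rfl⟩ : 3 ∣ w := Int.prime_three.dvd_of_dvd_pow (n := 2)
      ⟨_, by rw [← h, mul_assoc, mul_assoc]⟩
    exact three_mul_mul_ne_sq_of_not_dvd (n := l) (k := n) (w := t) (by lia) hn
      hco.of_mul_left_right.symm hn3 (by linarith)
  · exact three_mul_mul_ne_sq_of_not_dvd hn hk hco h3 h

/-- The only rational solution `(u,v)` of `v² = 3(u³ − 1)` is `(1, 0)`. -/
theorem stmt_6 (u v : ℚ) : v ^ 2 = 3 * (u ^ 3 - 1) ↔ u = 1 ∧ v = 0 := by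
  refine ⟨fun h => ?_, by rintro ⟨rfl, rfl⟩; norm_num⟩
  suffices hu : u = 1 by
    subst hu
    exact ⟨rfl, by simpa using h⟩
  let n : ℤ := u.den
  let k : ℤ := u.num - n
  have hun : u = (k + n) / n := by simp [k, n, Rat.num_div_den]
  have hsq : IsSquare ((3 * n * k * (k ^ 2 + 3 * k * n + 3 * n ^ 2) : ℤ) : ℚ) := by
    refine ⟨v * n ^ 2, ?_⟩
    have hn : (n : ℚ) ≠ 0 := by simp [n]
    rw [hun] at h
    field_simp at h
    push_cast
    linear_combination (-n : ℚ) * h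
  obtain ⟨w, hw⟩ := Rat.isSquare_intCast_iff.1 hsq
  have hco : IsCoprime k n := by
    have : IsCoprime u.num n := Int.isCoprime_iff_nat_coprime.2 (by simpa [n] using u.reduced)
    rw [show u.num = k + n * 1 by simp [k]] at this
    exact this.of_add_mul_left_left
  have hk := Int.eq_zero_of_three_mul_mul_eq_sq (by simp [n, u.den_pos]) hco (hw.trans (sq w).symm)
  rw [hun, hk]
  simp [n]
end

section
/- The rational solutions (u,v) ∈ ℚ × ℚ of the equation v² = u³ + 1 are exactly the five points (0,1), (0,−1), (2,3), (2,−3), and (−1,0). -/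
/-- If `A * B = 3 * y ^ 4` and no prime divides all of `A`, `B`, `y`, then one factor is a fourth
power and the other is three times a fourth power. -/
theorem exists_fourth_pow_of_mul_eq_three_mul {A B y : ℤ} (hy : y ≠ 0) (hsum : 0 < A + B)
    (h : A * B = 3 * y ^ 4) (hp : ∀ p : ℤ, Prime p → p ∣ A → p ∣ B → ¬ p ∣ y) :
    ∃ s t : ℤ, IsCoprime s t ∧ y = s * t ∧
      ((A = 3 * s ^ 4 ∧ B = t ^ 4) ∨ (A = t ^ 4 ∧ B = 3 * s ^ 4)) := by
  have hpos : 0 < A * B := by rw [h]; positivity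
  have hA : 0 < A := by by_contra! hA; nlinarith
  have hB : 0 < B := by by_contra! hB; nlinarith
  have hcop : IsCoprime A B := by
    refine isCoprime_of_prime_dvd (fun h0 => hA.ne' h0.1) fun p hpp hpA hpB => ?_
    have hpy := hp p hpp hpA hpB
    have hc : IsCoprime (p * p) (y ^ 4) := by
      have := (Prime.coprime_iff_not_dvd hpp).2 hpy
      exact (this.mul_left this).pow_right
    have h3 : p * p ∣ 3 := hc.dvd_of_dvd_mul_right (h ▸ mul_dvd_mul hpA hpB)
    exact hpp.not_isUnit (Int.prime_three.squarefree p h3)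
  have key : ∀ A B : ℤ, 0 < A → 0 < B → IsCoprime A B → A * B = 3 * y ^ 4 → 3 ∣ A →
      ∃ s t : ℤ, IsCoprime s t ∧ y = s * t ∧ A = 3 * s ^ 4 ∧ B = t ^ 4 := by
    rintro A B hA hB hcop h ⟨A, rfl⟩
    have hA' : 0 < A := by linarith
    have h' : A * B = y ^ 4 := by linarith
    have hc : IsCoprime A B := hcop.of_mul_left_right
    obtain ⟨s, hs⟩ := exists_associated_pow_of_mul_eq_pow' hc h'
    obtain ⟨t, ht⟩ := exists_associated_pow_of_mul_eq_pow' hc.symm ((mul_comm B A).trans h')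
    have hs' : s ^ 4 = A := by
      rcases Int.associated_iff.1 hs with h | h
      · exact h
      · nlinarith [pow_nonneg (sq_nonneg s) 2]
    have ht' : t ^ 4 = B := by
      rcases Int.associated_iff.1 ht with h | h
      · exact h
      · nlinarith [pow_nonneg (sq_nonneg t) 2]
    subst hs' ht'
    have hst : IsCoprime s t := (IsCoprime.pow_iff (by norm_num) (by norm_num)).1 hc
    rw [← mul_pow] at h'
    rcases (pow_eq_pow_iff_of_ne_zero (by norm_num : (4 : ℕ) ≠ 0)).1 h' with h | h
    · exact ⟨s, t, hst, h.symm, rfl, rfl⟩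
    · exact ⟨-s, t, hst.neg_left, by linarith [h.1], by ring, rfl⟩
  rcases Int.prime_three.dvd_or_dvd (Dvd.intro _ h.symm) with h3 | h3
  · obtain ⟨s, t, h1, h2, h3, h4⟩ := key A B hA hB hcop h h3
    exact ⟨s, t, h1, h2, .inl ⟨h3, h4⟩⟩
  · obtain ⟨s, t, h1, h2, h3, h4⟩ := key B A hB hA hcop.symm ((mul_comm B A).trans h) h3
    exact ⟨s, t, h1, h2, .inr ⟨h4, h3⟩⟩

theorem sq_ne_three_mul_pow_four_add {s t X : ℤ} (hst : IsCoprime s t) :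
    X ^ 2 ≠ 3 * s ^ 4 + 6 * s ^ 2 * t ^ 2 - t ^ 4 := by
  intro h
  have hmod : 3 ∣ X ∧ 3 ∣ t := by
    have h0 : (X ^ 2 + (t ^ 2) ^ 2) % 3 = 0 := by
      have : X ^ 2 + (t ^ 2) ^ 2 = 3 * (s ^ 4 + 2 * s ^ 2 * t ^ 2) := by linarith
      omega
    have hX : X % 3 = 0 ∨ X % 3 = 1 ∨ X % 3 = 2 := by omega
    have ht : t % 3 = 0 ∨ t % 3 = 1 ∨ t % 3 = 2 := by omega
    rcases hX with hX | hX | hX <;> rcases ht with ht | ht | ht <;>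
      simp [pow_two, Int.add_emod, Int.mul_emod, hX, ht] at h0 <;> omega
  obtain ⟨⟨a, rfl⟩, b, rfl⟩ := hmod
  have hs : (3 : ℤ) ∣ s ^ 4 := ⟨a ^ 2 - 6 * s ^ 2 * b ^ 2 + 9 * b ^ 4, by linarith⟩
  exact Int.prime_three.not_isUnit
    (hst.isUnit_of_dvd' (Int.prime_three.dvd_of_dvd_pow hs) (dvd_mul_right _ _))

/-- The descent step on the 2-isogenous quartic `X² = t⁴ + 6s²t² - 3s⁴`. -/
theorem exists_descent_of_sq_eq {s t X : ℤ} (hst : IsCoprime s t) (hs : s ≠ 0)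
    (h : X ^ 2 = t ^ 4 + 6 * s ^ 2 * t ^ 2 - 3 * s ^ 4) :
    ∃ p q : ℤ, IsCoprime p q ∧ s = p * q ∧ t ^ 2 = q ^ 4 - 3 * q ^ 2 * p ^ 2 + 3 * p ^ 4 := by
  have hev : Even (t ^ 2 + 3 * s ^ 2 - X) := by
    have : Even (X ^ 2 - (t ^ 2 + 3 * s ^ 2) ^ 2) := ⟨-6 * s ^ 4, by rw [h]; ring⟩
    simp only [Int.even_sub, Int.even_pow] at this ⊢
    tauto
  obtain ⟨C, hC⟩ := hev
  have hX : X = t ^ 2 + 3 * s ^ 2 - 2 * C := by linarith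
  subst hX
  have hsum : C + (t ^ 2 + 3 * s ^ 2 - C) = t ^ 2 + 3 * s ^ 2 := by ring
  obtain ⟨p, q, hpq, rfl, hor⟩ := exists_fourth_pow_of_mul_eq_three_mul
    (A := C) (B := t ^ 2 + 3 * s ^ 2 - C) hs (by rw [hsum]; positivity) (by linarith) (by
      intro r hr hrA hrB hrs
      have h1 : r ∣ t ^ 2 + 3 * s ^ 2 := hsum ▸ dvd_add hrA hrB
      have h2 : r ∣ t ^ 2 := (dvd_add_left ((hrs.pow two_ne_zero).mul_left 3)).1 h1
      exact hr.not_isUnit (hst.isUnit_of_dvd' hrs (hr.dvd_of_dvd_pow h2)))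
  refine ⟨p, q, hpq, rfl, ?_⟩
  rcases hor with ⟨h1, h2⟩ | ⟨h1, h2⟩ <;> linarith

/-- The descent step on the quartic `z² = x⁴ - 3x²y² + 3y⁴`. -/
theorem exists_isogenous_of_sq_eq {x y z : ℤ} (hxy : IsCoprime x y) (hy : y ≠ 0)
    (h : z ^ 2 = x ^ 4 - 3 * x ^ 2 * y ^ 2 + 3 * y ^ 4) :
    ∃ s t X : ℤ, IsCoprime s t ∧ X ^ 2 = t ^ 4 + 6 * s ^ 2 * t ^ 2 - 3 * s ^ 4 ∧
      ((X = 2 * x ∧ y = s * t) ∨ (X = x ∧ y = 2 * (s * t))) := by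
  wlog hz : 0 ≤ z generalizing z
  · exact this (z := -z) (by linarith [neg_sq z]) (by linarith)
  have hz : 0 < z := by
    refine hz.lt_of_ne fun h0 => ?_
    subst h0
    nlinarith [sq_nonneg (2 * x ^ 2 - 3 * y ^ 2), show 0 < y ^ 4 by positivity]
  rcases Int.even_or_odd' y with ⟨Y, rfl | hY⟩
  · have hY : Y ≠ 0 := by rintro rfl; simp at hy
    have hev : Even (z - (x ^ 2 - 6 * Y ^ 2)) := by
      have : Even (z ^ 2 - (x ^ 2 - 6 * Y ^ 2) ^ 2) := ⟨6 * Y ^ 4, by rw [h]; ring⟩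
      simp only [Int.even_sub, Int.even_pow] at this ⊢
      tauto
    obtain ⟨A, hA⟩ := hev
    have hz' : z = 2 * A + x ^ 2 - 6 * Y ^ 2 := by linarith
    subst hz'
    obtain ⟨s, t, hst, rfl, hor⟩ := exists_fourth_pow_of_mul_eq_three_mul
      (A := A) (B := A + (x ^ 2 - 6 * Y ^ 2)) hY (by linarith) (by linarith) (by
        intro r hr hrA hrB hrY
        have h1 : r ∣ x ^ 2 - 6 * Y ^ 2 := (dvd_add_right hrA).1 hrB
        have h2 : r ∣ x ^ 2 := (dvd_sub_left ((hrY.pow two_ne_zero).mul_left 6)).1 h1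
        exact hr.not_isUnit (hxy.isUnit_of_dvd' (hr.dvd_of_dvd_pow h2) (hrY.mul_left 2)))
    rcases hor with ⟨h1, h2⟩ | ⟨h1, h2⟩
    · exact ⟨s, t, x, hst, by linarith, .inr ⟨rfl, rfl⟩⟩
    · exact absurd (by linarith) (sq_ne_three_mul_pow_four_add (X := x) hst)
  · obtain ⟨s, t, hst, hy', hor⟩ := exists_fourth_pow_of_mul_eq_three_mul
      (A := 2 * z - 2 * x ^ 2 + 3 * y ^ 2) (B := 2 * z + 2 * x ^ 2 - 3 * y ^ 2) hy
      (by linarith) (by linarith) (by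
        intro r hr hrA hrB hry
        have h2y : IsCoprime (2 ^ 2) y := IsCoprime.pow_left ⟨-Y, 1, by rw [hY]; ring⟩
        have h1 : r ∣ 2 ^ 2 * x ^ 2 - 6 * y ^ 2 := by
          rw [show 2 ^ 2 * x ^ 2 - 6 * y ^ 2 = 2 * z + 2 * x ^ 2 - 3 * y ^ 2 -
            (2 * z - 2 * x ^ 2 + 3 * y ^ 2) by ring]
          exact dvd_sub hrB hrA
        have h2 : r ∣ 2 ^ 2 * x ^ 2 := (dvd_sub_left ((hry.pow two_ne_zero).mul_left 6)).1 h1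
        rcases hr.dvd_or_dvd h2 with h3 | h3
        · exact hr.not_isUnit (h2y.isUnit_of_dvd' h3 hry)
        · exact hr.not_isUnit (hxy.isUnit_of_dvd' (hr.dvd_of_dvd_pow h3) hry))
    have hy2 : y ^ 2 = s ^ 2 * t ^ 2 := by rw [hy']; ring
    rcases hor with ⟨h1, h2⟩ | ⟨h1, h2⟩
    · exact ⟨s, t, 2 * x, hst, by linarith, .inl ⟨rfl, hy'⟩⟩
    · exact absurd (by linarith) (sq_ne_three_mul_pow_four_add (X := 2 * x) hst)

/-- The only primitive integral solutions of `z² = x⁴ - 3x²y² + 3y⁴` are the trivial ones. -/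
theorem sq_eq_one_of_sq_eq_quartic {x y z : ℤ} (hxy : IsCoprime x y) (hy : y ≠ 0)
    (h : z ^ 2 = x ^ 4 - 3 * x ^ 2 * y ^ 2 + 3 * y ^ 4) : x ^ 2 = 1 ∧ y ^ 2 = 1 := by
  induction hn : y.natAbs using Nat.strong_induction_on generalizing x y z with
  | _ n ih =>
    obtain ⟨s, t, X, hst, hX, hor⟩ := exists_isogenous_of_sq_eq hxy hy h
    have hs : s ≠ 0 := by rintro rfl; simp at hor; tauto
    have ht : t ≠ 0 := by rintro rfl; simp at hor; tauto
    obtain ⟨p, q, hpq, rfl, htpq⟩ := exists_descent_of_sq_eq hst hs hX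
    have hp : p ≠ 0 := left_ne_zero_of_mul hs
    have hq : q ≠ 0 := right_ne_zero_of_mul hs
    have hp0 : 0 < p.natAbs := Int.natAbs_pos.2 hp
    have hqt0 : 0 < (q * t).natAbs := Int.natAbs_pos.2 (mul_ne_zero hq ht)
    have hpq1 : q ^ 2 = 1 ∧ p ^ 2 = 1 := by
      by_cases hlt : p.natAbs < n
      · exact ih _ hlt hpq.symm hp htpq rfl
      · have hqt : (q * t).natAbs = 1 := by
          rcases hor with ⟨-, rfl⟩ | ⟨-, rfl⟩
          · rw [mul_assoc, Int.natAbs_mul] at hn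
            nlinarith
          · rw [mul_assoc p, Int.natAbs_mul, Int.natAbs_mul p] at hn
            simp only [Int.reduceAbs] at hn
            nlinarith
        rw [Int.natAbs_mul, _root_.mul_eq_one] at hqt
        have hq2 : q ^ 2 = 1 := by rw [← Int.natAbs_sq, hqt.1]; rfl
        have ht2 : t ^ 2 = 1 := by rw [← Int.natAbs_sq, hqt.2]; rfl
        refine ⟨hq2, mul_left_cancel₀ (pow_ne_zero 2 hp) ?_⟩
        have hq4 : q ^ 4 = 1 := by rw [show q ^ 4 = (q ^ 2) ^ 2 by ring, hq2]; rfl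
        rw [ht2, hq4, hq2] at htpq
        linarith
    obtain ⟨hq2, hp2⟩ := hpq1
    have ht2 : t ^ 2 = 1 := by
      rw [htpq, show q ^ 4 = (q ^ 2) ^ 2 by ring, show p ^ 4 = (p ^ 2) ^ 2 by ring, hq2, hp2]; rfl
    have hs2 : (p * q) ^ 2 = 1 := by rw [mul_pow, hq2, hp2]; rfl
    have hX4 : X ^ 2 = 4 := by
      rw [hX, show t ^ 4 = (t ^ 2) ^ 2 by ring, show (p * q) ^ 4 = ((p * q) ^ 2) ^ 2 by ring,
        hs2, ht2]; rfl
    rcases hor with ⟨rfl, rfl⟩ | ⟨rfl, rfl⟩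
    · exact ⟨by linarith, by rw [mul_pow, hs2, ht2]; rfl⟩
    · have h2 : (2 : ℤ) ∣ X := Int.prime_two.dvd_of_dvd_pow (n := 2) (by rw [hX4]; norm_num)
      exact absurd (hxy.isUnit_of_dvd' h2 (dvd_mul_right _ _)) Int.prime_two.not_isUnit

theorem eq_one_of_mul_mul_eq_sq {b c n : ℤ} (hb : 0 < b) (hc : 0 < c) (hbc : IsCoprime b c)
    (h3 : ¬ 3 ∣ c) (h : b * c * (c ^ 2 - 3 * b * c + 3 * b ^ 2) = n ^ 2) : b = 1 ∧ c = 1 := by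
  have hbQ : IsCoprime b (c ^ 2 - 3 * b * c + 3 * b ^ 2) := by
    have : IsCoprime b (c ^ 2 + b * (3 * b - 3 * c)) := hbc.pow_right.add_mul_left_right _
    convert this using 1; ring
  have hcQ : IsCoprime c (c ^ 2 - 3 * b * c + 3 * b ^ 2) := by
    have h3c : IsCoprime c 3 := ((Prime.coprime_iff_not_dvd Int.prime_three).2 h3).symm
    have : IsCoprime c (3 * b ^ 2 + c * (c - 3 * b)) :=
      (h3c.mul_right hbc.symm.pow_right).add_mul_left_right _
    convert this using 1; ring
  have hQ : 0 < c ^ 2 - 3 * b * c + 3 * b ^ 2 := by nlinarith [sq_nonneg (2 * c - 3 * b)]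
  have sq_of : ∀ {a d e : ℤ}, 0 < a → IsCoprime a d → a * d = e ^ 2 → ∃ r, a = r ^ 2 := by
    intro a d e ha had hade
    obtain ⟨r, hr | hr⟩ := Int.sq_of_isCoprime had hade
    · exact ⟨r, hr⟩
    · nlinarith [sq_nonneg r]
  obtain ⟨β, rfl⟩ := sq_of hb (hbc.mul_right hbQ) (by rw [← h]; ring)
  obtain ⟨γ, rfl⟩ := sq_of hc (hbc.symm.mul_right hcQ) ((by rw [← h]; ring : _ = n ^ 2))
  obtain ⟨δ, hδ⟩ := sq_of hQ (hbQ.symm.mul_right hcQ.symm) ((by rw [← h]; ring : _ = n ^ 2))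
  have := sq_eq_one_of_sq_eq_quartic (x := γ) (y := β) (z := δ)
    ((IsCoprime.pow_iff two_pos two_pos).1 hbc.symm) (by rintro rfl; simp at hb)
    (by rw [← hδ]; ring)
  exact this.symm

/-- The rational solutions `(u,v)` of `v² = u³ + 1` are exactly
`(0,1)`, `(0,−1)`, `(2,3)`, `(2,−3)`, and `(−1,0)`. -/
theorem stmt_7 (u v : ℚ) :
    v ^ 2 = u ^ 3 + 1 ↔
      (u = 0 ∧ v = 1) ∨ (u = 0 ∧ v = -1) ∨ (u = 2 ∧ v = 3) ∨ (u = 2 ∧ v = -3) ∨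
        (u = -1 ∧ v = 0) := by
  refine ⟨fun h => ?_, by rintro (⟨rfl, rfl⟩ | ⟨rfl, rfl⟩ | ⟨rfl, rfl⟩ | ⟨rfl, rfl⟩ | ⟨rfl, rfl⟩) <;>
    norm_num⟩
  suffices hu : u = 0 ∨ u = 2 ∨ u = -1 by
    rcases hu with rfl | rfl | rfl
    · rcases sq_eq_sq_iff_eq_or_eq_neg.1 (show v ^ 2 = 1 ^ 2 by linarith) with rfl | rfl <;> simp
    · rcases sq_eq_sq_iff_eq_or_eq_neg.1 (show v ^ 2 = 3 ^ 2 by linarith) with rfl | rfl <;> simp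
    · have : v = 0 := pow_eq_zero_iff two_ne_zero |>.1 (by linarith)
      simp [this]
  obtain ⟨b, hb⟩ : ∃ b : ℤ, b = u.den := ⟨_, rfl⟩
  obtain ⟨c, hc⟩ : ∃ c : ℤ, c = u.num + b := ⟨_, rfl⟩
  have hb0 : 0 < b := by rw [hb]; exact_mod_cast u.den_pos
  have hbQ : (b : ℚ) ≠ 0 := by exact_mod_cast hb0.ne'
  have hu : u * b = c - b := by
    rw [hc, hb]; push_cast; rw [Rat.mul_den_eq_num]; ring
  have hbc : IsCoprime b c := by
    have : IsCoprime u.num b := by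
      rw [hb, Int.isCoprime_iff_nat_coprime]; exact u.reduced
    rw [hc]
    simpa using this.symm.add_mul_left_right 1
  have hsq : ∃ n : ℤ, b * c * (c ^ 2 - 3 * b * c + 3 * b ^ 2) = n ^ 2 := by
    have : IsSquare ((b * c * (c ^ 2 - 3 * b * c + 3 * b ^ 2) : ℤ) : ℚ) := by
      refine ⟨v * b ^ 2, ?_⟩
      have hc' : (c : ℚ) = u * b + b := by linarith
      push_cast
      rw [hc', show v * b ^ 2 * (v * b ^ 2) = v ^ 2 * (b : ℚ) ^ 4 by ring, h]
      ring
    obtain ⟨n, hn⟩ := Rat.isSquare_intCast_iff.1 this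
    exact ⟨n, by rw [hn, sq]⟩
  obtain ⟨n, hn⟩ := hsq
  have hc0 : 0 ≤ c := by
    by_contra! hc0
    have hQ : 0 < c ^ 2 - 3 * b * c + 3 * b ^ 2 := by nlinarith
    nlinarith [mul_neg_of_neg_of_pos (mul_neg_of_pos_of_neg hb0 hc0) hQ, sq_nonneg n]
  rcases hc0.eq_or_lt with rfl | hc0
  · right; right
    refine mul_right_cancel₀ hbQ ?_
    rw [hu]; simp
  by_cases h3 : 3 ∣ c
  · obtain ⟨d, rfl⟩ := h3
    have h3b : ¬ 3 ∣ b := fun h3b =>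
      Int.prime_three.not_isUnit (hbc.isUnit_of_dvd' h3b (dvd_mul_right _ _))
    have h3n : (3 : ℤ) ∣ n :=
      Int.prime_three.dvd_of_dvd_pow (n := 2) ⟨_, by rw [← hn, mul_left_comm b 3 d, mul_assoc 3]⟩
    obtain ⟨m, rfl⟩ := h3n
    obtain ⟨rfl, rfl⟩ := eq_one_of_mul_mul_eq_sq (b := d) (c := b) (n := m) (by linarith) hb0
      hbc.of_mul_right_right.symm h3b (by linarith)
    right; left
    norm_num at hu
    exact hu
  · obtain ⟨rfl, rfl⟩ := eq_one_of_mul_mul_eq_sq hb0 hc0 hbc h3 hn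
    left
    simpa using hu
end

section
/- The rational solutions (r,y) ∈ ℚ × ℚ of the equation 2y² = r³ + 12r² + 48r + 72 are exactly the five points (0,6), (0,−6), (−4,2), (−4,−2), and (−6,0). -/
open NumberField in
/-- Every Eisenstein integer is `a + b η` with integers `a`, `b`. -/
theorem exists_int_add_int_mul_toInteger {K : Type*} [Field K] [NumberField K]
    [IsCyclotomicExtension {3} ℚ K] {ζ : K} (hζ : IsPrimitiveRoot ζ 3) (x : 𝓞 K) :
    ∃ a b : ℤ, x = a + b * hζ.toInteger := by
  have hdim : hζ.integralPowerBasis.dim = 2 := by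
    rw [hζ.integralPowerBasis_dim]; rfl
  obtain ⟨f, hf, hx⟩ := hζ.integralPowerBasis.exists_eq_aeval x
  rw [hdim] at hf
  refine ⟨f.coeff 0, f.coeff 1, ?_⟩
  rw [hx, Polynomial.aeval_eq_sum_range' hf, hζ.integralPowerBasis_gen]
  simp [Finset.sum_range_succ]

/-- Integer coordinates with respect to a primitive cube root of unity are unique. -/
theorem eq_and_eq_of_add_mul_eq {R : Type*} [CommRing R] [CharZero R] {e : R}
    (he : e ^ 2 = -e - 1) {a b c d : ℤ} (h : (a + b * e : R) = c + d * e) : a = c ∧ b = d := by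
  have h' : ((a - c : ℤ) + (b - d : ℤ) * e : R) = 0 := by
    push_cast; linear_combination h
  have hn : (a - c) ^ 2 - (a - c) * (b - d) + (b - d) ^ 2 = 0 := by
    have : (((a - c) ^ 2 - (a - c) * (b - d) + (b - d) ^ 2 : ℤ) : R) = 0 := by
      push_cast at h' ⊢
      linear_combination (a - c - (b - d) * (1 + e) : R) * h' + (b - d : R) ^ 2 * he
    exact_mod_cast this
  constructor <;> nlinarith [sq_nonneg (a - c), sq_nonneg (b - d), sq_nonneg (a - c - (b - d)),
    sq_nonneg (2 * (a - c) - (b - d)), sq_nonneg (2 * (b - d) - (a - c))]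

/-- For any `a` and `c`, `(a + c ω)³` is the cube of some `s + t √-3`. -/
theorem exists_of_two_mul_eq {p q a c : ℤ} (hp : 2 * p = (a + c) * (2 * a - c) * (a - 2 * c))
    (hq : 2 * q = 3 * a * c * (a - c)) :
    ∃ s t : ℤ, p = s * (s - 3 * t) * (s + 3 * t) ∧ q = 3 * t * (s - t) * (s + t) := by
  rcases Int.even_or_odd' c with ⟨t, rfl | rfl⟩
  · exact ⟨a - t, t, by linarith, by linarith⟩
  rcases Int.even_or_odd' a with ⟨u, rfl | rfl⟩
  · exact ⟨2 * t + 1 - u, -u, by linarith, by linarith⟩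
  · exact ⟨-(u + t + 1), u - t, by linarith, by linarith⟩

open NumberField in
/-- If `p² + 3q²` is an odd cube, with `p` coprime to it, then `p + q √-3` is the cube of an
Eisenstein integer `a + c ω`. -/
theorem exists_two_mul_eq_of_sq_add_three_mul_sq_eq_cube {K : Type*} [Field K] [NumberField K]
    [IsCyclotomicExtension {3} ℚ K] {ζ : K} (hζ : IsPrimitiveRoot ζ 3) {p q b : ℤ}
    (h : p ^ 2 + 3 * q ^ 2 = b ^ 3) (hb : Odd b) (hpb : IsCoprime p b) :
    ∃ a c : ℤ, 2 * p = (a + c) * (2 * a - c) * (a - 2 * c) ∧ 2 * q = 3 * a * c * (a - c) := by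
  have := IsCyclotomicExtension.Rat.three_pid K
  set e : 𝓞 K := hζ.toInteger with he_def
  have he : e ^ 2 = -e - 1 := IsCyclotomicExtension.Rat.Three.eta_sq hζ
  have hmul : ((p + q : ℤ) + (2 * q : ℤ) * e : 𝓞 K) * ((p - q : ℤ) - (2 * q : ℤ) * e) =
      (b : 𝓞 K) ^ 3 := by
    have h' : ((p ^ 2 + 3 * q ^ 2 : ℤ) : 𝓞 K) = (b ^ 3 : ℤ) := by rw [h]
    push_cast at h' ⊢
    linear_combination h' - 4 * (q : 𝓞 K) ^ 2 * he
  have hcop : IsCoprime ((p + q : ℤ) + (2 * q : ℤ) * e : 𝓞 K) ((p - q : ℤ) - (2 * q : ℤ) * e) := by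
    have h2 : IsCoprime (2 * p) (b ^ 3) := by
      refine (IsCoprime.mul_left ?_ hpb).pow_right
      exact Int.isCoprime_two_left.2 hb
    obtain ⟨u, v, huv⟩ := h2
    have huv' : ((u * (2 * p) + v * b ^ 3 : ℤ) : 𝓞 K) = (1 : ℤ) := by rw [huv]
    refine ⟨u + v * ((p - q : ℤ) - (2 * q : ℤ) * e), u, ?_⟩
    push_cast at huv' hmul ⊢
    linear_combination huv' + (v : 𝓞 K) * hmul
  obtain ⟨γ, u, hγ⟩ := exists_associated_pow_of_mul_eq_pow' hcop hmul
  obtain ⟨a, c, rfl⟩ := exists_int_add_int_mul_toInteger hζ γ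
  rw [← he_def] at hγ
  have hcube : ((a : 𝓞 K) + c * e) ^ 3 =
      (a ^ 3 + c ^ 3 - 3 * a * c ^ 2 : ℤ) + (3 * a * c * (a - c) : ℤ) * e := by
    push_cast
    linear_combination (3 * (a : 𝓞 K) * c ^ 2 + c ^ 3 * (e - 1)) * he
  rw [hcube] at hγ
  have hodd : Odd (p + q) := by
    have hodd : Odd (p ^ 2 + 3 * q ^ 2) := h ▸ hb.pow
    clear * - hodd
    rw [← Int.not_even_iff_odd] at hodd ⊢
    simpa [parity_simps, (by decide : ¬ Even (3 : ℤ))] using hodd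
  have hB_even : Even (3 * a * c * (a - c)) := by
    clear * -
    simp only [parity_simps]
    tauto
  obtain ⟨m, hm⟩ := hodd
  obtain ⟨n, hn⟩ := hB_even
  have key {r s : ℤ} (hrs : (r + s * e : 𝓞 K) = (p + q : ℤ) + (2 * q : ℤ) * e) :
      r = p + q ∧ s = 2 * q := eq_and_eq_of_add_mul_eq he hrs
  have hu := IsCyclotomicExtension.Rat.Three.Units.mem hζ u
  generalize hA : a ^ 3 + c ^ 3 - 3 * a * c ^ 2 = A at hγ
  generalize hB : 3 * a * c * (a - c) = B at hγ hn
  simp only [List.mem_cons, List.not_mem_nil, or_false] at hu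
  rcases hu with rfl | rfl | rfl | rfl | rfl | rfl
  · obtain ⟨h1, h2⟩ := key (r := A) (s := B) (by rw [← hγ]; simp)
    exact ⟨a, c, by linarith, by linarith⟩
  · obtain ⟨h1, h2⟩ := key (r := -A) (s := -B) (by rw [← hγ]; push_cast; ring)
    exact ⟨-a, -c, by linarith, by linarith⟩
  · obtain ⟨h1, h2⟩ := key (r := -B) (s := A - B) (by
      rw [← hγ, IsUnit.unit_spec]; push_cast; linear_combination -(B : 𝓞 K) * he)
    omega
  · obtain ⟨h1, h2⟩ := key (r := B) (s := B - A) (by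
      rw [← hγ]; push_cast; rw [IsUnit.unit_spec]; linear_combination (B : 𝓞 K) * he)
    omega
  · obtain ⟨h1, h2⟩ := key (r := B - A) (s := -A) (by
      rw [← hγ]; push_cast; rw [IsUnit.unit_spec];
      linear_combination -(A : 𝓞 K) * he - B * (e - 1) * he)
    omega
  · obtain ⟨h1, h2⟩ := key (r := A - B) (s := A) (by
      rw [← hγ]; push_cast; rw [IsUnit.unit_spec];
      linear_combination (A : 𝓞 K) * he + B * (e - 1) * he)
    omega

/-- Euler's lemma: if `p² + 3q²` is an odd cube, with `p` coprime to it, then `p + q √-3` is the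
cube of some `s + t √-3`. -/
theorem exists_eq_of_sq_add_three_mul_sq_eq_cube {p q b : ℤ} (h : p ^ 2 + 3 * q ^ 2 = b ^ 3)
    (hb : Odd b) (hpb : IsCoprime p b) :
    ∃ s t : ℤ, p = s * (s - 3 * t) * (s + 3 * t) ∧ q = 3 * t * (s - t) * (s + t) := by
  have : @IsCyclotomicExtension {3} ℚ (CyclotomicField 3 ℚ) _ _ DivisionRing.toRatAlgebra := by
    have hK : @IsCyclotomicExtension {3} ℚ (CyclotomicField 3 ℚ) _ _
      (CyclotomicField.algebra 3 ℚ) := inferInstance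
    rwa [Subsingleton.elim (CyclotomicField.algebra 3 ℚ) DivisionRing.toRatAlgebra] at hK
  obtain ⟨a, c, hp, hq⟩ := exists_two_mul_eq_of_sq_add_three_mul_sq_eq_cube
    (IsCyclotomicExtension.zeta_spec 3 ℚ (CyclotomicField 3 ℚ)) h hb hpb
  exact exists_of_two_mul_eq hp hq

theorem isCoprime_sub_add_of_odd {m n : ℤ} (h : IsCoprime m n) (hodd : Odd (m - n)) :
    IsCoprime (m - n) (m + n) := by
  have h2 : IsCoprime (m - n) (2 * n) :=
    (Int.isCoprime_two_right.2 hodd).mul_right (by simpa [sub_eq_add_neg] using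
      (IsCoprime.add_mul_right_left_iff (z := -1)).2 h)
  rw [show m + n = (m - n) * 1 + 2 * n by ring]
  exact h2.mul_add_left_right 1

/-- If `s(s - m)(s + m)` is a cube, with `s` and `m` coprime and of opposite parity, then each
factor is a cube. -/
theorem exists_cubes_of_mul_sub_mul_add_eq_cube {s m a : ℤ} (hsm : IsCoprime s m)
    (hodd : Odd (s - m)) (h : s * (s - m) * (s + m) = a ^ 3) :
    ∃ x y z : ℤ, s = z ^ 3 ∧ s - m = x ^ 3 ∧ s + m = y ^ 3 ∧ IsCoprime x y := by
  have h1 := isCoprime_sub_add_of_odd hsm hodd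
  have hsub : IsCoprime s (s - m) := by
    simpa [sub_eq_add_neg, add_comm] using
      (IsCoprime.mul_add_left_right_iff (z := 1)).2 hsm.neg_right
  have hadd : IsCoprime s (s + m) := by
    simpa using (IsCoprime.mul_add_left_right_iff (z := 1)).2 hsm
  rw [mul_assoc] at h
  have h3 : Odd 3 := by decide
  obtain ⟨⟨z, hz⟩, w, hw⟩ := Int.eq_pow_of_mul_eq_pow_odd (hsub.mul_right hadd) h3 h
  obtain ⟨⟨x, hx⟩, y, hy⟩ := Int.eq_pow_of_mul_eq_pow_odd h1 h3 hw
  rw [hx, hy] at h1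
  exact ⟨x, y, z, hz, hx, hy, (IsCoprime.pow_iff (by decide) (by decide)).1 h1⟩

/-- Three cubes of integers `x`, `z`, `y` in arithmetic progression, with `x`, `y` coprime and `z ≠ 0`,
are equal. -/
theorem eq_of_cube_add_cube_eq_two_mul_cube {x y z : ℤ} (hxy : IsCoprime x y) (hz : z ≠ 0)
    (h : x ^ 3 + y ^ 3 = 2 * z ^ 3) : x = y := by
  have h3 : Odd 3 := by decide
  induction hn : z.natAbs using Nat.strong_induction_on generalizing x y z with
  | _ n ih =>
  have hpar : Even (x + y) := by
    have : Even (x ^ 3 + y ^ 3) := h ▸ even_two_mul _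
    simpa [parity_simps] using this
  obtain ⟨p, hp⟩ := hpar
  obtain ⟨q, rfl⟩ : ∃ q, x = p + q := ⟨x - p, by ring⟩
  obtain rfl : y = p - q := by linarith
  have hpq : IsCoprime p q := by
    obtain ⟨u, v, huv⟩ := hxy
    exact ⟨u + v, u - v, by linarith⟩
  have hodd : Odd (p + q) := by
    rw [← Int.not_even_iff_odd]
    intro he
    have := hxy.isUnit_of_dvd' he.two_dvd (by simpa [parity_simps] using he : Even (p - q)).two_dvd
    exact absurd this (by decide)
  have hz3 : p * (p ^ 2 + 3 * q ^ 2) = z ^ 3 := by linarith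
  by_contra hne
  have hq : q ≠ 0 := by rintro rfl; simp at hne
  have descend {s m a w : ℤ} (hsm : IsCoprime s m) (hodd' : Odd (s - m))
      (ha : s * (s - m) * (s + m) = a ^ 3) (hs : s ∣ w ^ 3) (hw : w ≠ 0)
      (hwz : w.natAbs < z.natAbs) : m = 0 := by
    obtain ⟨x', y', z', h1, h2, h3', hcop⟩ := exists_cubes_of_mul_sub_mul_add_eq_cube hsm hodd' ha
    have hzw : z' ∣ w := by rwa [h1, Int.pow_dvd_pow_iff (by decide)] at hs
    have hlt := (Int.natAbs_le_of_dvd_ne_zero hzw hw).trans_lt (hn ▸ hwz)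
    have := ih _ hlt hcop (ne_zero_of_dvd_ne_zero hw hzw) (by linarith) rfl
    subst this
    linarith
  by_cases hp3 : (3 : ℤ) ∣ p
  · obtain ⟨k, rfl⟩ := hp3
    have hq3 : IsCoprime q 3 := hpq.symm.of_mul_right_left
    have hzdvd : (3 : ℤ) ∣ z := Int.prime_three.dvd_of_dvd_pow (n := 3) 
      ⟨k * ((3 * k) ^ 2 + 3 * q ^ 2), by rw [← hz3]; ring⟩
    obtain ⟨w, rfl⟩ := hzdvd
    have hk : (3 : ℤ) ∣ k := by
      have : IsCoprime 3 (3 * k ^ 2 + q ^ 2) :=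
        hq3.symm.pow_right.mul_add_left_right _
      exact this.dvd_of_dvd_mul_right ⟨w ^ 3, by linarith⟩
    obtain ⟨l, rfl⟩ := hk
    have hl : l * (q ^ 2 + 3 * (3 * l) ^ 2) = w ^ 3 := by linarith
    have hqb : IsCoprime q (q ^ 2 + 3 * (3 * l) ^ 2) := by
      rw [pow_two q]
      exact (hq3.mul_right hpq.symm.of_mul_right_right.pow_right).mul_add_left_right _
    have hlb : IsCoprime l (q ^ 2 + 3 * (3 * l) ^ 2) := by
      rw [show q ^ 2 + 3 * (3 * l) ^ 2 = l * (27 * l) + q ^ 2 by ring]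
      exact hpq.of_mul_left_right.of_mul_left_right.pow_right.mul_add_left_right _
    obtain ⟨⟨c, hc⟩, b, hb⟩ := Int.eq_pow_of_mul_eq_pow_odd hlb h3 hl
    have hbodd : Odd (b ^ 3) := by
      rw [← hb]
      rw [← Int.not_even_iff_odd] at hodd ⊢
      simp only [parity_simps, (by decide : ¬ Even (3 : ℤ))] at hodd ⊢
      tauto
    rw [hb] at hqb
    obtain ⟨s, t, hs, ht⟩ := exists_eq_of_sq_add_three_mul_sq_eq_cube hb
      ((Int.odd_pow' (by decide)).1 hbodd) ((IsCoprime.pow_right_iff (by decide)).1 hqb)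
    have hlt : l = t * (s - t) * (s + t) := by linarith
    have hs0 : s = 0 := by
      have hw : w ≠ 0 := by rintro rfl; simp at hz
      refine descend (s := t) (a := -c) (w := w) ?_ ?_ ?_ ?_ hw (by omega)
      · rw [hlt, hs] at hpq
        exact hpq.of_mul_left_right.of_mul_left_right.of_mul_left_left.of_mul_left_left
          |>.of_mul_right_left.of_mul_right_left
      · rw [← Int.not_even_iff_odd] at hodd ⊢
        rw [hlt, hs] at hodd
        simp only [parity_simps, (by decide : ¬ Even (3 : ℤ))] at hodd ⊢
        tauto
      · rw [neg_pow, ← hc, hlt]; ring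
      · rw [← hl, hlt, mul_assoc, mul_assoc]
        exact Dvd.intro _ rfl
    exact hq (by rw [hs, hs0]; ring)
  · have hp3' : IsCoprime p 3 := ((Int.prime_three.coprime_iff_not_dvd).2 hp3).symm
    have hpb : IsCoprime p (p ^ 2 + 3 * q ^ 2) := by
      rw [pow_two p]
      exact (hp3'.mul_right hpq.pow_right).mul_add_left_right _
    obtain ⟨⟨a, ha⟩, b, hb⟩ := Int.eq_pow_of_mul_eq_pow_odd hpb h3 hz3
    have hbodd : Odd (b ^ 3) := by
      rw [← hb]
      rw [← Int.not_even_iff_odd] at hodd ⊢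
      simp only [parity_simps, (by decide : ¬ Even (3 : ℤ))] at hodd ⊢
      tauto
    rw [hb] at hpb
    obtain ⟨s, t, hs, ht⟩ := exists_eq_of_sq_add_three_mul_sq_eq_cube hb
      ((Int.odd_pow' (by decide)).1 hbodd) ((IsCoprime.pow_right_iff (by decide)).1 hpb)
    have ht0 : 3 * t = 0 := by
      have hzab : z = a * b := by
        refine h3.strictMono_pow.injective ?_
        rw [mul_pow, ← ha, ← hb, hz3]
      have hb1 : 1 < b := by
        refine h3.strictMono_pow.lt_iff_lt.1 ?_
        rw [← hb]
        have := Int.one_le_abs hq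
        nlinarith [sq_abs q, sq_nonneg p]
      have ha0 : a ≠ 0 := left_ne_zero_of_mul (hzab ▸ hz)
      refine descend (s := s) (a := a) (w := a) ?_ ?_ (by rw [← hs, ha]) ?_ ha0 ?_
      · rw [hs, ht] at hpq
        exact hpq.of_mul_left_left.of_mul_left_left.of_mul_right_left.of_mul_right_left
      · rw [← Int.not_even_iff_odd] at hodd ⊢
        rw [hs, ht] at hodd
        simp only [parity_simps, (by decide : ¬ Even (3 : ℤ))] at hodd ⊢
        tauto
      · rw [← ha, hs, mul_assoc]
        exact Dvd.intro _ rfl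
      · rw [hzab, Int.natAbs_mul]
        exact lt_mul_of_one_lt_right (Int.natAbs_pos.2 ha0) (by omega)
    exact hq (by rw [ht, ht0]; ring)

theorem eq_zero_or_eq_neg_cube_of_mul_eq_cube {k e a : ℤ} (hodd : Odd e)
    (hke : IsCoprime k e) (h : k * (2 * k + e ^ 3) = a ^ 3) : k = 0 ∨ k = -e ^ 3 := by
  have hcop : IsCoprime k (2 * k + e ^ 3) := hke.pow_right.mul_add_right_right _
  obtain ⟨⟨s, hs⟩, w, hw⟩ := Int.eq_pow_of_mul_eq_pow_odd hcop (by decide) h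
  by_cases hs0 : s = 0
  · left; rw [hs, hs0]; rfl
  have hwe : IsCoprime w (-e) := by
    have : IsCoprime (2 * k + e ^ 3) e := by
      rw [pow_succ]
      exact ((Int.isCoprime_two_left.2 hodd).mul_left hke).add_mul_right_left _
    rw [hw, IsCoprime.pow_left_iff (by decide)] at this
    exact this.neg_right
  have := eq_of_cube_add_cube_eq_two_mul_cube hwe hs0 (by
    rw [← hw, ← hs, Odd.neg_pow (by decide)]; ring)
  rw [this, Odd.neg_pow (by decide)] at hw
  right; linarith

/-- The coprime integral form of the equation `y² = x³ + 1`. -/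
theorem eq_of_sq_eq_cube_add_pow_six {a b e : ℤ} (he : e ≠ 0) (hbe : IsCoprime b e)
    (h : b ^ 2 = a ^ 3 + e ^ 6) :
    b = 0 ∨ b = e ^ 3 ∨ b = -e ^ 3 ∨ b = 3 * e ^ 3 ∨ b = -3 * e ^ 3 := by
  rcases Int.even_or_odd (b - e ^ 3) with heven | hodd
  · have hparity : Odd b ∧ Odd e := by
      have h2 : ¬ (Even b ∧ Even e) := fun ⟨h1, h2⟩ ↦
        absurd (hbe.isUnit_of_dvd' h1.two_dvd h2.two_dvd) (by decide)
      simp only [← Int.not_even_iff_odd]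
      simp only [parity_simps] at heven
      tauto
    obtain ⟨hb_odd, he_odd⟩ := hparity
    have ha : Even a := by
      have : Even (a ^ 3) := by
        rw [show a ^ 3 = (b - e ^ 3) * (b + e ^ 3) by linarith]
        exact heven.mul_right _
      exact (Int.even_pow.1 this).1
    obtain ⟨c, rfl⟩ := ha.two_dvd
    obtain ⟨m, hm⟩ := heven.two_dvd
    obtain rfl : b = 2 * m + e ^ 3 := by linarith
    have hme : IsCoprime m e := by
      rw [pow_succ] at hbe
      exact hbe.of_add_mul_right_left.of_mul_left_right
    have hmc : m * (m + e ^ 3) = 2 * c ^ 3 := by linarith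
    rcases Int.even_or_odd' m with ⟨k, rfl | hk⟩
    · have := eq_zero_or_eq_neg_cube_of_mul_eq_cube he_odd hme.of_mul_left_right
        (a := c) (by linarith)
      grind
    · obtain ⟨l, hl⟩ := (Odd.add_odd ⟨k, hk⟩ (he_odd.pow (n := 3))).two_dvd
      obtain rfl : m = 2 * l + -e ^ 3 := by linarith
      have hle : IsCoprime (2 * l) e := by
        rw [pow_succ, ← neg_mul] at hme
        exact hme.of_add_mul_right_left
      have hneg : (-e) ^ 3 = -e ^ 3 := Odd.neg_pow (by decide) e
      have := eq_zero_or_eq_neg_cube_of_mul_eq_cube he_odd.neg hle.of_mul_left_right.neg_right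
        (a := c) (by rw [hneg]; linarith)
      grind
  · obtain ⟨⟨s, hs⟩, w, hw⟩ := Int.eq_pow_of_mul_eq_pow_odd (c := a)
      (isCoprime_sub_add_of_odd hbe.pow_right hodd) (by decide : Odd 3) (by linarith)
    have hcop := isCoprime_sub_add_of_odd hbe.pow_right hodd
    rw [hs, hw, IsCoprime.pow_iff (by decide) (by decide)] at hcop
    have := eq_of_cube_add_cube_eq_two_mul_cube hcop.symm.neg_right he (by
      rw [← hw, Odd.neg_pow (by decide), ← hs]; ring)
    rw [this, Odd.neg_pow (by decide)] at hw
    left; linarith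

/-- The only rational points on `y² = x³ + 1` have `y ∈ {0, ±1, ±3}`. -/
theorem eq_of_sq_eq_cube_add_one {x y : ℚ} (h : y ^ 2 = x ^ 3 + 1) :
    y = 0 ∨ y = 1 ∨ y = -1 ∨ y = 3 ∨ y = -3 := by
  have hden : y.den ^ 2 = x.den ^ 3 := by
    rw [← Rat.den_pow, ← Rat.den_pow, h]
    exact Rat.add_ofNat_den (x ^ 3) 1
  obtain ⟨e, he⟩ : x.den ∣ y.den := by
    rw [← Nat.pow_dvd_pow_iff two_ne_zero, hden]
    exact pow_dvd_pow _ (by decide)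
  have hx : x.den = e ^ 2 := by
    have := pow_pos x.den_pos 2
    rw [he] at hden
    nlinarith
  rw [hx] at he
  have he0 : e ≠ 0 := by rintro rfl; simp at hx
  have hx' : x = x.num / (e : ℚ) ^ 2 := by
    conv_lhs => rw [← Rat.num_div_den x, hx]
    push_cast; rfl
  have hy' : y = y.num / (e : ℚ) ^ 3 := by
    conv_lhs => rw [← Rat.num_div_den y, he]
    push_cast; ring
  have heq : y.num ^ 2 = x.num ^ 3 + (e : ℤ) ^ 6 := by
    rw [hx', hy'] at h
    field_simp at h
    exact_mod_cast h
  have hcop : IsCoprime y.num (e : ℤ) := by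
    have := Rat.isCoprime_num_den y
    rw [he] at this
    push_cast at this
    exact this.of_mul_right_right
  have := eq_of_sq_eq_cube_add_pow_six (by exact_mod_cast he0) hcop heq
  rw [hy']
  rcases this with h | h | h | h | h <;> rw [h] <;> push_cast <;> field_simp <;> simp

/-- The rational solutions `(r,y)` of `2y² = r³ + 12r² + 48r + 72` are exactly
`(0,6)`, `(0,−6)`, `(−4,2)`, `(−4,−2)`, and `(−6,0)`. -/
theorem stmt_8 (r y : ℚ) :
    2 * y ^ 2 = r ^ 3 + 12 * r ^ 2 + 48 * r + 72 ↔
      (r = 0 ∧ y = 6) ∨ (r = 0 ∧ y = -6) ∨ (r = -4 ∧ y = 2) ∨ (r = -4 ∧ y = -2) ∨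
        (r = -6 ∧ y = 0) := by
  constructor
  · intro h
    have key : ∀ c : ℚ, (r / 2 + 2) ^ 3 = c ^ 3 → r = 2 * c - 4 := fun c hc ↦ by
      have := (Odd.strictMono_pow (by decide : Odd 3)).injective hc
      linarith
    have hE : (y / 2) ^ 2 = (r / 2 + 2) ^ 3 + 1 := by linarith
    rcases eq_of_sq_eq_cube_add_one hE with h0 | h0 | h0 | h0 | h0 <;> rw [h0] at hE
    · have := key (-1) (by linarith); grind
    · have := key 0 (by linarith); grind
    · have := key 0 (by linarith); grind
    · have := key 2 (by linarith); grind
    · have := key 2 (by linarith); grind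
  · rintro (⟨rfl, rfl⟩ | ⟨rfl, rfl⟩ | ⟨rfl, rfl⟩ | ⟨rfl, rfl⟩ | ⟨rfl, rfl⟩) <;> norm_num
end

section
/- The only rational solution (X,Y) ∈ ℚ × ℚ of the equation Y² = X³ + 108X is (X,Y) = (0,0). -/
/-- A prime power dividing a product of coprime factors can be split off from one of them. -/
lemma exists_factor_of_coprime_of_mul_eq {x y q n : ℕ} (hxy : x.Coprime y) (hq : IsPrimePow q)
    (h : x * y = q * n) :
    (∃ z, x = q * z ∧ z.Coprime y ∧ z * y = n) ∨ (∃ z, y = q * z ∧ x.Coprime z ∧ x * z = n) := by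
  have hq0 : 0 < q := hq.pos
  rcases (hxy.isPrimePow_dvd_mul hq).1 ⟨n, h⟩ with ⟨z, rfl⟩ | ⟨z, rfl⟩
  · exact .inl ⟨z, rfl, hxy.coprime_mul_left, Nat.eq_of_mul_eq_mul_left hq0 (by rw [← h]; ring)⟩
  · exact .inr ⟨z, rfl, hxy.coprime_mul_left_right,
      Nat.eq_of_mul_eq_mul_left hq0 (by rw [← h]; ring)⟩

lemma exists_pow_four_of_coprime_of_mul_eq {x y n : ℕ} (hxy : x.Coprime y) (h : x * y = n ^ 4) :
    ∃ r s, x = r ^ 4 ∧ y = s ^ 4 ∧ r * s = n := by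
  obtain ⟨r, hr⟩ := exists_eq_pow_of_mul_eq_pow (Nat.isUnit_iff.2 hxy) h
  obtain ⟨s, hs⟩ := exists_eq_pow_of_mul_eq_pow (a := y) (b := x)
    (Nat.isUnit_iff.2 hxy.symm) (by rw [mul_comm, h])
  refine ⟨r, s, hr, hs, Nat.pow_left_injective (n := 4) (by norm_num) ?_⟩
  simp only [mul_pow, ← hr, ← hs, h]

lemma isPrimePow_twentySeven : IsPrimePow 27 :=
  (isPrimePow_nat_iff _).2 ⟨3, 3, Nat.prime_three, by norm_num, by norm_num⟩

lemma isPrimePow_four : IsPrimePow 4 :=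
  (isPrimePow_nat_iff _).2 ⟨2, 2, Nat.prime_two, by norm_num, by norm_num⟩

lemma sq_ne_four_mul_add_twentySeven_mul {r u v : ℕ} (hv : v % 2 = 1) :
    r ^ 2 ≠ 4 * u + 27 * v ^ 4 := by
  intro h
  have h4 := congrArg (· % 4) h
  have hv' : v % 4 = 1 ∨ v % 4 = 3 := by omega
  have hr : r % 4 = 0 ∨ r % 4 = 1 ∨ r % 4 = 2 ∨ r % 4 = 3 := by omega
  rcases hv' with hv' | hv' <;> rcases hr with hr | hr | hr | hr <;>
    simp [Nat.pow_mod, Nat.add_mod, Nat.mul_mod, hv', hr] at h4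

lemma three_dvd_of_three_dvd_sq_add_sq {a b : ℕ} (h : 3 ∣ a ^ 2 + b ^ 2) : 3 ∣ a := by
  have h3 := Nat.mod_eq_zero_of_dvd h
  have ha : a % 3 = 0 ∨ a % 3 = 1 ∨ a % 3 = 2 := by omega
  have hb : b % 3 = 0 ∨ b % 3 = 1 ∨ b % 3 = 2 := by omega
  rcases ha with ha | ha | ha
  · exact Nat.dvd_of_mod_eq_zero ha
  all_goals
    rcases hb with hb | hb | hb <;> simp [Nat.pow_mod, Nat.add_mod, ha, hb] at h3

/-- The first half of the descent, a `2`-isogeny lift from `Y² = X³ + 108X` to `Y² = X³ - 27X`. -/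
lemma exists_sq_add_eq_pow_four {a b c : ℕ} (hab : a.Coprime (6 * b))
    (h : a ^ 4 + 108 * b ^ 4 = c ^ 2) :
    ∃ r s, a ^ 2 + 27 * s ^ 4 = r ^ 4 ∧ r * s = b := by
  have ha3 : ¬ 3 ∣ a := fun h3 ↦
    Nat.not_coprime_of_dvd_of_dvd (by norm_num) h3 (Dvd.dvd.mul_right (by norm_num) b) hab
  obtain ⟨j, rfl⟩ : ∃ j, c = a ^ 2 + j := Nat.exists_eq_add_of_le (by
    by_contra! hlt
    nlinarith [Nat.zero_le (b ^ 4)])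
  have hj : 2 ∣ j := Nat.prime_two.dvd_of_dvd_pow (n := 2)
    ⟨54 * b ^ 4 - a ^ 2 * j, by zify [show a ^ 2 * j ≤ 54 * b ^ 4 by nlinarith]; zify at h; linarith⟩
  obtain ⟨k, rfl⟩ := hj
  have hk : k * (a ^ 2 + k) = 27 * b ^ 4 := by nlinarith
  have hcop : k.Coprime (a ^ 2 + k) := by
    refine Nat.coprime_of_dvd fun p hp hpk hpa ↦ ?_
    have hpa : p ∣ a := hp.dvd_of_dvd_pow ((Nat.dvd_add_left hpk).1 hpa)
    have hpb : p ∣ (6 * b) ^ 4 := by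
      have : p ∣ 48 * (k * (a ^ 2 + k)) := (hpk.mul_right _).mul_left _
      rw [hk] at this
      exact this.trans (Dvd.intro 1 (by ring))
    exact Nat.not_coprime_of_dvd_of_dvd hp.one_lt hpa (hp.dvd_of_dvd_pow hpb) hab
  rcases exists_factor_of_coprime_of_mul_eq hcop isPrimePow_twentySeven hk with
    ⟨z, rfl, hz, hzb⟩ | ⟨z, hz, hkz, hzb⟩
  · obtain ⟨s, r, rfl, hr, hb⟩ := exists_pow_four_of_coprime_of_mul_eq hz hzb
    exact ⟨r, s, hr, by rw [← hb, mul_comm]⟩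
  · obtain ⟨s, r, rfl, rfl, hb⟩ := exists_pow_four_of_coprime_of_mul_eq hkz hzb
    exact absurd (three_dvd_of_three_dvd_sq_add_sq (a := a) (b := s ^ 2)
      ⟨9 * r ^ 4, by linarith⟩) ha3

/-- The second half of the descent, a lift back to `Y² = X³ + 108X`. -/
lemma exists_pow_four_add_eq_sq {a r s : ℕ} (ha : a.Coprime (6 * (r * s)))
    (h : a ^ 2 + 27 * s ^ 4 = r ^ 4) :
    ∃ u v, v.Coprime (6 * u) ∧ v ^ 4 + 108 * u ^ 4 = r ^ 2 ∧ s = 2 * (u * v) := by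
  have ha2 : a % 2 = 1 := by
    by_contra h2
    exact Nat.not_coprime_of_dvd_of_dvd (d := 2) (by norm_num) (by omega)
      (Dvd.dvd.mul_right (by norm_num) _) ha
  have hs : 2 ∣ s := by
    by_contra hs
    have h8 := congrArg (· % 8) h
    have ha8 : a % 8 = 1 ∨ a % 8 = 3 ∨ a % 8 = 5 ∨ a % 8 = 7 := by omega
    have hs8 : s % 8 = 1 ∨ s % 8 = 3 ∨ s % 8 = 5 ∨ s % 8 = 7 := by omega
    have hr8 : r % 8 = 0 ∨ r % 8 = 1 ∨ r % 8 = 2 ∨ r % 8 = 3 ∨ r % 8 = 4 ∨ r % 8 = 5 ∨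
      r % 8 = 6 ∨ r % 8 = 7 := by omega
    have e1 : a ^ 2 % 8 = 1 := by rcases ha8 with e | e | e | e <;> simp [Nat.pow_mod, e]
    have e2 : s ^ 4 % 8 = 1 := by rcases hs8 with e | e | e | e <;> simp [Nat.pow_mod, e]
    have e3 : r ^ 4 % 8 = 0 ∨ r ^ 4 % 8 = 1 := by
      rcases hr8 with e | e | e | e | e | e | e | e <;> simp [Nat.pow_mod, e]
    omega
  obtain ⟨t, rfl⟩ := hs
  obtain ⟨j, hj⟩ : ∃ j, r ^ 2 = a + j := Nat.exists_eq_add_of_le (by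
    by_contra! hlt
    nlinarith [Nat.zero_le ((2 * t) ^ 4)])
  have hr2 : r % 2 = 1 := by
    have e : r ^ 4 % 2 = 1 := by
      have : a ^ 2 % 2 = 1 := by simp [Nat.pow_mod, ha2]
      have : (2 * t) ^ 4 = 2 * (8 * t ^ 4) := by ring
      omega
    by_contra hr
    simp [Nat.pow_mod, show r % 2 = 0 by omega] at e
  obtain ⟨k, rfl⟩ : 2 ∣ j := by
    have : r ^ 2 % 2 = 1 := by simp [Nat.pow_mod, hr2]
    omega
  have hk : k * (a + k) = 27 * (4 * t ^ 4) := by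
    have : (r ^ 2) ^ 2 = a ^ 2 + 27 * (2 * t) ^ 4 := by rw [h]; ring
    rw [hj] at this
    nlinarith
  have hcop : k.Coprime (a + k) := by
    refine Nat.coprime_of_dvd fun p hp hpk hpa ↦ ?_
    have hpa : p ∣ a := (Nat.dvd_add_left hpk).1 hpa
    have hpb : p ∣ (6 * (r * (2 * t))) ^ 4 := by
      have : p ∣ k * (a + k) := hpk.mul_right _
      rw [hk] at this
      exact this.trans ⟨192 * r ^ 4, by ring⟩
    exact Nat.not_coprime_of_dvd_of_dvd hp.one_lt hpa (hp.dvd_of_dvd_pow hpb) ha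
  have coprime_of {u v : ℕ} (huv : (27 * (4 * u ^ 4)).Coprime (v ^ 4)) : v.Coprime (6 * u) := by
    have h1 : (6 * u).Coprime v := by
      refine Nat.coprime_of_dvd fun p hp hpu hpv ↦ ?_
      refine Nat.not_coprime_of_dvd_of_dvd hp.one_lt (?_ : p ∣ _)
        (dvd_pow hpv (by norm_num)) huv
      rcases hp.dvd_mul.1 hpu with h6 | hu
      · exact (h6.trans (by norm_num : 6 ∣ 108)).trans ⟨u ^ 4, by ring⟩
      · exact ((dvd_pow hu (by norm_num : 4 ≠ 0)).mul_left _).mul_left _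
    exact h1.symm
  have odd_of {u v : ℕ} (huv : r ^ 2 = 4 * u ^ 4 + 27 * v ^ 4) : False := by
    refine sq_ne_four_mul_add_twentySeven_mul ?_ huv
    by_contra hv
    have e1 : v ^ 4 % 2 = 0 := by simp [Nat.pow_mod, show v % 2 = 0 by omega]
    have e2 : r ^ 2 % 2 = 1 := by simp [Nat.pow_mod, hr2]
    omega
  rcases exists_factor_of_coprime_of_mul_eq hcop isPrimePow_twentySeven hk with
    ⟨z, rfl, hz, hzt⟩ | ⟨z, hz, hkz, hzt⟩
  · rcases exists_factor_of_coprime_of_mul_eq hz isPrimePow_four hzt with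
      ⟨w, rfl, hw, hwt⟩ | ⟨w, hwa, hw, hwt⟩
    · obtain ⟨u, v, rfl, hv, rfl⟩ := exists_pow_four_of_coprime_of_mul_eq hw hwt
      rw [hv] at hcop
      exact ⟨u, v, coprime_of hcop, by omega, rfl⟩
    · obtain ⟨v, u, rfl, rfl, rfl⟩ := exists_pow_four_of_coprime_of_mul_eq hw hwt
      exact (odd_of (u := u) (v := v) (by omega)).elim
  · rcases exists_factor_of_coprime_of_mul_eq hkz isPrimePow_four hzt with
      ⟨w, rfl, hw, hwt⟩ | ⟨w, rfl, hw, hwt⟩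
    · obtain ⟨u, v, rfl, rfl, rfl⟩ := exists_pow_four_of_coprime_of_mul_eq hw hwt
      exact (odd_of (u := u) (v := v) (by omega)).elim
    · obtain ⟨v, u, rfl, rfl, rfl⟩ := exists_pow_four_of_coprime_of_mul_eq hw hwt
      rw [hz] at hcop
      exact ⟨u, v, coprime_of hcop.symm, by omega, by ring⟩

lemma pow_four_add_ne_sq_of_coprime_six {a b c : ℕ} (hab : a.Coprime (6 * b)) (hb : 0 < b) :
    a ^ 4 + 108 * b ^ 4 ≠ c ^ 2 := by
  induction b using Nat.strong_induction_on generalizing a c with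
  | _ b ih =>
    intro h
    obtain ⟨r, s, hrs, rfl⟩ := exists_sq_add_eq_pow_four hab h
    obtain ⟨u, v, huv, hr, rfl⟩ := exists_pow_four_add_eq_sq hab hrs
    have hr0 : 0 < r := Nat.pos_of_ne_zero fun h0 ↦ by simp [h0] at hb
    have hu0 : 0 < u := Nat.pos_of_ne_zero fun h0 ↦ by simp [h0] at hb
    have hv0 : 0 < v := Nat.pos_of_ne_zero fun h0 ↦ by simp [h0] at hb
    refine ih u ?_ huv hu0 hr
    have : u * 1 ≤ u * (r * v) := Nat.mul_le_mul_left _ (Nat.mul_pos hr0 hv0)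
    linarith [show r * (2 * (u * v)) = 2 * (u * (r * v)) by ring]

/-- A multiple of `27` that is a square is a multiple of `81`. -/
lemma nine_dvd_of_dvd_sq {c : ℕ} (h : 27 ∣ c ^ 2) : 9 ∣ c := by
  obtain ⟨d, rfl⟩ : 3 ∣ c := Nat.prime_three.dvd_of_dvd_pow ((by norm_num : 3 ∣ 27).trans h)
  have : 3 ∣ d ^ 2 := by
    rw [mul_pow] at h
    omega
  obtain ⟨e, rfl⟩ := Nat.prime_three.dvd_of_dvd_pow this
  exact ⟨e, by ring⟩

lemma three_dvd_of_eighty_one_mul_add {a b c k : ℕ} (hk : k.Coprime 3)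
    (h : 81 * a + 27 * (k * b ^ 4) = c ^ 2) : 3 ∣ b := by
  obtain ⟨d, rfl⟩ := nine_dvd_of_dvd_sq (c := c) ⟨3 * a + k * b ^ 4, by rw [← h]; ring⟩
  have : 3 ∣ k * b ^ 4 := by
    rw [mul_pow] at h
    omega
  exact Nat.prime_three.dvd_of_dvd_pow (hk.symm.dvd_of_dvd_mul_left this)

lemma pow_four_add_ne_sq {a b c : ℕ} (hab : a.Coprime b) (hb : 0 < b) :
    a ^ 4 + 108 * b ^ 4 ≠ c ^ 2 := by
  intro h
  have h2 : ¬ 2 ∣ a := by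
    rintro ⟨d, rfl⟩
    obtain ⟨e, rfl⟩ : 2 ∣ c := Nat.prime_two.dvd_of_dvd_pow (n := 2)
      ⟨8 * d ^ 4 + 54 * b ^ 4, by rw [← h]; ring⟩
    refine sq_ne_four_mul_add_twentySeven_mul (r := e) (u := d ^ 4) (v := b) ?_ (by linarith)
    by_contra hb2
    exact Nat.not_coprime_of_dvd_of_dvd (d := 2) (by norm_num) ⟨d, rfl⟩ (by omega) hab
  have h3 : ¬ 3 ∣ a := by
    rintro ⟨d, rfl⟩
    have := three_dvd_of_eighty_one_mul_add (a := d ^ 4) (b := b) (c := c) (k := 4)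
      (by norm_num) (by rw [← h]; ring)
    exact Nat.not_coprime_of_dvd_of_dvd (d := 3) (by norm_num) ⟨d, rfl⟩ this hab
  have h6 : a.Coprime 6 := (Nat.Coprime.mul_left ((Nat.prime_two.coprime_iff_not_dvd).2 h2)
    ((Nat.prime_three.coprime_iff_not_dvd).2 h3) : Nat.Coprime (2 * 3) a).symm
  exact pow_four_add_ne_sq_of_coprime_six (h6.mul_right hab) hb h

lemma two_mul_pow_four_add_ne_sq {a b c : ℕ} (hab : a.Coprime b) :
    2 * a ^ 4 + 54 * b ^ 4 ≠ c ^ 2 := by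
  intro h
  have ha : 3 ∣ a := by
    have := three_dvd_of_three_dvd_sq_add_sq (a := a ^ 2) (b := c)
      ⟨a ^ 4 + 18 * b ^ 4, by rw [← h]; ring⟩
    exact Nat.prime_three.dvd_of_dvd_pow this
  obtain ⟨d, rfl⟩ := ha
  have := three_dvd_of_eighty_one_mul_add (a := 2 * d ^ 4) (b := b) (c := c) (k := 2)
    (by norm_num) (by rw [← h]; ring)
  exact Nat.not_coprime_of_dvd_of_dvd (d := 3) (by norm_num) ⟨d, rfl⟩ this hab

lemma exists_nat_sq_of_rat_sq {n : ℕ} {w : ℚ} (h : (n : ℚ) = w ^ 2) : ∃ c : ℕ, n = c ^ 2 := by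
  have : IsSquare (n : ℚ) := ⟨w, by rw [h, sq]⟩
  obtain ⟨c, hc⟩ := Rat.isSquare_natCast_iff.1 this
  exact ⟨c, by rw [hc, sq]⟩

lemma rat_pow_four_add_ne_sq (s w : ℚ) : s ^ 4 + 108 ≠ w ^ 2 := by
  intro h
  have habs : ((s.num.natAbs : ℕ) : ℚ) ^ 4 = (s.num : ℚ) ^ 4 := by
    rw [Nat.cast_natAbs, Int.cast_abs, Even.pow_abs ⟨2, rfl⟩]
  have hs : (s.num : ℚ) = s * s.den := (Rat.mul_den_eq_num s).symm
  obtain ⟨c, hc⟩ := exists_nat_sq_of_rat_sq (n := s.num.natAbs ^ 4 + 108 * s.den ^ 4)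
    (w := w * s.den ^ 2) (by push_cast [habs, hs]; rw [mul_pow w, ← h]; ring)
  exact pow_four_add_ne_sq s.reduced s.den_pos hc

lemma rat_two_mul_pow_four_add_ne_sq (s w : ℚ) : 2 * s ^ 4 + 54 ≠ w ^ 2 := by
  intro h
  have habs : ((s.num.natAbs : ℕ) : ℚ) ^ 4 = (s.num : ℚ) ^ 4 := by
    rw [Nat.cast_natAbs, Int.cast_abs, Even.pow_abs ⟨2, rfl⟩]
  have hs : (s.num : ℚ) = s * s.den := (Rat.mul_den_eq_num s).symm
  obtain ⟨c, hc⟩ := exists_nat_sq_of_rat_sq (n := 2 * s.num.natAbs ^ 4 + 54 * s.den ^ 4)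
    (w := w * s.den ^ 2) (by push_cast [habs, hs]; rw [mul_pow w, ← h]; ring)
  exact two_mul_pow_four_add_ne_sq s.reduced hc

lemma dvd_six_of_squarefree {d : ℕ} (hd : Squarefree d) (h : ∀ p, p.Prime → p ∣ d → p ∣ 6) :
    d ∣ 6 := by
  rw [← Nat.prod_primeFactors_of_squarefree hd]
  refine Finset.prod_primes_dvd _ (fun p hp ↦ (Nat.prime_of_mem_primeFactors hp).prime)
    fun p hp ↦ h p (Nat.prime_of_mem_primeFactors hp) (Nat.dvd_of_mem_primeFactors hp)

/-- Modulo squares, the abscissa of a point of `Y² = X³ + 108X` is a divisor of `6`. -/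
lemma exists_dvd_six_mul_sq {X Y : ℚ} (hX : 0 < X) (h : Y ^ 2 = X ^ 3 + 108 * X) :
    ∃ d : ℕ, ∃ s : ℚ, d ∣ 6 ∧ X = d * s ^ 2 := by
  obtain ⟨p, q, hq, hpq, rfl⟩ : ∃ p q : ℕ, 0 < q ∧ p.Coprime q ∧ X = p / q := by
    refine ⟨X.num.natAbs, X.den, X.den_pos, X.reduced, ?_⟩
    rw [Nat.cast_natAbs, abs_of_pos (Rat.num_pos.2 hX), Rat.num_div_den]
  have hq0 : (q : ℚ) ≠ 0 := by exact_mod_cast hq.ne'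
  obtain ⟨c, hc⟩ := exists_nat_sq_of_rat_sq (n := p * q * (p ^ 2 + 108 * q ^ 2))
    (w := Y * q ^ 2) (by push_cast; rw [mul_pow, h]; field_simp)
  obtain ⟨d, m, hdm, hd⟩ := Nat.sq_mul_squarefree (p * q)
  refine ⟨d, m / q, dvd_six_of_squarefree hd fun ℓ hℓ hℓd ↦ ?_, ?_⟩
  · have hp0 : p ≠ 0 := by rintro rfl; simp at hX
    have hm0 : 0 < m := Nat.pos_of_ne_zero fun h0 ↦ by simp [h0, hp0, hq.ne'] at hdm
    have hd0 : 0 < d := hd.ne_zero.bot_lt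
    obtain ⟨e, rfl⟩ : m ∣ c := (Nat.pow_dvd_pow_iff two_ne_zero).1
      ⟨d * (p ^ 2 + 108 * q ^ 2), by rw [← hc, ← hdm]; ring⟩
    have he : d * (p ^ 2 + 108 * q ^ 2) = e ^ 2 :=
      Nat.eq_of_mul_eq_mul_left (pow_pos hm0 2) (by rw [← mul_pow, ← hc, ← hdm]; ring)
    obtain ⟨f, rfl⟩ : d ∣ e := (hd.dvd_pow_iff_dvd two_ne_zero).1 ⟨_, he.symm⟩
    have hf : p ^ 2 + 108 * q ^ 2 = d * f ^ 2 :=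
      Nat.eq_of_mul_eq_mul_left hd0 (by rw [he]; ring)
    have hℓf : ℓ ∣ p ^ 2 + 108 * q ^ 2 := hf ▸ hℓd.mul_right _
    have hℓpq : ℓ ∣ p * q := hdm ▸ hℓd.mul_left _
    have hnot (hp : ℓ ∣ p) (hq : ℓ ∣ q) : False :=
      Nat.not_coprime_of_dvd_of_dvd hℓ.one_lt hp hq hpq
    rcases hℓ.dvd_mul.1 hℓpq with hp | hq
    · have h108 := (Nat.dvd_add_right (dvd_pow hp two_ne_zero)).1 hℓf
      rcases hℓ.dvd_mul.1 h108 with h108 | hq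
      · exact hℓ.dvd_of_dvd_pow (n := 3) (h108.trans (by norm_num))
      · exact (hnot hp (hℓ.dvd_of_dvd_pow hq)).elim
    · have hp := (Nat.dvd_add_left ((dvd_pow hq two_ne_zero).mul_left 108)).1 hℓf
      exact (hnot (hℓ.dvd_of_dvd_pow hp) hq).elim
  · have : (m : ℚ) ^ 2 * d = p * q := by exact_mod_cast hdm
    field_simp
    linarith

/-- The only rational solution `(X,Y)` of `Y² = X³ + 108X` is `(0,0)`. -/
theorem stmt_9 (X Y : ℚ) : Y ^ 2 = X ^ 3 + 108 * X ↔ X = 0 ∧ Y = 0 := by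
  refine ⟨fun h ↦ ?_, by rintro ⟨rfl, rfl⟩; norm_num⟩
  rcases lt_trichotomy X 0 with hX | rfl | hX
  · nlinarith [sq_nonneg Y, sq_nonneg X, mul_nonneg (sq_nonneg X) (neg_pos.2 hX).le]
  · exact ⟨rfl, by simpa using h⟩
  · exfalso
    obtain ⟨d, s, hd, rfl⟩ := exists_dvd_six_mul_sq hX h
    have hs : s ≠ 0 := by rintro rfl; simp at hX
    have hd' : d ∈ Nat.divisors 6 := by simpa using hd
    rw [show Nat.divisors 6 = {1, 2, 3, 6} by decide] at hd'
    simp only [Finset.mem_insert, Finset.mem_singleton] at hd'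
    rcases hd' with rfl | rfl | rfl | rfl
    · refine rat_pow_four_add_ne_sq s (Y / s) ?_
      rw [div_pow, h]; field_simp; push_cast; ring
    · refine rat_two_mul_pow_four_add_ne_sq s (Y / (2 * s)) ?_
      rw [div_pow, h]; field_simp; push_cast; ring
    · refine rat_pow_four_add_ne_sq (6 / s) (2 * Y / s ^ 3) ?_
      rw [div_pow, div_pow, mul_pow, h]; field_simp; push_cast; ring
    · refine rat_two_mul_pow_four_add_ne_sq (3 / s) (Y / (2 * s ^ 3)) ?_
      rw [div_pow, div_pow, mul_pow, h]; field_simp; push_cast; ring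
end

section
/- Let c be a nonzero rational number such that the polynomial x⁶ − 4x² − c² ∈ ℚ[x] is reducible over ℚ. Then there exists v ∈ ℚ, v ≠ 0, such that c = (v⁴ + 16)/(8v). -/
open Polynomial

/-- The elliptic curve `y² = x³ - 4x` has no rational point with `y ≠ 0`. -/
theorem sq_ne_cube_sub_four_mul {c : ℚ} (hc : c ≠ 0) (a : ℚ) : c ^ 2 ≠ a ^ 3 - 4 * a := by
  intro h
  have ha : a ≠ 0 := by
    rintro rfl
    exact hc (by simpa using h)
  set r : ℚ := c / (2 * a) with hr
  have hr0 : r ≠ 0 := by positivity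
  have hw : r ^ 4 + 1 = ((a ^ 2 + 4) / (4 * a)) ^ 2 := by
    have h4 : c ^ 4 = (a ^ 3 - 4 * a) ^ 2 := by rw [← h]; ring
    rw [hr, div_pow, h4]
    field_simp
    ring
  have hsq : IsSquare (r.num ^ 4 + (r.den : ℤ) ^ 4) := by
    rw [← Rat.isSquare_intCast_iff]
    refine ⟨(r.den : ℚ) ^ 2 * ((a ^ 2 + 4) / (4 * a)), ?_⟩
    have hd : (r.den : ℚ) ≠ 0 := by exact_mod_cast r.den_nz
    have hn : (r.num : ℚ) = r * r.den := (Rat.mul_den_eq_num r).symm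
    push_cast
    rw [hn]
    linear_combination (r.den : ℚ) ^ 4 * hw
  obtain ⟨s, hs⟩ := hsq
  exact not_fermat_42 (Rat.num_ne_zero.mpr hr0) (Int.natCast_ne_zero.mpr r.den_nz)
    (by rw [hs, sq])

theorem sum_coeff_mul_coeff_of_mul_eq (c : ℚ) {p q : ℚ[X]}
    (h : p * q = X ^ 6 - 4 * X ^ 2 - C (c ^ 2)) (n : ℕ) :
    ∑ x ∈ Finset.HasAntidiagonal.antidiagonal n, p.coeff x.1 * q.coeff x.2 =
      (if n = 6 then 1 else 0) - 4 * (if n = 2 then 1 else 0) - if n = 0 then c ^ 2 else 0 := by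
  rw [← coeff_mul, h, show (4 : ℚ[X]) = C 4 from rfl, coeff_sub, coeff_sub, coeff_C_mul,
    coeff_X_pow, coeff_X_pow, coeff_C]

/-- If `c` is a nonzero rational number such that `x⁶ − 4x² − c²` is reducible over `ℚ`,
then `c = (v⁴ + 16)/(8v)` for some nonzero `v ∈ ℚ`. -/
theorem stmt_10 (c : ℚ) (hc : c ≠ 0)
    (hred : ¬ Irreducible (X ^ 6 - 4 * X ^ 2 - C (c ^ 2) : ℚ[X])) :
    ∃ v : ℚ, v ≠ 0 ∧ c = (v ^ 4 + 16) / (8 * v) := by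
  have hdeg : (X ^ 6 - 4 * X ^ 2 - C (c ^ 2) : ℚ[X]).natDegree = 6 := by compute_degree!
  have hmonic : (X ^ 6 - 4 * X ^ 2 - C (c ^ 2) : ℚ[X]).Monic := by monicity!
  have hne : (X ^ 6 - 4 * X ^ 2 - C (c ^ 2) : ℚ[X]) ≠ 1 := by
    intro h
    rw [h, natDegree_one] at hdeg
    omega
  rw [hmonic.irreducible_iff_natDegree'] at hred
  push Not at hred
  obtain ⟨p, q, hp, hq, hpq, hq0⟩ := hred hne
  have hsum : p.natDegree + q.natDegree = 6 := by rw [← hp.natDegree_mul hq, hpq, hdeg]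
  rw [hdeg, Finset.mem_Ioc] at hq0
  have hcoeff := sum_coeff_mul_coeff_of_mul_eq c hpq
  have hp1 := hp.coeff_natDegree
  have hq1 := hq.coeff_natDegree
  have hpz : ∀ n, p.natDegree < n → p.coeff n = 0 := fun n => coeff_eq_zero_of_natDegree_lt
  have hqz : ∀ n, q.natDegree < n → q.coeff n = 0 := fun n => coeff_eq_zero_of_natDegree_lt
  have h0 := hcoeff 0
  have h1 := hcoeff 1
  have h2 := hcoeff 2
  have h3 := hcoeff 3
  have h4 := hcoeff 4
  have h5 := hcoeff 5
  simp only [Finset.Nat.sum_antidiagonal_eq_sum_range_succ_mk, Finset.sum_range_succ,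
    Finset.sum_range_zero, Nat.reduceSub, Nat.reduceEqDiff, if_true, if_false, zero_add,
    OfNat.ofNat_ne_zero, OfNat.zero_ne_ofNat, one_ne_zero] at h0 h1 h2 h3 h4 h5
  obtain ⟨hl, hu⟩ := hq0
  have hk : q.natDegree = 1 ∨ q.natDegree = 2 ∨ q.natDegree = 3 := by omega
  rcases hk with hk | hk | hk
  · have hroot : (X ^ 6 - 4 * X ^ 2 - C (c ^ 2) : ℚ[X]).eval (-q.coeff 0) = 0 := by
      have hqX : q = X + C (q.coeff 0) := hq.eq_X_add_C hk
      have : q.eval (-q.coeff 0) = 0 := by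
        conv_lhs => rw [hqX]
        simp
      rw [← hpq, eval_mul, this, mul_zero]
    simp at hroot
    exact (sq_ne_cube_sub_four_mul hc ((q.coeff 0) ^ 2) (by linear_combination -hroot)).elim
  · have hk' : p.natDegree = 4 := by omega
    rw [hk] at hq1 hqz
    rw [hk'] at hp1 hpz
    simp only [hp1, hq1, hpz 5 (by omega), hqz 3 (by omega), hqz 4 (by omega),
      hqz 5 (by omega)] at h0 h1 h2 h3 h4 h5
    generalize q.coeff 0 = w at *
    generalize q.coeff 1 = u at *
    generalize p.coeff 0 = k at *
    generalize p.coeff 1 = n at *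
    generalize p.coeff 2 = m at *
    generalize p.coeff 3 = l at *
    obtain rfl : l = -u := by linear_combination h5
    obtain rfl : m = u ^ 2 - w := by linear_combination h4
    obtain rfl : n = u * (2 * w - u ^ 2) := by linear_combination h3
    have hu : u * (k + w * (2 * w - u ^ 2)) = 0 := by linear_combination h1
    rcases mul_eq_zero.mp hu with rfl | hu
    · exact (sq_ne_cube_sub_four_mul hc (-w) (by linear_combination h0 - w * h2)).elim
    · obtain rfl : k = -(w * (2 * w - u ^ 2)) := by linear_combination hu
      exact (sq_ne_cube_sub_four_mul hc (2 * w - u ^ 2)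
        (by linear_combination h0 + (2 * w - u ^ 2) * h2)).elim
  · have hk' : p.natDegree = 3 := by omega
    rw [hk] at hq1 hqz
    rw [hk'] at hp1 hpz
    simp only [hp1, hq1, hpz 4 (by omega), hpz 5 (by omega), hqz 4 (by omega),
      hqz 5 (by omega)] at h0 h1 h2 h3 h4 h5
    generalize p.coeff 0 = d at *
    generalize p.coeff 1 = b at *
    generalize p.coeff 2 = a at *
    generalize q.coeff 0 = k at *
    generalize q.coeff 1 = f at *
    generalize q.coeff 2 = e at *
    obtain rfl : e = -a := by linear_combination h5
    obtain rfl : f = a ^ 2 - b := by linear_combination h4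
    obtain rfl : k = a * (2 * b - a ^ 2) - d := by linear_combination h3
    have hb : (2 * b - a ^ 2) * (a * b - d) = 0 := by linear_combination h1
    rcases mul_eq_zero.mp hb with hb | hb
    · obtain rfl : b = a ^ 2 / 2 := by linear_combination hb / 2
      have had : 8 * a * d = a ^ 4 + 16 := by linear_combination -4 * h2
      have ha : a ≠ 0 := by
        rintro rfl
        norm_num at had
      have hcd : c ^ 2 = d ^ 2 := by linear_combination h0
      rcases sq_eq_sq_iff_eq_or_eq_neg.mp hcd with rfl | rfl
      · exact ⟨a, ha, by field_simp; linear_combination had⟩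
      · exact ⟨-a, neg_ne_zero.mpr ha, by field_simp; linear_combination -had⟩
    · obtain rfl : d = a * b := by linear_combination -hb
      exact (sq_ne_cube_sub_four_mul hc (-b) (by linear_combination h0 - b * h2)).elim
end

section
/- There is no pair (v,x) ∈ ℚ × ℚ satisfying 8vx³ − 8v²x² + 4v³x − v⁴ − 16 = 0, and there is no pair (v,x) ∈ ℚ × ℚ satisfying 8vx³ + 8v²x² + 4v³x + v⁴ + 16 = 0. -/
/-- If `ab` and `a² + ab + b²` multiply to a nonzero fourth power with `a`, `b` coprime, then
`(a + b)² = ab + (a² + ab + b²)` is a nontrivial sum of two fourth powers, contradicting Fermat. -/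
theorem Int.mul_mul_sq_add_mul_add_sq_ne_pow_four {a b c : ℤ} (hab : IsCoprime a b) (hc : c ≠ 0) :
    a * b * (a ^ 2 + a * b + b ^ 2) ≠ c ^ 4 := by
  intro h
  have hcop : IsCoprime (a * b) (a ^ 2 + a * b + b ^ 2) := by
    refine IsCoprime.mul_left ?_ ?_
    · have : IsCoprime a (b ^ 2 + a * (a + b)) :=
        IsCoprime.add_mul_left_right hab.pow_right (a + b)
      convert this using 1; ring
    · have : IsCoprime b (a ^ 2 + b * (a + b)) :=
        IsCoprime.add_mul_left_right hab.symm.pow_right (a + b)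
      convert this using 1; ring
  have hprod : 0 < a * b * (a ^ 2 + a * b + b ^ 2) := by rw [h]; positivity
  have hN : 0 < a ^ 2 + a * b + b ^ 2 := by
    have h1 : 0 ≤ a ^ 2 + a * b + b ^ 2 := by nlinarith [sq_nonneg (a + b), sq_nonneg a, sq_nonneg b]
    exact h1.lt_of_ne' (right_ne_zero_of_mul hprod.ne')
  have hM : 0 < a * b := pos_of_mul_pos_left hprod hN.le
  have fourth_power : ∀ {m n : ℤ}, 0 < m → IsCoprime m n → m * n = c ^ 4 →
      ∃ d : ℤ, d ≠ 0 ∧ d ^ 4 = m := by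
    intro m n hm hmn hmul
    obtain ⟨d, hd⟩ := exists_associated_pow_of_mul_eq_pow' hmn hmul
    have hdm : d ^ 4 = m := by
      rcases Int.associated_iff.mp hd with hd | hd
      · exact hd
      · have : 0 ≤ d ^ 4 := by positivity
        linarith
    refine ⟨d, ?_, hdm⟩
    rintro rfl
    simp at hdm
    omega
  obtain ⟨d, hd, hdM⟩ := fourth_power hM hcop h
  obtain ⟨e, he, heN⟩ := fourth_power hN hcop.symm (by rw [mul_comm, h])
  exact not_fermat_42 (c := a + b) hd he (by rw [hdM, heN]; ring)

theorem Rat.mul_mul_sq_add_mul_add_sq_ne_sixteen (u v : ℚ) :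
    u * v * (u ^ 2 + u * v + v ^ 2) ≠ 16 := by
  intro h
  have hv : v ≠ 0 := by rintro rfl; norm_num at h
  set m : ℚ := u / v
  have hu : u = m * v := (div_mul_cancel₀ u hv).symm
  have hden : (m.den : ℚ) ≠ 0 := by exact_mod_cast m.den_nz
  have hnum : (m.num : ℚ) = m * m.den := (Rat.mul_den_eq_num m).symm
  set r : ℚ := 2 * m.den / v with hr
  have hr4 : ((m.num * m.den * (m.num ^ 2 + m.num * m.den + m.den ^ 2) : ℤ) : ℚ) = r ^ 4 := by
    push_cast
    rw [hnum, hr, div_pow, eq_div_iff (pow_ne_zero 4 hv)]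
    rw [hu] at h
    linear_combination (m.den : ℚ) ^ 4 * h
  have hrden : r.den = 1 := by
    have h1 : (r ^ 4).den = 1 := by rw [← hr4]; exact Rat.den_intCast _
    rw [Rat.den_pow] at h1
    exact (Nat.pow_eq_one.mp h1).resolve_right (by norm_num)
  have hrnum : (r.num : ℚ) = r := Rat.coe_int_num_of_den_eq_one hrden
  have hr0 : r ≠ 0 := div_ne_zero (mul_ne_zero two_ne_zero hden) hv
  refine Int.mul_mul_sq_add_mul_add_sq_ne_pow_four (a := m.num) (b := m.den) (c := r.num)
    (Rat.isCoprime_num_den m) (Rat.num_ne_zero.mpr hr0) ?_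
  rw [← hrnum] at hr4
  exact_mod_cast hr4

/-- The affine plane curves `8vx³ − 8v²x² + 4v³x − v⁴ − 16 = 0` and
`8vx³ + 8v²x² + 4v³x + v⁴ + 16 = 0` have no rational points. -/
theorem stmt_11 :
    (∀ v x : ℚ, 8 * v * x ^ 3 - 8 * v ^ 2 * x ^ 2 + 4 * v ^ 3 * x - v ^ 4 - 16 ≠ 0) ∧
    (∀ v x : ℚ, 8 * v * x ^ 3 + 8 * v ^ 2 * x ^ 2 + 4 * v ^ 3 * x + v ^ 4 + 16 ≠ 0) := by
  refine ⟨fun v x h => ?_, fun v x h => ?_⟩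
  · exact Rat.mul_mul_sq_add_mul_add_sq_ne_sixteen (2 * x - v) v (by linear_combination h)
  · exact Rat.mul_mul_sq_add_mul_add_sq_ne_sixteen (2 * x + v) (-v) (by linear_combination -h)
end

section
/- Suppose v ∈ ℚ is nonzero and c = (v⁴ + 16)/(8v). Then in ℚ[x] one has the factorization 64v²·(x⁶ − 4x² − c²) = (8vx³ − 8v²x² + 4v³x − v⁴ − 16)·(8vx³ + 8v²x² + 4v³x + v⁴ + 16), and both cubic factors are irreducible over ℚ. -/
open Polynomial

/-- There are no nonzero rational solutions of `a⁴ + b⁴ = c²`. -/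
theorem rat_not_fermat_42 {a b c : ℚ} (ha : a ≠ 0) (hb : b ≠ 0) : a ^ 4 + b ^ 4 ≠ c ^ 2 := by
  intro h
  have hda : (a.den : ℚ) ≠ 0 := by exact_mod_cast a.den_nz
  have hdb : (b.den : ℚ) ≠ 0 := by exact_mod_cast b.den_nz
  have hdc : (c.den : ℚ) ≠ 0 := by exact_mod_cast c.den_nz
  have ha' : a * a.den = a.num := Rat.mul_den_eq_num a
  have hb' : b * b.den = b.num := Rat.mul_den_eq_num b
  have hc' : c * c.den = c.num := Rat.mul_den_eq_num c
  refine not_fermat_42 (a := a.num * b.den * c.den) (b := b.num * a.den * c.den)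
    (c := c.num * a.den ^ 2 * b.den ^ 2 * c.den) ?_ ?_ ?_
  · have := Rat.num_ne_zero.mpr ha
    positivity
  · have := Rat.num_ne_zero.mpr hb
    positivity
  · have key : ((a.num : ℚ) * b.den * c.den) ^ 4 + (b.num * a.den * c.den) ^ 4 =
        (c.num * a.den ^ 2 * b.den ^ 2 * c.den) ^ 2 := by
      rw [← ha', ← hb', ← hc']
      linear_combination (a.den * b.den * c.den : ℚ) ^ 4 * h
    exact_mod_cast key

/-- For `c ≠ 0`, the polynomial `x⁶ - 4x² - c²` has no rational root. -/
theorem sextic_ne_zero {c : ℚ} (hc : c ≠ 0) (x : ℚ) : x ^ 6 - 4 * x ^ 2 - c ^ 2 ≠ 0 := by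
  intro h
  have hx : x ≠ 0 := by
    rintro rfl
    exact hc (by simpa using h)
  refine rat_not_fermat_42 (a := c / x) (b := 2 * x) (c := x ^ 4 + 4)
    (div_ne_zero hc hx) (mul_ne_zero two_ne_zero hx) ?_
  have hy : (c / x) ^ 2 = x ^ 4 - 4 := by
    field_simp
    linear_combination -h
  linear_combination ((c / x) ^ 2 + x ^ 4 - 4) * hy

/-- A rational cubic without rational roots is irreducible. -/
theorem irreducible_cubic {p : ℚ[X]} (hp : p.natDegree = 3) (h : ∀ x, p.eval x ≠ 0) :
    Irreducible p := by
  rw [irreducible_iff_roots_eq_zero_of_degree_le_three (by lia) (by lia)]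
  exact Multiset.eq_zero_of_forall_notMem fun x hx => h x (isRoot_of_mem_roots hx)

/-- If `v ∈ ℚ` is nonzero and `c = (v⁴ + 16)/(8v)`, then in `ℚ[x]` one has
`64v²·(x⁶ − 4x² − c²) = (8vx³ − 8v²x² + 4v³x − (v⁴ + 16))·(8vx³ + 8v²x² + 4v³x + (v⁴ + 16))`,
and both cubic factors are irreducible over `ℚ`. -/
theorem stmt_12 (v : ℚ) (hv : v ≠ 0) (c : ℚ) (hc : c = (v ^ 4 + 16) / (8 * v)) :
    C (64 * v ^ 2) * (X ^ 6 - 4 * X ^ 2 - C (c ^ 2)) =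
      (C (8 * v) * X ^ 3 - C (8 * v ^ 2) * X ^ 2 + C (4 * v ^ 3) * X - C (v ^ 4 + 16)) *
        (C (8 * v) * X ^ 3 + C (8 * v ^ 2) * X ^ 2 + C (4 * v ^ 3) * X + C (v ^ 4 + 16)) ∧
    Irreducible
      (C (8 * v) * X ^ 3 - C (8 * v ^ 2) * X ^ 2 + C (4 * v ^ 3) * X - C (v ^ 4 + 16) : ℚ[X]) ∧
    Irreducible
      (C (8 * v) * X ^ 3 + C (8 * v ^ 2) * X ^ 2 + C (4 * v ^ 3) * X + C (v ^ 4 + 16) : ℚ[X]) := by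
  have hcne : c ≠ 0 := by
    rw [hc]
    positivity
  have hcv : 8 * v * c = v ^ 4 + 16 := by
    rw [hc]
    field_simp
  have h8 : 8 * v ≠ 0 := by positivity
  refine (and_iff_left_of_imp fun hfac => ?_).mpr ?_
  · have hroot (x : ℚ) := congrArg (eval x) hfac
    have hne (x : ℚ) :
        eval x (C (64 * v ^ 2) * (X ^ 6 - 4 * X ^ 2 - C (c ^ 2))) ≠ 0 := by
      have := sextic_ne_zero hcne x
      simpa [hv] using this
    refine ⟨irreducible_cubic (by compute_degree!) fun x hx => hne x ?_,
      irreducible_cubic (by compute_degree!) fun x hx => hne x ?_⟩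
    · rw [hroot, eval_mul, hx, zero_mul]
    · rw [hroot, eval_mul, hx, mul_zero]
  · rw [← hcv]
    have hcv' : (8 * C v * C c : ℚ[X]) = C v ^ 4 + 16 := by
      simpa only [map_mul, map_add, map_pow, map_ofNat] using congrArg (C : ℚ → ℚ[X]) hcv
    simp only [map_mul, map_pow, map_ofNat]
    linear_combination (16 * C v ^ 2 * X ^ 2) * hcv'
end

section
/- Let F₁(t,x) = x³ + 48x² + (336 − 1296t²)x − 10368t² + 640 and let c be a nonzero rational number. Then the polynomial F₁(c,x) ∈ ℚ[x] has a rational root if and only if there exists v ∈ ℚ with v² ≠ 1 such that c = (v³ − 9v)/(9(1 − v²)). -/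
/-- For nonzero `c ∈ ℚ`, the polynomial
`F₁(c,x) = x³ + 48x² + (336 − 1296c²)x − 10368c² + 640` has a rational root if and only if
`c = (v³ − 9v)/(9(1 − v²))` for some `v ∈ ℚ` with `v² ≠ 1`. -/
theorem stmt_13 (c : ℚ) (hc : c ≠ 0) :
    (∃ x : ℚ, x ^ 3 + 48 * x ^ 2 + (336 - 1296 * c ^ 2) * x - 10368 * c ^ 2 + 640 = 0) ↔
      ∃ v : ℚ, v ^ 2 ≠ 1 ∧ c = (v ^ 3 - 9 * v) / (9 * (1 - v ^ 2)) := by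
  constructor
  · rintro ⟨x, hx⟩
    have key : (36 * c) ^ 2 * (x + 8) = (x + 4) ^ 2 * (x + 40) := by linear_combination -hx
    have h4 : x + 4 ≠ 0 := by
      intro h
      obtain rfl : x = -4 := by linarith
      have : c ^ 2 = 0 := by linarith
      exact hc (pow_eq_zero_iff two_ne_zero |>.mp this)
    have hw : (36 * c / (x + 4)) ^ 2 * (x + 8) = x + 40 := by
      field_simp
      linear_combination key
    have hcw : 36 * c = 36 * c / (x + 4) * (x + 4) := by field_simp
    generalize 36 * c / (x + 4) = w at hw hcw
    have h1 : w ^ 2 ≠ 1 := by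
      intro h
      rw [h] at hw
      linarith
    have h1' : 1 - w ^ 2 ≠ 0 := sub_ne_zero.mpr h1.symm
    refine ⟨w, h1, ?_⟩
    rw [eq_div_iff (by positivity)]
    linear_combination (1 - w ^ 2) / 4 * hcw - w / 4 * hw
  · rintro ⟨v, hv, rfl⟩
    have h1 : 1 - v ^ 2 ≠ 0 := sub_ne_zero.mpr hv.symm
    refine ⟨-32 / (1 - v ^ 2) - 8, ?_⟩
    field_simp
    ring
end

section
/- Let F₂(t,x) = x⁴ + 4x³ + 81t² + 27 and let c be a nonzero rational number. Then the polynomial F₂(c,x) = x⁴ + 4x³ + 81c² + 27 ∈ ℚ[x] has no rational root. -/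
/-- For nonzero `c ∈ ℚ`, the polynomial `F₂(c,x) = x⁴ + 4x³ + 81c² + 27` has no
rational root. -/
theorem stmt_14 (c : ℚ) (hc : c ≠ 0) :
    ∀ x : ℚ, x ^ 4 + 4 * x ^ 3 + 81 * c ^ 2 + 27 ≠ 0 := by
  intro x
  have key : x ^ 4 + 4 * x ^ 3 + 81 * c ^ 2 + 27 =
      (x + 3) ^ 2 * ((x - 1) ^ 2 + 2) + 81 * c ^ 2 := by ring
  rw [key]
  positivity
end

section
/- Let c ∈ ℚ and let G_c be the Galois group over ℚ of a splitting field of the polynomial P_c = 3x⁴ − 4x³ + 1 + 3c² ∈ ℚ[x]. Then G_c is not isomorphic to the alternating group A₄ if and only if there exists v ∈ ℚ with v² ≠ 1 such that c = (v³ − 9v)/(9(1 − v²)). -/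
open Polynomial

/-- A split polynomial of degree four, evaluated through a family of its four roots. -/
theorem exists_roots_quartic {L : Type*} [Field L] {p : L[X]} (hp : p.Splits)
    (hdeg : p.natDegree = 4) :
    ∃ x : Fin 4 → L, ∀ t, p.eval t =
      p.leadingCoeff * ((t - x 0) * (t - x 1) * (t - x 2) * (t - x 3)) := by
  have hcard : p.roots.card = 4 := by rw [← hp.natDegree_eq_card_roots, hdeg]
  obtain ⟨a, b, c, d, ha⟩ := Multiset.card_eq_four.1 hcard
  refine ⟨![a, b, c, d], fun t => ?_⟩
  rw [hp.eval_eq_prod_roots, ha]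
  simp [mul_assoc]

/-- Elementary symmetric functions of the roots of `3x⁴ − 4x³ + d`. -/
theorem symmetric_functions_of_roots {L : Type*} [Field L] [CharZero L] {x : Fin 4 → L} {d : L}
    (h : ∀ t, 3 * t ^ 4 - 4 * t ^ 3 + d =
      3 * ((t - x 0) * (t - x 1) * (t - x 2) * (t - x 3))) :
    x 0 + x 1 + x 2 + x 3 = 4 / 3 ∧
    x 0 * x 1 + x 0 * x 2 + x 0 * x 3 + x 1 * x 2 + x 1 * x 3 + x 2 * x 3 = 0 ∧
    x 0 * x 1 * x 2 + x 0 * x 1 * x 3 + x 0 * x 2 * x 3 + x 1 * x 2 * x 3 = 0 ∧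
    x 0 * x 1 * x 2 * x 3 = d / 3 := by
  have h0 := h 0
  have h1 := h 1
  have h2 := h (-1)
  have h3 := h 2
  have h4 := h (-2)
  refine ⟨?_, ?_, ?_, ?_⟩
  · linear_combination (1 / 36 : L) * (h3 - h4) - (1 / 18 : L) * (h1 - h2)
  · linear_combination (-1 / 6 : L) * (h1 + h2 - 2 * h0)
  · linear_combination (2 / 9 : L) * (h1 - h2) - (1 / 36 : L) * (h3 - h4)
  · linear_combination (-1 / 3 : L) * h0

/-- The cubic resolvent of `3x⁴ − 4x³ + d`, factored through the roots. -/
theorem resolvent_eq_prod {L : Type*} [Field L] [CharZero L] {a b c e d : L}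
    (h1 : a + b + c + e = 4 / 3)
    (h2 : a * b + a * c + a * e + b * c + b * e + c * e = 0)
    (h3 : a * b * c + a * b * e + a * c * e + b * c * e = 0)
    (h4 : a * b * c * e = d / 3) (w : L) :
    w ^ 3 - 3 * d * w - 2 * d =
      (w - 3 / 2 * (a * b + c * e)) * (w - 3 / 2 * (a * c + b * e)) *
        (w - 3 / 2 * (a * e + b * c)) := by
  have key : ∀ y : L, (y - (a * b + c * e)) * (y - (a * c + b * e)) * (y - (a * e + b * c)) =
      y ^ 3 - (a * b + a * c + a * e + b * c + b * e + c * e) * y ^ 2 +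
      ((a + b + c + e) * (a * b * c + a * b * e + a * c * e + b * c * e)
        - 4 * (a * b * c * e)) * y
      - (a + b + c + e) ^ 2 * (a * b * c * e)
      + 4 * (a * b + a * c + a * e + b * c + b * e + c * e) * (a * b * c * e)
      - (a * b * c + a * b * e + a * c * e + b * c * e) ^ 2 := fun y => by ring
  have := key (2 / 3 * w)
  rw [h1, h2, h3, h4] at this
  linear_combination (-27 / 8 : L) * this

/-- The discriminant of `3x⁴ − 4x³ + d`, up to a normalization. -/
theorem sq_prod_sub_roots {L : Type*} [Field L] [CharZero L] {a b c e d : L}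
    (h1 : a + b + c + e = 4 / 3)
    (h2 : a * b + a * c + a * e + b * c + b * e + c * e = 0)
    (h3 : a * b * c + a * b * e + a * c * e + b * c * e = 0)
    (h4 : a * b * c * e = d / 3) :
    ((b - a) * (c - a) * (e - a) * ((c - b) * (e - b)) * (e - c)) ^ 2 =
      256 / 27 * d ^ 2 * (d - 1) := by
  have key : ((b - a) * (c - a) * (e - a) * ((c - b) * (e - b)) * (e - c)) ^ 2 =
      (4 * ((a * b + a * c + a * e + b * c + b * e + c * e) ^ 2
        - 3 * (a + b + c + e) * (a * b * c + a * b * e + a * c * e + b * c * e)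
        + 12 * (a * b * c * e)) ^ 3
      - (2 * (a * b + a * c + a * e + b * c + b * e + c * e) ^ 3
        - 9 * (a + b + c + e) * (a * b + a * c + a * e + b * c + b * e + c * e)
            * (a * b * c + a * b * e + a * c * e + b * c * e)
        + 27 * (a * b * c + a * b * e + a * c * e + b * c * e) ^ 2
        + 27 * (a + b + c + e) ^ 2 * (a * b * c * e)
        - 72 * (a * b + a * c + a * e + b * c + b * e + c * e) * (a * b * c * e)) ^ 2) / 27 := by
    ring
  rw [key, h1, h2, h3, h4]
  ring

/-- The action of automorphisms on a family of distinct elements that generates the field and is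
stable under automorphisms. -/
theorem exists_permHom {K L : Type*} [Field K] [Field L] [Algebra K L] {ι : Type*} {x : ι → L}
    (hx : Function.Injective x) (hgen : Algebra.adjoin K (Set.range x) = ⊤)
    (hstab : ∀ (g : L ≃ₐ[K] L) i, ∃ j, g (x i) = x j) :
    ∃ φ : (L ≃ₐ[K] L) →* Equiv.Perm ι,
      Function.Injective φ ∧ ∀ g i, g (x i) = x (φ g i) := by
  choose f hf using hstab
  let ψ : (L ≃ₐ[K] L) →* Function.End ι :=
    { toFun := f
      map_one' := by
        funext i
        exact hx (by rw [← hf]; rfl)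
      map_mul' := fun g h => by
        funext i
        refine hx ?_
        rw [← hf]
        change g (h (x i)) = x (f g (f h i))
        rw [hf h, hf g] }
  refine ⟨ψ.toHomPerm, fun g h hgh => ?_, fun g i => hf g i⟩
  have hfe : ∀ i, f g i = f h i := fun i => DFunLike.congr_fun hgh i
  have : (g : L →ₐ[K] L) = h := by
    refine AlgHom.ext_of_adjoin_eq_top hgen ?_
    rintro _ ⟨i, rfl⟩
    change g (x i) = h (x i)
    rw [hf, hf, hfe]
  ext y
  exact DFunLike.congr_fun this y

theorem perm_fin_four_of_pow_three_eq_one (σ : Equiv.Perm (Fin 4)) (h : σ ^ 3 = 1)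
    (h1 : σ ≠ 1) :
    (σ 0, σ 1, σ 2, σ 3) ∈ ({(0, 2, 3, 1), (0, 3, 1, 2), (2, 1, 3, 0), (3, 1, 0, 2),
      (1, 3, 2, 0), (3, 0, 2, 1), (1, 2, 0, 3), (2, 0, 1, 3)} :
        Finset (Fin 4 × Fin 4 × Fin 4 × Fin 4)) := by
  revert σ
  decide

theorem exists_fixed_of_pow_three_eq_one (σ : Equiv.Perm (Fin 4)) (h : σ ^ 3 = 1)
    (h1 : σ ≠ 1) : ∃ i, ∀ j k, j ≠ i → k ≠ i → k = j ∨ k = σ j ∨ k = σ (σ j) := by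
  revert σ
  decide

/-- A group of even permutations of four letters that contains a 3-cycle and has no fixed letter
is the whole alternating group. -/
theorem eq_alternatingGroup_of_three_dvd (H : Subgroup (Equiv.Perm (Fin 4)))
    (hH : H ≤ alternatingGroup (Fin 4)) (h3 : 3 ∣ Nat.card H)
    (hfix : ∀ i, ∃ τ ∈ H, τ i ≠ i) : H = alternatingGroup (Fin 4) := by
  have : Fact (Nat.Prime 3) := ⟨Nat.prime_three⟩
  obtain ⟨s, hs⟩ := exists_prime_orderOf_dvd_card' (G := H) 3 h3
  obtain ⟨σ, hσ⟩ := s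
  have hσ3 : σ ^ 3 = 1 := by
    have := pow_orderOf_eq_one (⟨σ, hσ⟩ : H)
    rw [hs] at this
    exact congrArg Subtype.val this
  have hσ1 : σ ≠ 1 := by
    rintro rfl
    have : (⟨1, hσ⟩ : H) = 1 := rfl
    rw [this, orderOf_one] at hs
    omega
  obtain ⟨i, hi⟩ := exists_fixed_of_pow_three_eq_one σ hσ3 hσ1
  obtain ⟨τ, hτ, hτi⟩ := hfix i
  have horb : ∀ k, ∃ g : H, g • i = k := by
    intro k
    by_cases hk : k = i
    · exact ⟨1, by simp [hk]⟩
    · rcases hi (τ i) k hτi hk with h | h | h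
      · exact ⟨⟨τ, hτ⟩, h.symm⟩
      · exact ⟨⟨σ, hσ⟩ * ⟨τ, hτ⟩, h.symm⟩
      · exact ⟨⟨σ, hσ⟩ * (⟨σ, hσ⟩ * ⟨τ, hτ⟩), h.symm⟩
  have : MulAction.IsPretransitive H (Fin 4) := .of_orbit (x₀ := i) horb
  have h4 : 4 ∣ Nat.card H := by
    have := MulAction.index_stabilizer_of_transitive H i
    rw [Nat.card_eq_fintype_card, Fintype.card_fin] at this
    exact (dvd_of_eq this.symm).trans (Subgroup.index_dvd_card _)
  have h12 : 12 ∣ Nat.card H := (by decide : Nat.Coprime 3 4).mul_dvd_of_dvd_of_dvd h3 h4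
  refine Subgroup.eq_of_le_of_card_ge hH ?_
  rw [nat_card_alternatingGroup, Nat.card_eq_fintype_card, Fintype.card_fin]
  exact Nat.le_of_dvd Nat.card_pos h12

/-- A permutation of four distinct elements whose order is three moves each of the three ways
of pairing them. -/
theorem pairing_ne_of_pow_three_eq_one {L : Type*} [Field L] {x : Fin 4 → L}
    (hx : Function.Injective x) (σ : Equiv.Perm (Fin 4)) (h : σ ^ 3 = 1) (h1 : σ ≠ 1) :
    x (σ 0) * x (σ 1) + x (σ 2) * x (σ 3) ≠ x 0 * x 1 + x 2 * x 3 ∧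
    x (σ 0) * x (σ 2) + x (σ 1) * x (σ 3) ≠ x 0 * x 2 + x 1 * x 3 ∧
    x (σ 0) * x (σ 3) + x (σ 1) * x (σ 2) ≠ x 0 * x 3 + x 1 * x 2 := by
  have hne : ∀ i j, i ≠ j → x i - x j ≠ 0 := fun i j hij => sub_ne_zero.2 (hx.ne hij)
  have n12 : (x 0 - x 3) * (x 1 - x 2) ≠ 0 :=
    mul_ne_zero (hne _ _ (by decide)) (hne _ _ (by decide))
  have n13 : (x 0 - x 2) * (x 1 - x 3) ≠ 0 :=
    mul_ne_zero (hne _ _ (by decide)) (hne _ _ (by decide))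
  have n23 : (x 0 - x 1) * (x 2 - x 3) ≠ 0 :=
    mul_ne_zero (hne _ _ (by decide)) (hne _ _ (by decide))
  have := perm_fin_four_of_pow_three_eq_one σ h h1
  simp only [Finset.mem_insert, Finset.mem_singleton, Prod.mk.injEq] at this
  rcases this with ⟨e0, e1, e2, e3⟩ | ⟨e0, e1, e2, e3⟩ | ⟨e0, e1, e2, e3⟩ | ⟨e0, e1, e2, e3⟩ |
    ⟨e0, e1, e2, e3⟩ | ⟨e0, e1, e2, e3⟩ | ⟨e0, e1, e2, e3⟩ | ⟨e0, e1, e2, e3⟩ <;>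
  rw [e0, e1, e2, e3] <;>
  refine ⟨fun h => ?_, fun h => ?_, fun h => ?_⟩ <;>
  first
    | exact n12 (by linear_combination h)
    | exact n12 (by linear_combination -h)
    | exact n13 (by linear_combination h)
    | exact n13 (by linear_combination -h)
    | exact n23 (by linear_combination h)
    | exact n23 (by linear_combination -h)

/-- A group isomorphic to `A₄` has an element of order three. -/
theorem exists_pow_three_of_mulEquiv {G : Type*} [Group G]
    (e : G ≃* alternatingGroup (Fin 4)) : ∃ g : G, g ^ 3 = 1 ∧ g ≠ 1 := by
  have : Fact (Nat.Prime 3) := ⟨Nat.prime_three⟩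
  have h3 : 3 ∣ Nat.card (alternatingGroup (Fin 4)) := by
    rw [nat_card_alternatingGroup, Nat.card_eq_fintype_card, Fintype.card_fin]
    decide
  obtain ⟨s, hs⟩ := exists_prime_orderOf_dvd_card' 3 h3
  refine ⟨e.symm s, ?_, fun h => ?_⟩
  · rw [← map_pow, ← hs, pow_orderOf_eq_one, map_one]
  · have : s = 1 := by simpa using h
    rw [this, orderOf_one] at hs
    omega

/-- The resolvent `w³ − 3dw − 2d` with `d = 1 + 3c²` has a rational root exactly for `c` in the
stated one-parameter family. -/
theorem exists_resolvent_root_iff (c : ℚ) :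
    (∃ w : ℚ, w ^ 3 - 3 * (1 + 3 * c ^ 2) * w - 2 * (1 + 3 * c ^ 2) = 0) ↔
      ∃ v : ℚ, v ^ 2 ≠ 1 ∧ c = (v ^ 3 - 9 * v) / (9 * (1 - v ^ 2)) := by
  constructor
  · rintro ⟨w, hw⟩
    by_cases hc : c = 0
    · exact ⟨0, by norm_num, by simp [hc]⟩
    have hw1 : w + 1 ≠ 0 := by
      intro h
      have : w = -1 := by linear_combination h
      subst this
      apply hc
      have : c ^ 2 = 0 := by linear_combination hw / 3
      exact pow_eq_zero_iff (two_ne_zero) |>.1 this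
    have hfac : (w + 1) ^ 2 * (w - 2) = 3 * c ^ 2 * (3 * w + 2) := by linear_combination hw
    obtain ⟨u, hu⟩ : ∃ u, c = u * (w + 1) := ⟨c / (w + 1), by field_simp⟩
    have hq : w - 2 = 3 * u ^ 2 * (3 * w + 2) := by
      have : (w + 1) ^ 2 * (w - 2 - 3 * u ^ 2 * (3 * w + 2)) = 0 := by
        rw [hu] at hfac
        linear_combination hfac
      rcases mul_eq_zero.1 this with h | h
      · exact absurd h (pow_ne_zero 2 hw1)
      · linear_combination h
    have hu1 : 1 - 9 * u ^ 2 ≠ 0 := by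
      intro h
      have : (8 / 3 : ℚ) = 0 := by linear_combination -hq + (w + 2 / 3) * h
      norm_num at this
    refine ⟨-3 * u, fun h => hu1 (by linear_combination -h), ?_⟩
    rw [eq_div_iff (mul_ne_zero (by norm_num) (fun h => hu1 (by linear_combination h))), hu]
    linear_combination 9 * u * hq
  · rintro ⟨v, hv, rfl⟩
    have hv1 : 1 - v ^ 2 ≠ 0 := fun h => hv (by linear_combination -h)
    refine ⟨(2 + 2 / 3 * v ^ 2) / (1 - v ^ 2), ?_⟩
    field_simp
    ring

/-- Let `c ∈ ℚ` and let `G_c` be the Galois group over `ℚ` of a splitting field of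
`P_c = 3x⁴ − 4x³ + 1 + 3c² ∈ ℚ[x]`.  Then `G_c` is not isomorphic to the alternating
group `A₄` if and only if `c = (v³ − 9v)/(9(1 − v²))` for some `v ∈ ℚ` with `v² ≠ 1`. -/
theorem stmt_15 (c : ℚ) (Pc : ℚ[X])
    (hPc : Pc = C 3 * X ^ 4 - C 4 * X ^ 3 + 1 + C (3 * c ^ 2))
    (L : Type*) [Field L] [Algebra ℚ L] [IsSplittingField ℚ L Pc] :
    ¬ Nonempty ((L ≃ₐ[ℚ] L) ≃* alternatingGroup (Fin 4)) ↔
      ∃ v : ℚ, v ^ 2 ≠ 1 ∧ c = (v ^ 3 - 9 * v) / (9 * (1 - v ^ 2)) := by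
  rw [← exists_resolvent_root_iff]
  have : CharZero L := algebraRat.charZero L
  have : FiniteDimensional ℚ L := IsSplittingField.finiteDimensional L Pc
  have : Normal ℚ L := Normal.of_isSplittingField Pc
  have : IsGalois ℚ L := {}
  have hdeg : Pc.natDegree = 4 := by rw [hPc]; compute_degree!
  have hlead : Pc.leadingCoeff = 3 := by
    rw [leadingCoeff, hdeg, hPc]
    simp only [coeff_add, coeff_sub, coeff_C_mul, coeff_X_pow, coeff_one, coeff_C]
    norm_num
  have hPc0 : Pc ≠ 0 := by
    rintro rfl
    simp at hdeg
  set cL : L := algebraMap ℚ L c with hcL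
  obtain ⟨x, hx⟩ := exists_roots_quartic (IsSplittingField.splits L Pc)
    ((natDegree_map _).trans hdeg)
  have heval : ∀ t : L, (Pc.map (algebraMap ℚ L)).eval t =
      3 * t ^ 4 - 4 * t ^ 3 + (1 + 3 * cL ^ 2) := fun t => by
    rw [hPc]
    simp [hcL]
    ring
  have hx' : ∀ t, 3 * t ^ 4 - 4 * t ^ 3 + (1 + 3 * cL ^ 2) =
      3 * ((t - x 0) * (t - x 1) * (t - x 2) * (t - x 3)) := fun t => by
    rw [← heval, hx, leadingCoeff_map, hlead]
    simp
  have hroot : ∀ t, 3 * t ^ 4 - 4 * t ^ 3 + (1 + 3 * cL ^ 2) = 0 ↔ ∃ i, t = x i := fun t => by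
    rw [hx']
    simp [Fin.exists_fin_succ, sub_eq_zero, or_assoc]
  have hstab : ∀ (g : L ≃ₐ[ℚ] L) i, ∃ j, g (x i) = x j := fun g i => by
    rw [← hroot]
    have := congrArg g ((hroot (x i)).2 ⟨i, rfl⟩)
    simpa only [hcL, map_add, map_sub, map_mul, map_pow, map_ofNat, map_one, map_zero,
      AlgEquiv.commutes] using this
  have hgen : Algebra.adjoin ℚ (Set.range x) = ⊤ := by
    rw [← IsSplittingField.adjoin_rootSet L Pc]
    congr 1
    ext t
    rw [mem_rootSet_of_ne hPc0, aeval_def, ← eval_map, heval, hroot]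
    simp [eq_comm]
  obtain ⟨h1, h2, h3, h4⟩ := symmetric_functions_of_roots hx'
  have hdisc := sq_prod_sub_roots h1 h2 h3 h4
  have hres := resolvent_eq_prod h1 h2 h3 h4
  by_cases hc : c = 0
  · refine iff_of_true ?_ ⟨2, by rw [hc]; norm_num⟩
    rintro ⟨e⟩
    obtain ⟨g, hg3, hg1⟩ := exists_pow_three_of_mulEquiv e
    apply hg1
    have hg3' : ∀ y, g (g (g y)) = y := fun y => DFunLike.congr_fun hg3 y
    have hfix : ∀ i, g (x i) = x i := by
      intro i
      have hfac : ∀ t, (∃ i, t = x i) → t = 1 ∨ 3 * t ^ 2 + 2 * t + 1 = 0 := fun t ht => by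
        have := (hroot t).2 ht
        rw [hcL, hc, map_zero] at this
        have hm : (t - 1) ^ 2 * (3 * t ^ 2 + 2 * t + 1) = 0 := by linear_combination this
        rcases mul_eq_zero.1 hm with h | h
        · exact .inl (sub_eq_zero.1 (pow_eq_zero_iff two_ne_zero |>.1 h))
        · exact .inr h
      rcases hfac _ ⟨i, rfl⟩ with h | h
      · rw [h, map_one]
      · have hg := congrArg g h
        simp only [map_add, map_mul, map_pow, map_ofNat, map_one, map_zero] at hg
        have hm : (g (x i) - x i) * (3 * (g (x i) + x i) + 2) = 0 := by
          linear_combination hg - h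
        rcases mul_eq_zero.1 hm with h' | h'
        · exact sub_eq_zero.1 h'
        · have hg' := congrArg g h'
          simp only [map_add, map_mul, map_ofNat, map_zero] at hg'
          have h2' : g (g (x i)) = x i := by linear_combination (hg' - h') / 3
          rw [← h2', hg3', h2']
    have : (g : L →ₐ[ℚ] L) = AlgHom.id ℚ L := by
      refine AlgHom.ext_of_adjoin_eq_top hgen ?_
      rintro _ ⟨i, rfl⟩
      exact hfix i
    ext y
    exact DFunLike.congr_fun this y
  have hcL0 : cL ≠ 0 := by simpa [hcL] using hc
  have hd0 : (1 + 3 * cL ^ 2) ≠ 0 := by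
    have : (1 + 3 * c ^ 2 : ℚ) ≠ 0 := by positivity
    have h := (map_ne_zero (algebraMap ℚ L)).2 this
    simpa [hcL] using h
  have hdet : (Matrix.vandermonde x).det =
      (x 1 - x 0) * (x 2 - x 0) * (x 3 - x 0) * ((x 2 - x 1) * (x 3 - x 1)) * (x 3 - x 2) := by
    rw [Matrix.det_vandermonde]
    simp [Fin.prod_univ_succ, Fin.prod_Ioi_succ]
    ring
  rw [← hdet] at hdisc
  have hdet0 : (Matrix.vandermonde x).det ≠ 0 := by
    intro h
    rw [h] at hdisc
    have : cL ^ 2 * (1 + 3 * cL ^ 2) ^ 2 = 0 := by linear_combination (-9 / 256 : L) * hdisc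
    simp [hcL0, hd0] at this
  have hinj : Function.Injective x := Matrix.det_vandermonde_ne_zero_iff.1 hdet0
  obtain ⟨φ, hφ, hφx⟩ := exists_permHom hinj hgen hstab
  rw [not_iff_comm]
  constructor
  · intro hno
    have heven : ∀ g, φ g ∈ alternatingGroup (Fin 4) := fun g => by
      have hmap : g (Matrix.vandermonde x).det = (Equiv.Perm.sign (φ g) : ℤ) *
          (Matrix.vandermonde x).det := by
        have hsub : (Matrix.vandermonde x).map g = (Matrix.vandermonde x).submatrix (φ g) id := by
          ext i j
          simp [Matrix.vandermonde_apply, hφx]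
        rw [← Matrix.det_permute, ← hsub]
        exact RingHom.map_det (g : L →+* L) _
      have hrat : ∃ r : ℚ, (Matrix.vandermonde x).det = algebraMap ℚ L r := by
        have : ((Matrix.vandermonde x).det - 16 / 3 * cL * (1 + 3 * cL ^ 2)) *
            ((Matrix.vandermonde x).det + 16 / 3 * cL * (1 + 3 * cL ^ 2)) = 0 := by
          linear_combination hdisc
        rcases mul_eq_zero.1 this with h | h
        · exact ⟨16 / 3 * c * (1 + 3 * c ^ 2), by
            simp only [map_add, map_mul, map_div₀, map_pow, map_ofNat, map_one, ← hcL]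
            linear_combination h⟩
        · exact ⟨-(16 / 3 * c * (1 + 3 * c ^ 2)), by
            simp only [map_neg, map_add, map_mul, map_div₀, map_pow, map_ofNat, map_one, ← hcL]
            linear_combination h⟩
      obtain ⟨r, hr⟩ := hrat
      rw [Equiv.Perm.mem_alternatingGroup]
      rcases Int.units_eq_one_or (Equiv.Perm.sign (φ g)) with h | h
      · exact h
      · exfalso
        rw [h, hr, AlgEquiv.commutes, ← hr] at hmap
        apply hdet0
        simp at hmap
        linear_combination hmap / 2
    have h3dvd : 3 ∣ Nat.card φ.range := by
      rw [← Nat.card_congr (MonoidHom.ofInjective hφ).toEquiv, IsGalois.card_aut_eq_finrank]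
      let q : ℚ[X] := X ^ 3 - C (3 * (1 + 3 * c ^ 2)) * X - C (2 * (1 + 3 * c ^ 2))
      have hq3 : q.natDegree = 3 := by simp only [q]; compute_degree!
      have hqm : q.Monic := by simp only [q]; monicity!
      have hqi : Irreducible q := by
        refine irreducible_of_degree_le_three_of_not_isRoot (by simp [hq3]) fun w hw => hno ⟨w, ?_⟩
        simpa [q, IsRoot] using hw
      have hqr : aeval (3 / 2 * (x 0 * x 1 + x 2 * x 3)) q = 0 := by
        have := hres (3 / 2 * (x 0 * x 1 + x 2 * x 3))
        rw [sub_self, zero_mul, zero_mul] at this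
        simpa [q, hcL] using this
      have hmin := minpoly.eq_of_irreducible_of_monic hqi hqr hqm
      rw [← hq3, hmin]
      exact minpoly.degree_dvd (Algebra.IsIntegral.isIntegral _)
    have hA := eq_alternatingGroup_of_three_dvd φ.range (by rintro _ ⟨g, rfl⟩; exact heven g)
      h3dvd (fun i => by
        by_contra! hi
        have hfx : ∀ g : L ≃ₐ[ℚ] L, g (x i) = x i := fun g => by
          rw [hφx, hi _ ⟨g, rfl⟩]
        obtain ⟨r, hr⟩ := (IsGalois.mem_range_algebraMap_iff_fixed (x i)).2 hfx
        have hz := (hroot (x i)).2 ⟨i, rfl⟩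
        rw [← hr, hcL] at hz
        have hz' : 3 * r ^ 4 - 4 * r ^ 3 + (1 + 3 * c ^ 2) = 0 := by
          apply (algebraMap ℚ L).injective
          simpa using hz
        have : 0 < c ^ 2 := by positivity
        nlinarith [mul_nonneg (sq_nonneg (r - 1)) (by nlinarith [sq_nonneg (r + 1)] :
          0 ≤ 3 * r ^ 2 + 2 * r + 1)])
    exact ⟨(MonoidHom.ofInjective hφ).trans (MulEquiv.subgroupCongr hA)⟩
  · rintro ⟨e⟩ ⟨w, hw⟩
    obtain ⟨g, hg3, hg1⟩ := exists_pow_three_of_mulEquiv e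
    obtain ⟨n1, n2, n3⟩ := pairing_ne_of_pow_three_eq_one hinj (φ g)
      (by rw [← map_pow, hg3, map_one]) (fun h => hg1 (hφ (by rw [h, map_one])))
    have hw' := hres (algebraMap ℚ L w)
    have hz : algebraMap ℚ L w ^ 3 - 3 * (1 + 3 * cL ^ 2) * algebraMap ℚ L w
        - 2 * (1 + 3 * cL ^ 2) = 0 := by
      simpa [hcL] using congrArg (algebraMap ℚ L) hw
    rw [hz, eq_comm] at hw'
    have hrat : ∀ y : L, algebraMap ℚ L w - 3 / 2 * y = 0 → g y = y := fun y hy => by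
      have : y = algebraMap ℚ L (2 / 3 * w) := by
        rw [map_mul, map_div₀, map_ofNat, map_ofNat]
        linear_combination (-2 / 3 : L) * hy
      rw [this, AlgEquiv.commutes]
    rcases mul_eq_zero.1 hw' with h | h
    · rcases mul_eq_zero.1 h with h | h
      · exact n1 (by simpa [hφx] using hrat _ h)
      · exact n2 (by simpa [hφx] using hrat _ h)
    · exact n3 (by simpa [hφx] using hrat _ h)
end

section
/- Let F₃(t,x) = x⁶ + 12x⁵ + 48x⁴ + 64x³ − (324t² + 108)x² − (1296t² + 432)x − 1296t² − 432. Let v ∈ ℚ with v² ≠ 1 and let c = (v³ − 9v)/(9(1 − v²)). Then F₃(c,x) ∈ ℚ[x] has a rational root if and only if v has one of the forms 1 + 2w², −1 − 2w², or 2w/(1 + w²) for some w ∈ ℚ. -/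
/-- In terms of `y = (x + 2)²`, the sextic `F₃(c,x)` is a cubic that splits into linear factors. -/
theorem sextic_eq_zero_iff {v c x : ℚ} (hv : v ^ 2 ≠ 1)
    (hc : c = (v ^ 3 - 9 * v) / (9 * (1 - v ^ 2))) :
    x ^ 6 + 12 * x ^ 5 + 48 * x ^ 4 + 64 * x ^ 3 - (324 * c ^ 2 + 108) * x ^ 2 -
        (1296 * c ^ 2 + 432) * x - 1296 * c ^ 2 - 432 = 0 ↔
      (x + 2) ^ 2 * (1 - v ^ 2) = 16 ∨ (x + 2) ^ 2 * (1 + v) = -2 * (v - 1) ^ 2 ∨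
        (x + 2) ^ 2 * (1 - v) = -2 * (v + 1) ^ 2 := by
  have hd : 1 - v ^ 2 ≠ 0 := sub_ne_zero.mpr hv.symm
  have hfactor : (1 - v ^ 2) ^ 2 * (x ^ 6 + 12 * x ^ 5 + 48 * x ^ 4 + 64 * x ^ 3 -
        (324 * c ^ 2 + 108) * x ^ 2 - (1296 * c ^ 2 + 432) * x - 1296 * c ^ 2 - 432) =
      ((x + 2) ^ 2 * (1 - v ^ 2) - 16) * (((x + 2) ^ 2 * (1 + v) - -2 * (v - 1) ^ 2) *
        ((x + 2) ^ 2 * (1 - v) - -2 * (v + 1) ^ 2)) := by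
    subst hc
    field_simp
    ring
  rw [← sub_eq_zero (b := (16 : ℚ)), ← sub_eq_zero (b := -2 * (v - 1) ^ 2),
    ← sub_eq_zero (b := -2 * (v + 1) ^ 2), ← mul_eq_zero, ← mul_eq_zero, ← hfactor,
    mul_eq_zero_iff_left (pow_ne_zero 2 hd)]

/-- The rational parametrization of the unit circle, away from its points with `r ≤ 0`. -/
theorem eq_two_mul_div_one_add_sq {v r : ℚ} (hr : 0 < r) (h : v ^ 2 + r ^ 2 = 1) :
    v = 2 * (v / (1 + r)) / (1 + (v / (1 + r)) ^ 2) := by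
  have hr' : 1 + r ≠ 0 := by positivity
  have hden : 1 + (v / (1 + r)) ^ 2 = 2 / (1 + r) := by
    field_simp
    linear_combination h
  rw [hden]
  field_simp

/-- Let `v ∈ ℚ` with `v² ≠ 1` and `c = (v³ − 9v)/(9(1 − v²))`.  Then
`F₃(c,x) = x⁶ + 12x⁵ + 48x⁴ + 64x³ − (324c² + 108)x² − (1296c² + 432)x − 1296c² − 432`
has a rational root if and only if `v` has one of the forms `1 + 2w²`, `−1 − 2w²`, or
`2w/(1 + w²)` for some `w ∈ ℚ`. -/
theorem stmt_16 (v : ℚ) (hv : v ^ 2 ≠ 1) (c : ℚ)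
    (hc : c = (v ^ 3 - 9 * v) / (9 * (1 - v ^ 2))) :
    (∃ x : ℚ, x ^ 6 + 12 * x ^ 5 + 48 * x ^ 4 + 64 * x ^ 3 - (324 * c ^ 2 + 108) * x ^ 2 -
        (1296 * c ^ 2 + 432) * x - 1296 * c ^ 2 - 432 = 0) ↔
      ∃ w : ℚ, v = 1 + 2 * w ^ 2 ∨ v = -1 - 2 * w ^ 2 ∨ v = 2 * w / (1 + w ^ 2) := by
  have hv₁ : v - 1 ≠ 0 := fun h => hv (by linear_combination (v + 1) * h)
  have hv₂ : v + 1 ≠ 0 := fun h => hv (by linear_combination (v - 1) * h)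
  simp only [sextic_eq_zero_iff hv hc]
  constructor
  · rintro ⟨x, h⟩
    have hx : x + 2 ≠ 0 := by
      intro hx
      simp [hx, hv₁, hv₂] at h
    rcases h with h | h | h
    · refine ⟨_, Or.inr (Or.inr (eq_two_mul_div_one_add_sq
        (r := |4 / (x + 2)|) (by positivity) ?_))⟩
      rw [sq_abs]
      field_simp
      linear_combination -h
    · refine ⟨(v - 1) / (x + 2), Or.inr (Or.inl ?_)⟩
      field_simp
      linear_combination h
    · refine ⟨(v + 1) / (x + 2), Or.inl ?_⟩
      field_simp
      linear_combination -h
  · rintro ⟨w, h | h | h⟩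
    · have hw : w ≠ 0 := by
        rintro rfl
        exact hv₁ (by rw [h]; ring)
      refine ⟨(v + 1) / w - 2, Or.inr (Or.inr ?_)⟩
      rw [sub_add_cancel]
      field_simp
      linear_combination -h
    · have hw : w ≠ 0 := by
        rintro rfl
        exact hv₂ (by rw [h]; ring)
      refine ⟨(v - 1) / w - 2, Or.inr (Or.inl ?_)⟩
      rw [sub_add_cancel]
      field_simp
      linear_combination h
    · have hden : 1 + w ^ 2 ≠ 0 := by positivity
      have hw : 1 - w ^ 2 ≠ 0 := by
        intro hw
        refine hv ?_
        rw [h]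
        field_simp
        linear_combination (w ^ 2 - 1) * hw
      refine ⟨4 * (1 + w ^ 2) / (1 - w ^ 2) - 2, Or.inl ?_⟩
      rw [sub_add_cancel, h]
      field_simp
      ring
end

section
/- Let v ∈ ℚ with v² ≠ 1, let c = (v³ − 9v)/(9(1 − v²)), and let G_c be the Galois group over ℚ of a splitting field of P_c = 3x⁴ − 4x³ + 1 + 3c² ∈ ℚ[x]. If v has one of the forms 1 + 2w², −1 − 2w², or 2w/(1 + w²) for some w ∈ ℚ, then G_c is isomorphic to the cyclic group ℤ/2ℤ; otherwise G_c is isomorphic to the Klein four-group (ℤ/2ℤ) × (ℤ/2ℤ). -/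
open Polynomial

/-- The root of `3x⁴ − 4x³ + 1 + 3c²`, with `c = (v³ − 9v)/(9(1 − v²))`, attached to square roots
`β` of `-2(v + 1)` and `γ` of `2(v - 1)`. -/
def ferrariRoot {F : Type*} [Field F] (v β γ : F) : F :=
  (1 + 4 / (β * γ) + (1 - v) / β + (1 + v) / γ) / 3

theorem add_one_ne_zero_and_sub_one_ne_zero {F : Type*} [Field F] {v : F}
    (hv : v ^ 2 ≠ 1) : v + 1 ≠ 0 ∧ v - 1 ≠ 0 := by
  constructor <;> intro h <;> apply hv
  · linear_combination (v - 1) * h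
  · linear_combination (v + 1) * h

theorem quartic_eq_prod_ferrariRoot {F : Type*} [Field F] [CharZero F] {v β γ : F}
    (hv : v ^ 2 ≠ 1) (hβ : β ^ 2 = -2 * (v + 1)) (hγ : γ ^ 2 = 2 * (v - 1)) (x : F) :
    3 * x ^ 4 - 4 * x ^ 3 + 1 + 3 * ((v ^ 3 - 9 * v) / (9 * (1 - v ^ 2))) ^ 2 =
      3 * ((x - ferrariRoot v β γ) * (x - ferrariRoot v β (-γ)) *
        (x - ferrariRoot v (-β) γ) * (x - ferrariRoot v (-β) (-γ))) := by
  obtain ⟨h₁, h₂⟩ := add_one_ne_zero_and_sub_one_ne_zero hv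
  have h₃ : 1 - v ^ 2 ≠ 0 := sub_ne_zero.2 hv.symm
  have hβ₀ : β ≠ 0 := by rintro rfl; simp_all
  have hγ₀ : γ ≠ 0 := by rintro rfl; simp_all
  set a := 4 / (β * γ) with ha
  set b := (1 - v) / β with hb
  set c := (1 + v) / γ with hc
  have ha2 : a ^ 2 = 4 / (1 - v ^ 2) := by
    rw [ha, div_pow, mul_pow, hβ, hγ, div_eq_div_iff (by simp_all) h₃]
    ring
  have hb2 : b ^ 2 = -(1 - v) ^ 2 / (2 * (v + 1)) := by
    rw [hb, div_pow, hβ]; field_simp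
  have hc2 : c ^ 2 = (1 + v) ^ 2 / (2 * (v - 1)) := by
    rw [hc, div_pow, hγ]
  have habc : a * b * c = 1 := by
    rw [ha, hb, hc]; field_simp; rw [hβ, hγ]; ring
  have hs1 : a ^ 2 + b ^ 2 + c ^ 2 = 3 := by
    rw [ha2, hb2, hc2]; field_simp; ring
  have hs2 : a ^ 2 * b ^ 2 + a ^ 2 * c ^ 2 + b ^ 2 * c ^ 2 =
      -(15 + 81 * ((v ^ 3 - 9 * v) / (9 * (1 - v ^ 2))) ^ 2) / 4 := by
    rw [ha2, hb2, hc2]; field_simp; ring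
  have e1 : ferrariRoot v β γ = (1 + a + b + c) / 3 := rfl
  have e2 : ferrariRoot v β (-γ) = (1 - a + b - c) / 3 := by
    simp only [ferrariRoot, ha, hb, hc]; field_simp; ring
  have e3 : ferrariRoot v (-β) γ = (1 - a - b + c) / 3 := by
    simp only [ferrariRoot, ha, hb, hc]; field_simp; ring
  have e4 : ferrariRoot v (-β) (-γ) = (1 + a - b - c) / 3 := by
    simp only [ferrariRoot, ha, hb, hc]; field_simp; ring
  rw [e1, e2, e3, e4]
  clear_value a b c
  linear_combination (4 / 27 : F) * hs2 +
    (2 * (3 * x - 1) ^ 2 - (a ^ 2 + b ^ 2 + c ^ 2 + 3)) / 27 * hs1 + 8 * (3 * x - 1) / 27 * habc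

theorem ferrariRoot_add_neg_right {F : Type*} [Field F] [CharZero F] {v β γ : F} (hβ : β ≠ 0)
    (hγ : γ ≠ 0) :
    3 / 2 * (ferrariRoot v β γ + ferrariRoot v β (-γ)) - 1 = (1 - v) / β := by
  simp only [ferrariRoot]
  field_simp
  ring

theorem ferrariRoot_add_neg_left {F : Type*} [Field F] [CharZero F] {v β γ : F} (hβ : β ≠ 0)
    (hγ : γ ≠ 0) :
    3 / 2 * (ferrariRoot v β γ + ferrariRoot v (-β) γ) - 1 = (1 + v) / γ := by
  simp only [ferrariRoot]
  field_simp
  ring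

section Biquadratic

variable {K L : Type*} [Field K] [Field L] [Algebra K L]

theorem algEquiv_eq_or_eq_neg_of_sq {δ : L} {d : K} (hδ : δ ^ 2 = algebraMap K L d)
    (σ : L ≃ₐ[K] L) : σ δ = δ ∨ σ δ = -δ := by
  rw [← sq_eq_sq_iff_eq_or_eq_neg, ← map_pow, hδ, AlgEquiv.commutes]

theorem algEquiv_ext_of_forall_eq_one {β γ : L}
    (hgen : ∀ σ : L ≃ₐ[K] L, σ β = β → σ γ = γ → σ = 1) {σ τ : L ≃ₐ[K] L}
    (h₁ : σ β = τ β) (h₂ : σ γ = τ γ) : σ = τ := by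
  rw [← inv_mul_eq_one, eq_comm, hgen (σ⁻¹ * τ)]
  · simp [← h₁, AlgEquiv.aut_inv]
  · simp [← h₂, AlgEquiv.aut_inv]

variable [FiniteDimensional K L] [IsGalois K L]

/-- In a Galois extension, `d` is a square in the base field iff its square root is fixed. -/
theorem isSquare_iff_forall_algEquiv_apply_eq {δ : L} {d : K} (hδ : δ ^ 2 = algebraMap K L d) :
    IsSquare d ↔ ∀ σ : L ≃ₐ[K] L, σ δ = δ := by
  rw [← IsGalois.mem_bot_iff_fixed (F := K), IntermediateField.mem_bot]
  constructor
  · rintro ⟨e, rfl⟩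
    rw [map_mul, ← sq, sq_eq_sq_iff_eq_or_eq_neg] at hδ
    rcases hδ with h | h
    · exact ⟨e, h.symm⟩
    · exact ⟨-e, by rw [h, map_neg]⟩
  · rintro ⟨e, rfl⟩
    refine ⟨e, (algebraMap K L).injective ?_⟩
    rw [← hδ, sq, map_mul]

theorem card_algEquiv_eq_two_of_isSquare
    {β γ : L} {b g : K} (hβ : β ^ 2 = algebraMap K L b) (hγ : γ ^ 2 = algebraMap K L g)
    (hgen : ∀ σ : L ≃ₐ[K] L, σ β = β → σ γ = γ → σ = 1)
    (h : IsSquare b ∨ IsSquare g ∨ IsSquare (b * g))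
    (hn : ¬ (IsSquare b ∧ IsSquare g)) : Nat.card (L ≃ₐ[K] L) = 2 := by
  have hβγ : (β * γ) ^ 2 = algebraMap K L (b * g) := by rw [mul_pow, hβ, hγ, map_mul]
  rw [isSquare_iff_forall_algEquiv_apply_eq hβ, isSquare_iff_forall_algEquiv_apply_eq hγ] at hn
  rw [isSquare_iff_forall_algEquiv_apply_eq hβ, isSquare_iff_forall_algEquiv_apply_eq hγ,
    isSquare_iff_forall_algEquiv_apply_eq hβγ] at h
  have hβ' := algEquiv_eq_or_eq_neg_of_sq hβ
  have hγ' := algEquiv_eq_or_eq_neg_of_sq hγ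
  obtain ⟨σ, hσ⟩ : ∃ σ : L ≃ₐ[K] L, σ ≠ 1 := by
    by_contra! H
    exact hn ⟨fun σ ↦ by simp [H σ], fun σ ↦ by simp [H σ]⟩
  have key (τ : L ≃ₐ[K] L) (hτ : τ ≠ 1) : (τ β = σ β) ∧ τ γ = σ γ := by
    have h₁ := mt (fun H : σ β = β ∧ σ γ = γ ↦ hgen σ H.1 H.2) hσ
    have h₂ := mt (fun H : τ β = β ∧ τ γ = γ ↦ hgen τ H.1 H.2) hτ
    rcases h with h | h | h
    · grind
    · grind
    · have h₃ := h σ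
      have h₄ := h τ
      rw [map_mul] at h₃ h₄
      rcases eq_or_ne β 0 with rfl | hβ₀
      · simp at h₁ h₂ ⊢
        grind
      rcases eq_or_ne γ 0 with rfl | hγ₀
      · simp at h₁ h₂ ⊢
        grind
      grind
  exact (Nat.card_eq_two_iff' 1).2 ⟨σ, hσ, fun τ hτ ↦
    algEquiv_ext_of_forall_eq_one hgen (key τ hτ).1 (key τ hτ).2⟩

theorem isKleinFour_algEquiv_of_not_isSquare
    {β γ : L} {b g : K} (hβ : β ^ 2 = algebraMap K L b) (hγ : γ ^ 2 = algebraMap K L g)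
    (hgen : ∀ σ : L ≃ₐ[K] L, σ β = β → σ γ = γ → σ = 1)
    (hb : ¬ IsSquare b) (hg : ¬ IsSquare g)
    (hbg : ¬ IsSquare (b * g)) : IsKleinFour (L ≃ₐ[K] L) := by
  have hβγ : (β * γ) ^ 2 = algebraMap K L (b * g) := by rw [mul_pow, hβ, hγ, map_mul]
  rw [isSquare_iff_forall_algEquiv_apply_eq hβ, not_forall] at hb
  rw [isSquare_iff_forall_algEquiv_apply_eq hγ, not_forall] at hg
  rw [isSquare_iff_forall_algEquiv_apply_eq hβγ, not_forall] at hbg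
  have hβ' := algEquiv_eq_or_eq_neg_of_sq hβ
  have hγ' := algEquiv_eq_or_eq_neg_of_sq hγ
  have hβ₀ : -β ≠ β := by
    obtain ⟨σ, hσ⟩ := hb
    grind
  have hγ₀ : -γ ≠ γ := by
    obtain ⟨σ, hσ⟩ := hg
    grind
  obtain ⟨⟨σ, hσβ, hσγ⟩, τ, hτβ, hτγ⟩ : (∃ σ : L ≃ₐ[K] L, σ β = -β ∧ σ γ = γ) ∧
      ∃ τ : L ≃ₐ[K] L, τ β = β ∧ τ γ = -γ := by
    obtain ⟨σ₁, h₁⟩ := hb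
    obtain ⟨σ₂, h₂⟩ := hg
    obtain ⟨σ₃, h₃⟩ := hbg
    replace h₁ := (hβ' σ₁).resolve_left h₁
    replace h₂ := (hγ' σ₂).resolve_left h₂
    rw [map_mul] at h₃
    rcases hγ' σ₁ with h₁' | h₁'
    · refine ⟨⟨σ₁, h₁, h₁'⟩, ?_⟩
      rcases hβ' σ₂ with h₂' | h₂'
      · exact ⟨σ₂, h₂', h₂⟩
      · exact ⟨σ₁ * σ₂, by simp [h₁, h₂'], by simp [h₂, h₁']⟩
    · rcases hβ' σ₃ with h₄ | h₄ <;> rcases hγ' σ₃ with h₅ | h₅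
      · simp [h₄, h₅] at h₃
      · exact ⟨⟨σ₁ * σ₃, by simp [h₄, h₁], by simp [h₁', h₅]⟩, σ₃, h₄, h₅⟩
      · exact ⟨⟨σ₃, h₄, h₅⟩, σ₁ * σ₃, by simp [h₄, h₁], by simp [h₁', h₅]⟩
      · simp [h₄, h₅] at h₃
  have hbij : Function.Bijective fun σ : L ≃ₐ[K] L ↦ (σ β = β, σ γ = γ) := by
    constructor
    · intro ρ ρ' h
      simp only [Prod.mk.injEq, eq_iff_iff] at h
      exact algEquiv_ext_of_forall_eq_one hgen (by grind) (by grind)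
    · rintro ⟨p, q⟩
      by_cases hp : p <;> by_cases hq : q
      · exact ⟨1, by simp [hp, hq]⟩
      · exact ⟨τ, by simp [hp, hq, hτβ, hτγ, hγ₀]⟩
      · exact ⟨σ, by simp [hp, hq, hσβ, hσγ, hβ₀]⟩
      · exact ⟨σ * τ, by simp [hp, hq, hσβ, hσγ, hτβ, hτγ, hβ₀, hγ₀]⟩
  have hcard : Nat.card (L ≃ₐ[K] L) = 4 := by
    rw [Nat.card_eq_of_bijective _ hbij]
    simp
  refine ⟨hcard, (Nat.dvd_prime Nat.prime_two).1 ?_ |>.resolve_left fun h ↦ ?_⟩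
  · refine Monoid.exponent_dvd_of_forall_pow_eq_one fun ρ ↦ ?_
    rw [sq]
    refine hgen _ ?_ ?_
    · rcases hβ' ρ with h | h <;> simp [h]
    · rcases hγ' ρ with h | h <;> simp [h]
  · have := Monoid.exp_eq_one_iff.1 h
    rw [Nat.card_of_subsingleton (1 : L ≃ₐ[K] L)] at hcard
    omega

end Biquadratic

theorem eval_map_quartic {F : Type*} [Field F] {v : ℚ} {P : ℚ[X]}
    (hP : P = C 3 * X ^ 4 - C 4 * X ^ 3 + 1 +
      C (3 * ((v ^ 3 - 9 * v) / (9 * (1 - v ^ 2))) ^ 2)) [CharZero F] (i : ℚ →+* F) (x : F) :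
    (P.map i).eval x = 3 * x ^ 4 - 4 * x ^ 3 + 1 +
      3 * (((v : F) ^ 3 - 9 * (v : F)) / (9 * (1 - (v : F) ^ 2))) ^ 2 := by
  simp [hP]

theorem exists_sqrts_of_isSplittingField {v : ℚ} (hv : v ^ 2 ≠ 1) {P : ℚ[X]}
    (hP : P = C 3 * X ^ 4 - C 4 * X ^ 3 + 1 +
      C (3 * ((v ^ 3 - 9 * v) / (9 * (1 - v ^ 2))) ^ 2))
    (L : Type*) [Field L] [Algebra ℚ L] [IsSplittingField ℚ L P] :
    ∃ β γ : L, β ^ 2 = algebraMap ℚ L (-2 * (v + 1)) ∧ γ ^ 2 = algebraMap ℚ L (2 * (v - 1)) ∧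
      ∀ σ : L ≃ₐ[ℚ] L, σ β = β → σ γ = γ → σ = 1 := by
  have : CharZero L := algebraRat.charZero L
  have hP₀ : P ≠ 0 := by
    rintro rfl
    have h := eval_map_quartic hP (RingHom.id ℚ) 2
    simp only [Polynomial.map_zero, eval_zero, Rat.cast_id] at h
    linarith [sq_nonneg ((v ^ 3 - 9 * v) / (9 * (1 - v ^ 2)))]
  obtain ⟨h₁, h₂⟩ := add_one_ne_zero_and_sub_one_ne_zero hv
  have hsplit : (P.map (algebraMap ℚ L)).Splits := IsSplittingField.splits L P
  let Ω := AlgebraicClosure L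
  let i : L →+* Ω := algebraMap L Ω
  have : CharZero Ω := charZero_of_injective_algebraMap i.injective
  obtain ⟨B, hB⟩ := IsAlgClosed.exists_pow_nat_eq (-2 * ((v : Ω) + 1)) two_pos
  obtain ⟨G, hG⟩ := IsAlgClosed.exists_pow_nat_eq (2 * ((v : Ω) - 1)) two_pos
  have h₁' : (v : Ω) + 1 ≠ 0 := by exact_mod_cast h₁
  have h₂' : (v : Ω) - 1 ≠ 0 := by exact_mod_cast h₂
  have hB₀ : B ≠ 0 := by rintro rfl; simp_all
  have hG₀ : G ≠ 0 := by rintro rfl; simp_all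
  have hfac := quartic_eq_prod_ferrariRoot (F := Ω) (by exact_mod_cast hv) hB hG
  have hroot (x : Ω) (hx : 3 * x ^ 4 - 4 * x ^ 3 + 1 +
      3 * (((v : Ω) ^ 3 - 9 * (v : Ω)) / (9 * (1 - (v : Ω) ^ 2))) ^ 2 = 0) : ∃ y, i y = x := by
    refine hsplit.mem_range_of_isRoot
      ((Polynomial.map_ne_zero_iff (algebraMap ℚ L).injective).2 hP₀) ?_
    rw [Polynomial.map_map, IsRoot.def, eval_map_quartic hP, hx]
  obtain ⟨y₁, hy₁⟩ := hroot (ferrariRoot (v : Ω) B G) (by rw [hfac]; ring)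
  obtain ⟨y₂, hy₂⟩ := hroot (ferrariRoot (v : Ω) B (-G)) (by rw [hfac]; ring)
  obtain ⟨y₃, hy₃⟩ := hroot (ferrariRoot (v : Ω) (-B) G) (by rw [hfac]; ring)
  obtain ⟨β, rfl⟩ : ∃ β, i β = B := by
    refine ⟨(1 - v) / (3 / 2 * (y₁ + y₂) - 1), ?_⟩
    have h₃ : 1 - (v : Ω) ≠ 0 := fun h ↦ h₂' (by linear_combination -h)
    simp only [map_div₀, map_sub, map_mul, map_add, map_one, map_ratCast,
      _root_.map_ofNat, hy₁, hy₂]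
    rw [ferrariRoot_add_neg_right hB₀ hG₀, div_div_cancel₀ h₃]
  obtain ⟨γ, rfl⟩ : ∃ γ, i γ = G := by
    refine ⟨(1 + v) / (3 / 2 * (y₁ + y₃) - 1), ?_⟩
    have h₃ : 1 + (v : Ω) ≠ 0 := fun h ↦ h₁' (by linear_combination h)
    simp only [map_div₀, map_sub, map_mul, map_add, map_one, map_ratCast,
      _root_.map_ofNat, hy₁, hy₃]
    rw [ferrariRoot_add_neg_left hB₀ hG₀, div_div_cancel₀ h₃]
  have hβ : β ^ 2 = -2 * ((v : L) + 1) := i.injective (by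
    simp only [map_pow, map_mul, map_neg, map_add, map_one, map_ratCast, _root_.map_ofNat, hB])
  have hγ : γ ^ 2 = 2 * ((v : L) - 1) := i.injective (by simpa [_root_.map_ofNat] using hG)
  refine ⟨β, γ, by simp [hβ], by simp [hγ], fun σ hσβ hσγ ↦ ?_⟩
  suffices (σ : L →ₐ[ℚ] L) = AlgHom.id ℚ L from
    AlgEquiv.ext fun x ↦ by simpa using DFunLike.congr_fun this x
  refine AlgHom.ext_of_adjoin_eq_top (IsSplittingField.adjoin_rootSet L P) fun x hx ↦ ?_
  have hx' := (mem_rootSet.1 hx).2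
  rw [aeval_def, ← eval_map, eval_map_quartic hP,
    quartic_eq_prod_ferrariRoot (by exact_mod_cast hv) hβ hγ] at hx'
  simp only [mul_eq_zero, OfNat.ofNat_ne_zero, false_or, sub_eq_zero] at hx'
  rcases hx' with ((rfl | rfl) | rfl) | rfl <;> simp [ferrariRoot, hσβ, hσγ, _root_.map_ofNat]

theorem isSquare_two_mul_sub_one_iff {v : ℚ} :
    IsSquare (2 * (v - 1)) ↔ ∃ w : ℚ, v = 1 + 2 * w ^ 2 := by
  constructor
  · rintro ⟨r, hr⟩
    exact ⟨r / 2, by linarith⟩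
  · rintro ⟨w, rfl⟩
    exact ⟨2 * w, by ring⟩

theorem isSquare_neg_two_mul_add_one_iff {v : ℚ} :
    IsSquare (-2 * (v + 1)) ↔ ∃ w : ℚ, v = -1 - 2 * w ^ 2 := by
  constructor
  · rintro ⟨r, hr⟩
    exact ⟨r / 2, by linarith⟩
  · rintro ⟨w, rfl⟩
    exact ⟨2 * w, by ring⟩

theorem isSquare_mul_iff {v : ℚ} (hv : v ^ 2 ≠ 1) :
    IsSquare (-2 * (v + 1) * (2 * (v - 1))) ↔ ∃ w : ℚ, v = 2 * w / (1 + w ^ 2) := by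
  constructor
  · rintro ⟨r, hr⟩
    rcases eq_or_ne (2 + r) 0 with h | h
    · obtain rfl : r = -2 := by linarith
      exact ⟨0, by nlinarith⟩
    · refine ⟨2 * v / (2 + r), ?_⟩
      have hv₂ : (2 + r) ^ 2 + (2 * v) ^ 2 = 4 * (2 + r) := by linear_combination -hr
      have h₂ : 1 + (2 * v / (2 + r)) ^ 2 = 4 / (2 + r) := by
        field_simp
        linear_combination hv₂
      rw [h₂]
      field_simp
      ring
  · rintro ⟨w, rfl⟩
    have h : 1 + w ^ 2 ≠ 0 := by positivity
    refine ⟨2 * (1 - w ^ 2) / (1 + w ^ 2), ?_⟩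
    field_simp
    ring

/-- Let `v ∈ ℚ` with `v² ≠ 1`, let `c = (v³ − 9v)/(9(1 − v²))`, and let `G_c` be the Galois
group over `ℚ` of a splitting field of `P_c = 3x⁴ − 4x³ + 1 + 3c² ∈ ℚ[x]`.  If `v` has one of
the forms `1 + 2w²`, `−1 − 2w²`, or `2w/(1 + w²)` for some `w ∈ ℚ`, then `G_c ≅ ℤ/2ℤ`;
otherwise `G_c ≅ (ℤ/2ℤ) × (ℤ/2ℤ)`. -/
theorem stmt_17 (v : ℚ) (hv : v ^ 2 ≠ 1) (c : ℚ)
    (hc : c = (v ^ 3 - 9 * v) / (9 * (1 - v ^ 2))) (Pc : ℚ[X])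
    (hPc : Pc = C 3 * X ^ 4 - C 4 * X ^ 3 + 1 + C (3 * c ^ 2))
    (L : Type*) [Field L] [Algebra ℚ L] [IsSplittingField ℚ L Pc] :
    ((∃ w : ℚ, v = 1 + 2 * w ^ 2 ∨ v = -1 - 2 * w ^ 2 ∨ v = 2 * w / (1 + w ^ 2)) →
      Nonempty ((L ≃ₐ[ℚ] L) ≃* Multiplicative (ZMod 2))) ∧
    (¬ (∃ w : ℚ, v = 1 + 2 * w ^ 2 ∨ v = -1 - 2 * w ^ 2 ∨ v = 2 * w / (1 + w ^ 2)) →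
      Nonempty ((L ≃ₐ[ℚ] L) ≃* Multiplicative (ZMod 2 × ZMod 2))) := by
  subst hc
  obtain ⟨β, γ, hβ, hγ, hgen⟩ := exists_sqrts_of_isSplittingField hv hPc L
  have : FiniteDimensional ℚ L := IsSplittingField.finiteDimensional L Pc
  have : Normal ℚ L := Normal.of_isSplittingField Pc
  have : IsGalois ℚ L := ⟨⟩
  simp only [exists_or, ← isSquare_two_mul_sub_one_iff, ← isSquare_neg_two_mul_add_one_iff,
    ← isSquare_mul_iff hv]
  constructor
  · intro h
    refine ⟨mulEquivOfPrimeCardEq (p := 2)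
      (card_algEquiv_eq_two_of_isSquare hβ hγ hgen (by tauto) ?_) (by simp)⟩
    rintro ⟨h₁, h₂⟩
    linarith [h₁.nonneg, h₂.nonneg]
  · intro h
    push Not at h
    have := isKleinFour_algEquiv_of_not_isSquare hβ hγ hgen h.2.1 h.1 h.2.2
    exact IsKleinFour.nonempty_mulEquiv
end

section
/- Let F be a field of characteristic 0, let k ∈ F with k ≠ 0 and k ≠ −1/2, and let b ∈ F with b ≠ 0. Suppose the map φ(z) = kz + b/z has a point of period five in F; that is, there exist pairwise distinct nonzero elements z₀, z₁, z₂, z₃, z₄ ∈ F with z_{i+1 mod 5} = k·z_i + b/z_i for i = 0,…,4. Then the polynomial P(k,x) = k⁴x³ + a(k)x² + β(k)x + γ(k) has a root in F, where a(t) = 11t⁶ + 11t⁵ + 11t⁴ + 7t³ + 5t² + 2t + 1, β(t) = 19t⁸ + 38t⁷ + 57t⁶ + 60t⁵ + 55t⁴ + 38t³ + 24t² + 9t + 3, and γ(t) = (3t³ + 3t² + 3t + 1)²·(t⁴ + t³ + t² + t + 1). -/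
/-- The divided sum of differences along a 5-cycle of `z ↦ k z + b / z`: it vanishes on the
genuine 5-cycles and not on the fixed points. -/
def cycleObstruction {R : Type*} [CommRing R] (k z0 z1 z2 z3 z4 : R) : R :=
  z1 * z2 * z3 * z4 + (k * z0 + (k - 1) * z1) * (z2 * z3 * z4
    + (k * z1 + (k - 1) * z2) * (z3 * z4
      + (k * z2 + (k - 1) * z3) * (z4 + (k * z3 + (k - 1) * z4))))

theorem cycleObstruction_eq_zero {R : Type*} [CommRing R] [IsDomain R] {k b z0 z1 z2 z3 z4 : R}
    (h : z0 ≠ z1)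
    (h0 : z0 * z1 = k * z0 ^ 2 + b) (h1 : z1 * z2 = k * z1 ^ 2 + b)
    (h2 : z2 * z3 = k * z2 ^ 2 + b) (h3 : z3 * z4 = k * z3 ^ 2 + b)
    (h4 : z4 * z0 = k * z4 ^ 2 + b) : cycleObstruction k z0 z1 z2 z3 z4 = 0 := by
  refine (mul_eq_zero.mp ?_).resolve_left (sub_ne_zero.mpr h.symm)
  have e1 : z1 * (z2 - z1) = (k * z0 + (k - 1) * z1) * (z1 - z0) := by
    linear_combination h1 - h0
  have e2 : z2 * (z3 - z2) = (k * z1 + (k - 1) * z2) * (z2 - z1) := by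
    linear_combination h2 - h1
  have e3 : z3 * (z4 - z3) = (k * z2 + (k - 1) * z3) * (z3 - z2) := by
    linear_combination h3 - h2
  have e4 : z4 * (z0 - z4) = (k * z3 + (k - 1) * z4) * (z4 - z3) := by
    linear_combination h4 - h3
  unfold cycleObstruction
  linear_combination
    -(z2 * z3 * z4 + (k * z1 + (k - 1) * z2) * (z3 * z4
      + (k * z2 + (k - 1) * z3) * (z4 + (k * z3 + (k - 1) * z4)))) * e1
    - z1 * (z3 * z4 + (k * z2 + (k - 1) * z3) * (z4 + (k * z3 + (k - 1) * z4))) * e2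
    - z1 * z2 * (z4 + (k * z3 + (k - 1) * z4)) * e3 - z1 * z2 * z3 * e4

/-- The coefficient of the first recurrence relation in `sum_pow_four_of_cycle`. -/
def sumPowFourCofactor {R : Type*} [CommRing R] (k b z0 z1 z2 z3 z4 : R) : R :=
  (-10 * k ^ 9) * z0 ^ 2 + (-40 * k ^ 9 - 10 * k ^ 8) * (z0 * z1) + (-40 * k ^ 9) * (z0 * z2)
    + (-40 * k ^ 9) * (z0 * z3) + (-40 * k ^ 9 - 60 * k ^ 8 - 40 * k ^ 7
    - 10 * k ^ 6) * (z0 * z4) + (-60 * k ^ 9 - 40 * k ^ 8 - 10 * k ^ 7) * z1 ^ 2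
    + (-72 * k ^ 9 - 16 * k ^ 8 - 12 * k ^ 7 - 20 * k ^ 6 - 20 * k ^ 5 - 12 * k ^ 4 - 6 * k ^ 3
    - 2 * k ^ 2) * (z1 * z2)
    + (-24 * k ^ 9 + 8 * k ^ 8 - 24 * k ^ 7 - 40 * k ^ 6 - 40 * k ^ 5 - 24 * k ^ 4 - 12 * k ^ 3
    - 4 * k ^ 2) * (z1 * z3)
    + (-72 * k ^ 9 - 136 * k ^ 8 - 112 * k ^ 7 - 60 * k ^ 6 - 30 * k ^ 5 - 12 * k ^ 4 - 6 * k ^ 3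
    - 2 * k ^ 2) * (z1 * z4)
    + (72 * k ^ 10 + 144 * k ^ 9 + 148 * k ^ 8 + 84 * k ^ 7 + 52 * k ^ 6 + 22 * k ^ 5
    + 14 * k ^ 4 + 8 * k ^ 3 + 4 * k ^ 2 + 2 * k) * z2 ^ 2
    + (-48 * k ^ 9 - 132 * k ^ 8 - 184 * k ^ 7 - 144 * k ^ 6 - 112 * k ^ 5 - 58 * k ^ 4
    - 32 * k ^ 3 - 14 * k ^ 2 - 4 * k - 2) * (z2 * z3)
    + (-24 * k ^ 9 - 72 * k ^ 8 - 64 * k ^ 7 - 40 * k ^ 6 - 40 * k ^ 5 - 24 * k ^ 4 - 12 * k ^ 3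
    - 4 * k ^ 2) * (z2 * z4)
    + (-72 * k ^ 10 - 156 * k ^ 9 - 172 * k ^ 8 - 120 * k ^ 7 - 60 * k ^ 6 - 22 * k ^ 5
    - 6 * k ^ 4 - 2 * k ^ 3) * z3 ^ 2
    + (-18 * k ^ 8 - 36 * k ^ 7 - 34 * k ^ 6 - 22 * k ^ 5 - 10 * k ^ 4 - 8 * k ^ 3 - 6 * k ^ 2
    - 4 * k - 2) * b

theorem sum_pow_four_of_cycle {F : Type*} [Field F] [CharZero F] {k b z0 z1 z2 z3 z4 : F}
    (h0 : z0 * z1 = k * z0 ^ 2 + b) (h1 : z1 * z2 = k * z1 ^ 2 + b)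
    (h2 : z2 * z3 = k * z2 ^ 2 + b) (h3 : z3 * z4 = k * z3 ^ 2 + b)
    (h4 : z4 * z0 = k * z4 ^ 2 + b)
    (o0 : cycleObstruction k z0 z1 z2 z3 z4 = 0) (o1 : cycleObstruction k z1 z2 z3 z4 z0 = 0)
    (o2 : cycleObstruction k z2 z3 z4 z0 z1 = 0) (o3 : cycleObstruction k z3 z4 z0 z1 z2 = 0)
    (o4 : cycleObstruction k z4 z0 z1 z2 z3 = 0) :
    2 * k ^ 10 * ((z0 + z1 + z2 + z3 + z4) ^ 4) =
      (-20 * k ^ 9 - 20 * k ^ 8 - 20 * k ^ 7 - 14 * k ^ 6 - 11 * k ^ 5 - 6 * k ^ 4 - 3 * k ^ 3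
        - k ^ 2) * b * (z0 + z1 + z2 + z3 + z4) ^ 2
        + (4 * k ^ 7 + 8 * k ^ 6 + 9 * k ^ 5 + 6 * k ^ 4 + 3 * k ^ 3 + k ^ 2) * b * (z0 ^ 2
        + z1 ^ 2 + z2 ^ 2 + z3 ^ 2 + z4 ^ 2)
        + (-18 * k ^ 8 - 36 * k ^ 7 - 34 * k ^ 6 - 22 * k ^ 5 - 10 * k ^ 4 - 8 * k ^ 3
        - 6 * k ^ 2 - 4 * k - 2) * b ^ 2 := by
  refine mul_left_cancel₀ (show (5 : F) ≠ 0 by norm_num) ?_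
  unfold cycleObstruction at o0 o1 o2 o3 o4
  linear_combination (norm := skip)
    sumPowFourCofactor k b z0 z1 z2 z3 z4 * h0
    + sumPowFourCofactor k b z1 z2 z3 z4 z0 * h1
    + sumPowFourCofactor k b z2 z3 z4 z0 z1 * h2
    + sumPowFourCofactor k b z3 z4 z0 z1 z2 * h3
    + sumPowFourCofactor k b z4 z0 z1 z2 z3 * h4
    + (48 * k ^ 6 + 72 * k ^ 5 + 60 * k ^ 4 + 40 * k ^ 3 + 20 * k ^ 2 + 8 * k + 2) * (o0 + o1 + o2
      + o3 + o4)
  unfold sumPowFourCofactor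
  ring1

/-- The coefficient of the first recurrence relation in `sum_sq_mul_sq_sum_of_cycle`. -/
def sumSqMulSqSumCofactor {R : Type*} [CommRing R] (k b z0 z1 z2 z3 z4 : R) : R :=
  (-10 * k ^ 9) * z0 ^ 2 + (-20 * k ^ 9 - 10 * k ^ 8) * (z0 * z1) + (-20 * k ^ 9) * (z0 * z2)
    + (-20 * k ^ 9) * (z0 * z3) + (-20 * k ^ 9 - 20 * k ^ 8 - 20 * k ^ 7
    - 10 * k ^ 6) * (z0 * z4) + (-20 * k ^ 9 - 20 * k ^ 8 - 10 * k ^ 7) * z1 ^ 2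
    + (-20 * k ^ 9 - 8 * k ^ 8 - 4 * k ^ 5 - 4 * k ^ 4 - 2 * k ^ 3 - 2 * k ^ 2) * (z1 * z2)
    + (-20 * k ^ 9 + 4 * k ^ 8 - 8 * k ^ 5 - 8 * k ^ 4 - 4 * k ^ 3 - 4 * k ^ 2) * (z1 * z3)
    + (-20 * k ^ 9 - 28 * k ^ 8 - 40 * k ^ 7 - 20 * k ^ 6 - 14 * k ^ 5 - 4 * k ^ 4 - 2 * k ^ 3
    - 2 * k ^ 2) * (z1 * z4)
    + (20 * k ^ 10 + 8 * k ^ 9 + 52 * k ^ 8 + 28 * k ^ 7 + 24 * k ^ 6 + 10 * k ^ 5 + 2 * k ^ 4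
    + 4 * k ^ 3 + 2 * k) * z2 ^ 2
    + (-40 * k ^ 9 + 8 * k ^ 8 - 52 * k ^ 7 - 28 * k ^ 6 - 36 * k ^ 5 - 22 * k ^ 4 - 8 * k ^ 3
    - 10 * k ^ 2 - 2) * (z2 * z3)
    + (-20 * k ^ 9 + 4 * k ^ 8 - 20 * k ^ 7 - 8 * k ^ 5 - 8 * k ^ 4 - 4 * k ^ 3
    - 4 * k ^ 2) * (z2 * z4)
    + (-20 * k ^ 10 - 28 * k ^ 9 - 40 * k ^ 8 - 40 * k ^ 7 - 24 * k ^ 6 - 14 * k ^ 5 - 2 * k ^ 4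
    - 2 * k ^ 3) * z3 ^ 2
    + (-10 * k ^ 8 - 12 * k ^ 7 - 18 * k ^ 6 - 10 * k ^ 5 - 6 * k ^ 4 - 2 * k ^ 2 - 2) * b

theorem sum_sq_mul_sq_sum_of_cycle {F : Type*} [Field F] [CharZero F] {k b z0 z1 z2 z3 z4 : F}
    (h0 : z0 * z1 = k * z0 ^ 2 + b) (h1 : z1 * z2 = k * z1 ^ 2 + b)
    (h2 : z2 * z3 = k * z2 ^ 2 + b) (h3 : z3 * z4 = k * z3 ^ 2 + b)
    (h4 : z4 * z0 = k * z4 ^ 2 + b)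
    (o0 : cycleObstruction k z0 z1 z2 z3 z4 = 0) (o1 : cycleObstruction k z1 z2 z3 z4 z0 = 0)
    (o2 : cycleObstruction k z2 z3 z4 z0 z1 = 0) (o3 : cycleObstruction k z3 z4 z0 z1 z2 = 0)
    (o4 : cycleObstruction k z4 z0 z1 z2 z3 = 0) :
    2 * k ^ 10 * ((z0 + z1 + z2 + z3 + z4) ^ 2 * (z0 ^ 2 + z1 ^ 2 + z2 ^ 2 + z3 ^ 2 + z4 ^ 2)) =
      (-10 * k ^ 9 - 2 * k ^ 8 - 6 * k ^ 7 - 2 * k ^ 6 - 3 * k ^ 5 - 2 * k ^ 4 - k ^ 3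
        - k ^ 2) * b * (z0 + z1 + z2 + z3 + z4) ^ 2
        + (-2 * k ^ 9 - 2 * k ^ 8 - 2 * k ^ 7 + k ^ 5 + 2 * k ^ 4 + k ^ 3 + k ^ 2) * b * (z0 ^ 2
        + z1 ^ 2 + z2 ^ 2 + z3 ^ 2 + z4 ^ 2)
        + (-10 * k ^ 8 - 12 * k ^ 7 - 18 * k ^ 6 - 10 * k ^ 5 - 6 * k ^ 4 - 2 * k ^ 2
        - 2) * b ^ 2 := by
  refine mul_left_cancel₀ (show (5 : F) ≠ 0 by norm_num) ?_
  unfold cycleObstruction at o0 o1 o2 o3 o4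
  linear_combination (norm := skip)
    sumSqMulSqSumCofactor k b z0 z1 z2 z3 z4 * h0
    + sumSqMulSqSumCofactor k b z1 z2 z3 z4 z0 * h1
    + sumSqMulSqSumCofactor k b z2 z3 z4 z0 z1 * h2
    + sumSqMulSqSumCofactor k b z3 z4 z0 z1 z2 * h3
    + sumSqMulSqSumCofactor k b z4 z0 z1 z2 z3 * h4
    + (12 * k ^ 5 + 12 * k ^ 4 + 12 * k ^ 3 + 8 * k ^ 2 + 4 * k + 2) * (o0 + o1 + o2 + o3 + o4)
  unfold sumSqMulSqSumCofactor
  ring1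

/-- Let `F` be a field of characteristic 0, `k ∈ F \ {0, −1/2}` and `b ∈ F*`.  If the map
`φ(z) = kz + b/z` has a point of period five in `F` (i.e. there are pairwise distinct
nonzero `z₀, …, z₄ ∈ F` with `z_{i+1 mod 5} = k·z_i + b/z_i`), then the polynomial
`P(k,x) = k⁴x³ + a(k)x² + β(k)x + γ(k)` has a root in `F`, where
`a(t) = 11t⁶ + 11t⁵ + 11t⁴ + 7t³ + 5t² + 2t + 1`,
`β(t) = 19t⁸ + 38t⁷ + 57t⁶ + 60t⁵ + 55t⁴ + 38t³ + 24t² + 9t + 3`, and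
`γ(t) = (3t³ + 3t² + 3t + 1)²·(t⁴ + t³ + t² + t + 1)`. -/
theorem stmt_18 (F : Type*) [Field F] [CharZero F] (k b : F)
    (hk0 : k ≠ 0) (hk : k ≠ -1/2) (hb : b ≠ 0)
    (z : Fin 5 → F) (hzinj : Function.Injective z) (hz0 : ∀ i, z i ≠ 0)
    (hiter : ∀ i : Fin 5, z (i + 1) = k * z i + b / z i) :
    ∃ x : F,
      k ^ 4 * x ^ 3 +
        (11 * k ^ 6 + 11 * k ^ 5 + 11 * k ^ 4 + 7 * k ^ 3 + 5 * k ^ 2 + 2 * k + 1) * x ^ 2 +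
        (19 * k ^ 8 + 38 * k ^ 7 + 57 * k ^ 6 + 60 * k ^ 5 + 55 * k ^ 4 + 38 * k ^ 3 +
          24 * k ^ 2 + 9 * k + 3) * x +
        (3 * k ^ 3 + 3 * k ^ 2 + 3 * k + 1) ^ 2 * (k ^ 4 + k ^ 3 + k ^ 2 + k + 1) = 0 := by
  have hrec : ∀ i, z i * z (i + 1) = k * z i ^ 2 + b := fun i => by
    rw [hiter i]
    field_simp [hz0 i]
  have hne : ∀ i, z i ≠ z (i + 1) := fun i h => by
    have := hzinj h
    revert this
    fin_cases i <;> decide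
  have h0 : z 0 * z 1 = k * z 0 ^ 2 + b := hrec 0
  have h1 : z 1 * z 2 = k * z 1 ^ 2 + b := hrec 1
  have h2 : z 2 * z 3 = k * z 2 ^ 2 + b := hrec 2
  have h3 : z 3 * z 4 = k * z 3 ^ 2 + b := hrec 3
  have h4 : z 4 * z 0 = k * z 4 ^ 2 + b := hrec 4
  have o0 := cycleObstruction_eq_zero (hne 0) h0 h1 h2 h3 h4
  have o1 := cycleObstruction_eq_zero (hne 1) h1 h2 h3 h4 h0
  have o2 := cycleObstruction_eq_zero (hne 2) h2 h3 h4 h0 h1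
  have o3 := cycleObstruction_eq_zero (hne 3) h3 h4 h0 h1 h2
  have o4 := cycleObstruction_eq_zero (hne 4) h4 h0 h1 h2 h3
  have hA := sum_pow_four_of_cycle h0 h1 h2 h3 h4 o0 o1 o2 o3 o4
  have hB := sum_sq_mul_sq_sum_of_cycle h0 h1 h2 h3 h4 o0 o1 o2 o3 o4
  generalize z 0 + z 1 + z 2 + z 3 + z 4 = s at hA hB
  generalize z 0 ^ 2 + z 1 ^ 2 + z 2 ^ 2 + z 3 ^ 2 + z 4 ^ 2 = y at hA hB
  refine ⟨k ^ 3 * s ^ 2 / b, ?_⟩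
  field_simp
  refine mul_left_cancel₀ (show 4 * k ^ 7 ≠ 0 by simp [hk0]) ?_
  linear_combination
    (2 * k ^ 10 * s ^ 2 - (-2 * k ^ 9 - 2 * k ^ 8 - 2 * k ^ 7 + k ^ 5 + 2 * k ^ 4 + k ^ 3
      + k ^ 2) * b) * hA
    + (4 * k ^ 7 + 8 * k ^ 6 + 9 * k ^ 5 + 6 * k ^ 4 + 3 * k ^ 3 + k ^ 2) * b * hB
end
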